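/- Let n ≥ 3 and let F = (α+β)²/α be a square metric on a connected open set U ⊆ ℝⁿ (with 0 < b² < 1 on U). Then F is of scalar flag curvature on U if and only if F is locally projectively flat, i.e., every point of U has an open neighborhood V and a smooth diffeomorphism φ from V onto an open subset W ⊆ ℝⁿ such that the geodesic coefficients Ĝⁱ of the transported metric F̂(u,v) := F(φ⁻¹(u), D(φ⁻¹)ᵤ(v)) satisfy Ĝⁱ(u,v) = P(u,v)·vⁱ for some function P on W × (ℝⁿ∖{0}). -/

import Mathlib

open scoped BigOperators

noncomputable section

abbrev Vec (n : ℕ) := Fin n → ℝ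

/-- Partial derivative of a function on `ℝⁿ` in the `k`-th coordinate direction. -/
def pd {n : ℕ} (f : Vec n → ℝ) (k : Fin n) (x : Vec n) : ℝ :=
  fderiv ℝ f x (Pi.single k 1)

/-- Partial derivative in the base (`x`) variable of a function of `(x, y)`. -/
def pdx {n : ℕ} (f : Vec n → Vec n → ℝ) (k : Fin n) (x y : Vec n) : ℝ :=
  fderiv ℝ (fun x' => f x' y) x (Pi.single k 1)

/-- Partial derivative in the fiber (`y`) variable of a function of `(x, y)`. -/
def pdy {n : ℕ} (f : Vec n → Vec n → ℝ) (k : Fin n) (x y : Vec n) : ℝ :=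
  fderiv ℝ (fun y' => f x y') y (Pi.single k 1)

/-- The fundamental tensor `g_{ij} = ½ ∂²(F²)/∂yⁱ∂yʲ` of a Finsler metric `F`. -/
def fundTensor {n : ℕ} (F : Vec n → Vec n → ℝ) (x y : Vec n) : Matrix (Fin n) (Fin n) ℝ :=
  Matrix.of fun i j => (1/2) * pdy (fun x y => pdy (fun x y => (F x y)^2) j x y) i x y

/-- The geodesic coefficients `Gⁱ = ¼ g^{il}(yᵏ ∂²(F²)/∂xᵏ∂yˡ − ∂(F²)/∂xˡ)`. -/
def geoCoeff {n : ℕ} (F : Vec n → Vec n → ℝ) (i : Fin n) (x y : Vec n) : ℝ :=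
  (1/4) * ∑ l, (fundTensor F x y)⁻¹ i l *
    ((∑ k, y k * pdx (fun x y => pdy (fun x y => (F x y)^2) l x y) k x y)
      - pdx (fun x y => (F x y)^2) l x y)

/-- Riemann curvature `Rⁱ_k` associated to a spray `G`. -/
def curvOfSpray {n : ℕ} (G : Fin n → Vec n → Vec n → ℝ) (i k : Fin n) (x y : Vec n) : ℝ :=
  2 * pdx (G i) k x y
  - ∑ j, y j * pdx (fun x y => pdy (G i) k x y) j x y
  + 2 * ∑ j, G j x y * pdy (fun x y => pdy (G i) k x y) j x y
  - ∑ j, pdy (G i) j x y * pdy (G j) k x y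

/-- Christoffel symbols `Γᵏ_{ij}` of a Riemannian metric field. -/
def christoffel {n : ℕ} (g : Vec n → Matrix (Fin n) (Fin n) ℝ) (k i j : Fin n) (x : Vec n) : ℝ :=
  (1/2) * ∑ l, (g x)⁻¹ k l *
    (pd (fun x => g x l i) j x + pd (fun x => g x l j) i x - pd (fun x => g x i j) l x)

/-- The geodesic spray `Gⁱ_α = ½ Γⁱ_{jk} yʲ yᵏ` of a Riemannian metric. -/
def sprayOf {n : ℕ} (g : Vec n → Matrix (Fin n) (Fin n) ℝ) (i : Fin n) (x y : Vec n) : ℝ :=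
  (1/2) * ∑ j, ∑ k, christoffel g i j k x * y j * y k

/-- Covariant derivative `b_{i|j}` of a 1-form w.r.t. a Riemannian metric. -/
def covDeriv {n : ℕ} (g : Vec n → Matrix (Fin n) (Fin n) ℝ) (b : Vec n → Vec n)
    (i j : Fin n) (x : Vec n) : ℝ :=
  pd (fun x => b x i) j x - ∑ k, b x k * christoffel g k i j x

/-- `b² = a^{ij} b_i b_j`. -/
def bsq {n : ℕ} (a : Vec n → Matrix (Fin n) (Fin n) ℝ) (b : Vec n → Vec n) (x : Vec n) : ℝ :=
  ∑ i, ∑ j, (a x)⁻¹ i j * b x i * b x j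

/-- `α(x,y) = √(a_{ij}(x) yⁱ yʲ)`. -/
def alphaOf {n : ℕ} (a : Vec n → Matrix (Fin n) (Fin n) ℝ) (x y : Vec n) : ℝ :=
  Real.sqrt (∑ i, ∑ j, a x i j * y i * y j)

/-- `β(x,y) = b_i(x) yⁱ`. -/
def betaOf {n : ℕ} (b : Vec n → Vec n) (x y : Vec n) : ℝ := ∑ i, b x i * y i

/-- The square metric `F = (α+β)²/α`. -/
def sqMetric {n : ℕ} (a : Vec n → Matrix (Fin n) (Fin n) ℝ) (b : Vec n → Vec n)
    (x y : Vec n) : ℝ :=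
  (alphaOf a x y + betaOf b x y)^2 / alphaOf a x y

/-- `F` is of scalar flag curvature on `U`. -/
def IsScalarFlag {n : ℕ} (U : Set (Vec n)) (F : Vec n → Vec n → ℝ) : Prop :=
  ∃ K : Vec n → Vec n → ℝ, ∀ x ∈ U, ∀ y : Vec n, y ≠ 0 → ∀ i k : Fin n,
    curvOfSpray (geoCoeff F) i k x y =
      K x y * ((F x y)^2 * (if i = k then (1:ℝ) else 0)
        - y i * ∑ j, fundTensor F x y k j * y j)

/-- Conditions (E1)–(E3). -/
def E123 {n : ℕ} (U : Set (Vec n)) (a : Vec n → Matrix (Fin n) (Fin n) ℝ)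
    (b : Vec n → Vec n) (τ lam : Vec n → ℝ) : Prop :=
  (∀ x ∈ U, ∀ i j : Fin n, covDeriv a b i j x =
      τ x * ((1 + 2 * bsq a b x) * a x i j - 3 * b x i * b x j)) ∧
  (∀ x ∈ U, ∀ y : Vec n, ∀ i k : Fin n,
      curvOfSpray (sprayOf a) i k x y =
        lam x * ((alphaOf a x y)^2 * (if i = k then (1:ℝ) else 0)
            - y i * (∑ j, a x k j * y j))
        + 2 * (lam x + 4 * (2 + bsq a b x) * (τ x)^2) *
          ((betaOf b x y)^2 * (if i = k then (1:ℝ) else 0)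
            + (alphaOf a x y)^2 * (∑ j, (a x)⁻¹ i j * b x j) * b x k
            - betaOf b x y * (∑ j, (a x)⁻¹ i j * b x j) * (∑ j, a x k j * y j)
            - betaOf b x y * b x k * y i)) ∧
  (∀ x ∈ U, ∀ i : Fin n, pd τ i x =
      (-(7 + 4 * bsq a b x) * (τ x)^2 - lam x) * b x i)

/-- `F` is locally projectively flat on `U`: around every point there is a smooth
diffeomorphism `φ` (with smooth inverse `ψ`) onto an open set `W` such that the
geodesic coefficients of the transported metric
`F̂(u,v) = F(ψ(u), Dψ_u(v))` satisfy `Ĝⁱ(u,v) = P(u,v)·vⁱ`. -/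
def IsLocallyProjFlat {n : ℕ} (U : Set (Vec n)) (F : Vec n → Vec n → ℝ) : Prop :=
  ∀ x ∈ U, ∃ V : Set (Vec n), IsOpen V ∧ x ∈ V ∧ V ⊆ U ∧
    ∃ W : Set (Vec n), IsOpen W ∧
    ∃ φ ψ : Vec n → Vec n,
      ContDiffOn ℝ (⊤ : ℕ∞) φ V ∧ ContDiffOn ℝ (⊤ : ℕ∞) ψ W ∧
      Set.MapsTo φ V W ∧ Set.MapsTo ψ W V ∧
      (∀ z ∈ V, ψ (φ z) = z) ∧ (∀ u ∈ W, φ (ψ u) = u) ∧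
      ∃ P : Vec n → Vec n → ℝ, ∀ u ∈ W, ∀ v : Vec n, v ≠ 0 → ∀ i : Fin n,
        geoCoeff (fun u' v' => F (ψ u') (fderiv ℝ ψ u' v')) i u v = P u v * v i

section SmoothAlgebra

open TopologicalSpace

set_option linter.unusedSectionVars false

variable {E : Type*} [NormedAddCommGroup E] [NormedSpace ℝ E]

/-- Extension by zero of a function on an open set. -/
def extZero (Ω : Opens E) (f : Ω → ℝ) : E → ℝ := Function.extend Subtype.val f 0

lemma extZero_coe (Ω : Opens E) (f : Ω → ℝ) (p : Ω) : extZero Ω f p = f p :=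
  Subtype.val_injective.extend_apply _ _ _

lemma contDiffOn_extZero_iff {Ω : Opens E} {f : Ω → ℝ} {g : E → ℝ} (h : ∀ p : Ω, f p = g p) :
    ContDiffOn ℝ (⊤ : ℕ∞) (extZero Ω f) Ω ↔ ContDiffOn ℝ (⊤ : ℕ∞) g Ω :=
  contDiffOn_congr fun p hp => (extZero_coe Ω f ⟨p, hp⟩).trans (h ⟨p, hp⟩)

/-- The subalgebra of smooth real functions on an open set of a normed space. -/
def smoothSubalgebra (Ω : Opens E) : Subalgebra ℝ (Ω → ℝ) where
  carrier := {f | ContDiffOn ℝ (⊤ : ℕ∞) (extZero Ω f) Ω}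
  mul_mem' {f g} hf hg := (contDiffOn_extZero_iff (g := extZero Ω f * extZero Ω g)
    fun p => by simp [extZero_coe]).2 (hf.mul hg)
  add_mem' {f g} hf hg := (contDiffOn_extZero_iff (g := extZero Ω f + extZero Ω g)
    fun p => by simp [extZero_coe]).2 (hf.add hg)
  algebraMap_mem' r := (contDiffOn_extZero_iff (g := fun _ => r) fun p => by simp).2
    contDiffOn_const

/-- The algebra of smooth real functions on an open set of a normed space. -/
def SmoothAlg (Ω : Opens E) : Type _ := smoothSubalgebra Ω

instance (Ω : Opens E) : CommRing (SmoothAlg Ω) := inferInstanceAs (CommRing (smoothSubalgebra Ω))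

instance (Ω : Opens E) : Algebra ℝ (SmoothAlg Ω) :=
  inferInstanceAs (Algebra ℝ (smoothSubalgebra Ω))

namespace SmoothAlg

variable {Ω : Opens E}

/-- The element of `SmoothAlg Ω` given by a function smooth on `Ω`. -/
def mk (g : E → ℝ) (hg : ContDiffOn ℝ (⊤ : ℕ∞) g Ω) : SmoothAlg Ω :=
  ⟨fun p => g p, (contDiffOn_extZero_iff fun _ => rfl).2 hg⟩

/-- Evaluation at a point, as an algebra homomorphism. -/
def ev (p : Ω) : SmoothAlg Ω →ₐ[ℝ] ℝ := (Pi.evalAlgHom ℝ (fun _ : Ω => ℝ) p).comp (smoothSubalgebra Ω).val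

@[simp] lemma ev_mk (g : E → ℝ) (hg : ContDiffOn ℝ (⊤ : ℕ∞) g Ω) (p : Ω) : ev p (mk g hg) = g p := rfl

lemma ext_ev {f g : SmoothAlg Ω} (h : ∀ p, ev p f = ev p g) : f = g :=
  Subtype.ext (funext h)

/-- The smooth extension by zero to the ambient space. -/
def toFn (f : SmoothAlg Ω) : E → ℝ := extZero Ω f.1

lemma toFn_coe (f : SmoothAlg Ω) (p : Ω) : (toFn f) p = ev p f := extZero_coe Ω _ p

lemma contDiffOn_toFn (f : SmoothAlg Ω) : ContDiffOn ℝ (⊤ : ℕ∞) (toFn f) Ω := f.2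

lemma contDiffAt_toFn (f : SmoothAlg Ω) (p : Ω) : ContDiffAt ℝ (⊤ : ℕ∞) (toFn f) p :=
  (contDiffOn_toFn f).contDiffAt (Ω.isOpen.mem_nhds p.2)

lemma differentiableAt_toFn (f : SmoothAlg Ω) (p : Ω) : DifferentiableAt ℝ (toFn f) p :=
  (contDiffAt_toFn f p).differentiableAt (by simp)

lemma toFn_eventuallyEq (f : SmoothAlg Ω) {g : E → ℝ} (h : ∀ p : Ω, ev p f = g p) (p : Ω) :
    (toFn f) =ᶠ[nhds (p : E)] g := by
  filter_upwards [Ω.isOpen.mem_nhds p.2] with q hq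
  exact (toFn_coe f ⟨q, hq⟩).trans (h ⟨q, hq⟩)

/-- The directional derivative in a fixed direction, as a function. -/
def dirFun (w : E) (f : SmoothAlg Ω) : SmoothAlg Ω :=
  mk (fun p => fderiv ℝ (toFn f) p w)
    (((contDiffOn_toFn f).fderiv_of_isOpen Ω.isOpen (by simp)).clm_apply contDiffOn_const)

lemma ev_dirFun (w : E) (f : SmoothAlg Ω) {g : E → ℝ} (h : ∀ p : Ω, ev p f = g p) (p : Ω) :
    ev p (dirFun w f) = fderiv ℝ g p w := by
  rw [dirFun, ev_mk, (toFn_eventuallyEq f h p).fderiv_eq]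

/-- The directional derivative in a fixed direction, as a derivation. -/
def dir (w : E) : Derivation ℝ (SmoothAlg Ω) (SmoothAlg Ω) :=
  Derivation.mk'
    { toFun := dirFun w
      map_add' := fun f g => ext_ev fun p => by
        rw [ev_dirFun w (f + g) (g := (toFn f) + (toFn g)) (fun q => by simp [toFn_coe]),
          fderiv_add (differentiableAt_toFn f p) (differentiableAt_toFn g p)]
        rfl
      map_smul' := fun c f => ext_ev fun p => by
        rw [ev_dirFun w (c • f) (g := c • (toFn f)) (fun q => by simp [toFn_coe]),
          fderiv_const_smul (differentiableAt_toFn f p)]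
        rfl }
    fun f g => ext_ev fun p => by
      change ev p (dirFun w (f * g)) = _
      rw [ev_dirFun w (f * g) (g := (toFn f) * (toFn g)) (fun q => by simp [toFn_coe]),
          fderiv_mul (differentiableAt_toFn f p) (differentiableAt_toFn g p)]
      simp only [smul_eq_mul, map_add, map_mul, ← toFn_coe f, ← toFn_coe g]
      rfl

lemma ev_dir (w : E) (f : SmoothAlg Ω) {g : E → ℝ} (h : ∀ p : Ω, ev p f = g p) (p : Ω) :
    ev p (dir w f) = fderiv ℝ g p w := ev_dirFun w f h p

lemma ev_dir_toFn (w : E) (f : SmoothAlg Ω) (p : Ω) :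
    ev p (dir w f) = fderiv ℝ (toFn f) p w := rfl

lemma dir_comm (v w : E) (f : SmoothAlg Ω) : dir v (dir w f) = dir w (dir v f) := by
  refine ext_ev fun p => ?_
  have key : ∀ v w : E, ev p (dir v (dir w f)) = fderiv ℝ (fderiv ℝ (toFn f)) p v w := by
    intro v w
    rw [ev_dir v (dir w f) (g := fun q => fderiv ℝ (toFn f) q w) (ev_dir_toFn w f), fderiv_clm_apply _ (by fun_prop)]
    · simp
    · exact (((contDiffAt_toFn f p).fderiv_right (m := (⊤ : ℕ∞)) (by simp)).differentiableAt
        (by simp))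
  rw [key, key]
  exact ((contDiffAt_toFn f p).isSymmSndFDerivAt (by
    simpa using WithTop.coe_le_coe.2 (le_top : (2 : ℕ∞) ≤ ⊤))).eq v w

/-- The inverse of a nowhere vanishing smooth function. -/
lemma exists_inv (f : SmoothAlg Ω) (h : ∀ p, ev p f ≠ 0) : ∃ g, f * g = 1 :=
  ⟨mk (fun p => ((toFn f) p)⁻¹) ((contDiffOn_toFn f).inv fun p hp => by
      simpa [toFn_coe f ⟨p, hp⟩] using h ⟨p, hp⟩),
    ext_ev fun p => by simp [toFn_coe, h p]⟩

end SmoothAlg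

end SmoothAlgebra

/-- Commuting base and fibre derivations `X`, `Y` on a ring of functions of `(x, y)`,
together with the fibre coordinates `y`. -/
structure TanCalc (n : ℕ) (A : Type*) [CommRing A] [Algebra ℝ A] where
  X : Fin n → Derivation ℝ A A
  Y : Fin n → Derivation ℝ A A
  y : Fin n → A
  XX : ∀ i j f, X i (X j f) = X j (X i f)
  YX : ∀ i j f, Y i (X j f) = X j (Y i f)
  YY : ∀ i j f, Y i (Y j f) = Y j (Y i f)
  Yy : ∀ k i, Y k (y i) = if i = k then 1 else 0
  Xy : ∀ k i, X k (y i) = 0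

namespace TanCalc

variable {n : ℕ} {A : Type*} [CommRing A] [Algebra ℝ A] (T : TanCalc n A)

/-- The horizontal operator `yᵏ ∂/∂xᵏ`. -/
def hor : Derivation ℝ A A := ∑ k, T.y k • T.X k

/-- The vertical operator `Vᵏ ∂/∂yᵏ`. -/
def vert (V : Fin n → A) : Derivation ℝ A A := ∑ k, V k • T.Y k

lemma _root_.Derivation.finset_sum_apply {ι : Type*} (s : Finset ι) (D : ι → Derivation ℝ A A)
    (f : A) : (∑ i ∈ s, D i) f = ∑ i ∈ s, D i f := by
  classical
  induction s using Finset.induction_on with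
  | empty => simp
  | insert a s ha ih => simp [Finset.sum_insert ha, ih]

lemma hor_apply (f : A) : T.hor f = ∑ k, T.y k * T.X k f := by
  simp [hor, Derivation.finset_sum_apply]

lemma vert_apply (V : Fin n → A) (f : A) : T.vert V f = ∑ k, V k * T.Y k f := by
  simp [vert, Derivation.finset_sum_apply]

/-- The Riemann curvature of a spray. -/
def curv (G : Fin n → A) (i k : Fin n) : A :=
  2 * T.X k (G i) - T.hor (T.Y k (G i)) + 2 * T.vert G (T.Y k (G i))
    - T.vert (fun j => T.Y k (G j)) (G i)

/-- The Euler-Lagrange expression of `L` along the spray `G`. -/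
def EL (L : A) (G : Fin n → A) (l : Fin n) : A :=
  T.hor (T.Y l L) - T.X l L - 2 * T.vert G (T.Y l L)

lemma vert_add (V W : Fin n → A) (f : A) : T.vert (fun j => V j + W j) f = T.vert V f + T.vert W f := by
  simp [vert_apply, add_mul, Finset.sum_add_distrib]

lemma vert_sub (V W : Fin n → A) (f : A) : T.vert (fun j => V j - W j) f = T.vert V f - T.vert W f := by
  simp [vert_apply, sub_mul, Finset.sum_sub_distrib]

lemma vert_smul (a : A) (V : Fin n → A) (f : A) : T.vert (fun j => a * V j) f = a * T.vert V f := by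
  simp [vert_apply, Finset.mul_sum, mul_assoc]

lemma vert_ite (k : Fin n) (f : A) : T.vert (fun j => if j = k then 1 else 0) f = T.Y k f := by
  simp [vert_apply]

lemma Y_vert (k : Fin n) (V : Fin n → A) (f : A) :
    T.Y k (T.vert V f) = T.vert (fun j => T.Y k (V j)) f + T.vert V (T.Y k f) := by
  simp only [vert_apply, map_sum, Derivation.leibniz, smul_eq_mul, ← Finset.sum_add_distrib]
  exact Finset.sum_congr rfl fun j _ => by rw [T.YY k j]; ring

lemma X_vert (k : Fin n) (V : Fin n → A) (f : A) :
    T.X k (T.vert V f) = T.vert (fun j => T.X k (V j)) f + T.vert V (T.X k f) := by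
  simp only [vert_apply, map_sum, Derivation.leibniz, smul_eq_mul, ← Finset.sum_add_distrib]
  exact Finset.sum_congr rfl fun j _ => by rw [← T.YX j k]; ring

lemma Y_hor (k : Fin n) (f : A) : T.Y k (T.hor f) = T.X k f + T.hor (T.Y k f) := by
  simp only [hor_apply, map_sum, Derivation.leibniz, smul_eq_mul, T.Yy, T.YX,
    Finset.sum_add_distrib]
  simp [add_comm]

lemma X_hor (k : Fin n) (f : A) : T.X k (T.hor f) = T.hor (T.X k f) := by
  simp only [hor_apply, map_sum, Derivation.leibniz, smul_eq_mul, T.Xy, T.XX k]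
  simp

lemma vert_coord (V : Fin n → A) (i : Fin n) : T.vert V (T.y i) = V i := by
  simp [vert_apply, T.Yy]

lemma hor_coord (i : Fin n) : T.hor (T.y i) = 0 := by
  simp [hor_apply, T.Xy]

/-- The Euler operator `yᵏ ∂/∂yᵏ`. -/
def euler : Derivation ℝ A A := T.vert T.y

lemma Y_euler (k : Fin n) (f : A) : T.Y k (T.euler f) = T.Y k f + T.euler (T.Y k f) := by
  rw [euler, Y_vert]
  congr 1
  simp [vert_apply, T.Yy]

lemma X_euler (k : Fin n) (f : A) : T.X k (T.euler f) = T.euler (T.X k f) := by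
  rw [euler, X_vert]
  simp [vert_apply, T.Xy]

lemma euler_hor (f : A) : T.euler (T.hor f) = T.hor f + T.hor (T.euler f) := by
  have h : T.hor (T.euler f) = ∑ k, T.y k * T.hor (T.Y k f) := by
    rw [euler, vert_apply, map_sum]; simp [hor_coord, Derivation.leibniz]
  rw [h, euler, vert_apply]
  simp only [Y_hor, mul_add, Finset.sum_add_distrib, ← hor_apply]

lemma euler_vert (V : Fin n → A) (f : A) :
    T.euler (T.vert V f) = T.vert (fun j => T.euler (V j)) f + T.vert V (T.euler f) - T.vert V f := by
  have : ∀ j, T.euler (T.Y j f) = T.Y j (T.euler f) - T.Y j f := fun j => by rw [Y_euler]; ring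
  simp only [vert_apply T V, map_sum, Derivation.leibniz, smul_eq_mul, this]
  rw [vert_apply, ← Finset.sum_add_distrib, ← Finset.sum_sub_distrib]
  exact Finset.sum_congr rfl fun j _ => by ring

lemma euler_coord (i : Fin n) : T.euler (T.y i) = T.y i := T.vert_coord _ _

lemma euler_Y_two {f : A} (h : T.euler f = 2 * f) (k : Fin n) : T.euler (T.Y k f) = T.Y k f := by
  have := T.Y_euler k f
  rw [h, two_mul, map_add] at this
  linear_combination -this

lemma euler_Y_one {f : A} (h : T.euler f = f) (k : Fin n) : T.euler (T.Y k f) = 0 := by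
  have := T.Y_euler k f
  rw [h] at this
  linear_combination -this

/-- Curvature of a projective change of spray. -/
lemma curv_projective {G : Fin n → A} {P : A} (hG : ∀ i, T.euler (G i) = 2 * G i)
    (hP : T.euler P = P) (i k : Fin n) :
    T.curv (fun i => G i + P * T.y i) i k = T.curv G i k
      + (P ^ 2 - T.hor P + 2 * T.vert G P) * (if i = k then 1 else 0)
      + (2 * T.X k P - T.hor (T.Y k P) + 2 * T.vert G (T.Y k P) - P * T.Y k P
          - T.vert (fun j => T.Y k (G j)) P) * T.y i := by
  have h1 : ∀ j, T.Y k (G j + P * T.y j) = T.Y k (G j) + (T.Y k P * T.y j + P * if j = k then 1 else 0) := by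
    intro j
    simp only [map_add, Derivation.leibniz, smul_eq_mul, T.Yy]; ring
  have hc : ∀ D : Derivation ℝ A A, D (if i = k then 1 else 0) = 0 := by
    intro D; split_ifs <;> simp
  have hGk := T.euler_Y_two (hG i) k
  have hPk := T.euler_Y_one hP k
  have hGi := hG i
  simp only [euler] at hGk hPk hGi hP
  simp only [curv, h1, vert_add, vert_smul, vert_ite]
  simp only [map_add, Derivation.leibniz, smul_eq_mul, hc, hor_coord, vert_coord, T.Xy, hGk, hPk,
    hP, hGi]
  ring

lemma curv_contract {G : Fin n → A} (hG : ∀ i, T.euler (G i) = 2 * G i) (i : Fin n) :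
    ∑ k, T.curv G i k * T.y k = 0 := by
  have h2 : T.hor (T.euler (G i)) = ∑ k, T.y k * T.hor (T.Y k (G i)) := by
    rw [euler, vert_apply, map_sum]; simp [hor_coord, Derivation.leibniz]
  have h3 : T.vert G (T.euler (G i)) = T.vert G (G i) + ∑ k, T.y k * T.vert G (T.Y k (G i)) := by
    rw [euler, vert_apply T T.y, map_sum]
    simp only [Derivation.leibniz, vert_coord, smul_eq_mul, Finset.sum_add_distrib]
    rw [vert_apply T G (G i)]
    simp only [mul_comm, add_comm]
  have h4 : ∑ k, T.y k * T.vert (fun j => T.Y k (G j)) (G i) = 2 * T.vert G (G i) := by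
    simp only [vert_apply, Finset.mul_sum]
    rw [Finset.sum_comm]
    refine Finset.sum_congr rfl fun j _ => ?_
    have := hG j
    rw [euler, vert_apply] at this
    rw [← mul_assoc, ← this, Finset.sum_mul]
    exact Finset.sum_congr rfl fun _ _ => by ring
  have h1 := T.hor_apply (G i)
  rw [hG, two_mul, map_add] at h2 h3
  have : ∀ k, T.curv G i k * T.y k = 2 * (T.y k * T.X k (G i)) - T.y k * T.hor (T.Y k (G i))
      + 2 * (T.y k * T.vert G (T.Y k (G i))) - T.y k * T.vert (fun j => T.Y k (G j)) (G i) :=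
    fun k => by rw [curv]; ring
  simp only [this, Finset.sum_sub_distrib, Finset.sum_add_distrib, ← Finset.mul_sum, h4, ← h1]
  linear_combination h2 - 2 * h3

/-- The curvature of the spray of `L` is `L`-orthogonal to the fibre coordinate. -/
lemma curv_orthogonal {G : Fin n → A} {L : A}
    (hEL : ∀ l, T.EL L G l = 0) (hc : T.hor L = 2 * T.vert G L) (k : Fin n) :
    ∑ i, T.Y i L * (2 * T.curv G i k) = 0 := by
  have hA : ∀ l, T.X l L = T.vert (fun j => T.Y l (G j)) L := by
    intro l
    have e1 := congrArg (T.Y l) hc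
    have e2 := hEL l
    rw [two_mul, map_add, Y_hor, Y_vert] at e1
    rw [EL] at e2
    have e3 : 2 * (T.X l L - T.vert (fun j => T.Y l (G j)) L) = 0 := by
      linear_combination e1 - e2
    have : (algebraMap ℝ A (1/2)) * 2 = 1 := by
      rw [← map_ofNat (algebraMap ℝ A) 2, ← map_mul]; norm_num
    linear_combination (algebraMap ℝ A (1/2)) * e3 - (T.X l L - T.vert (fun j => T.Y l (G j)) L) * this
  have sumvert : ∀ V : Fin n → A, ∑ i, T.Y i L * V i = T.vert V L := fun V => by
    rw [vert_apply]; exact Finset.sum_congr rfl fun _ _ => mul_comm _ _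
  have hX : ∑ i, T.Y i L * T.X k (G i) = T.vert (fun i => T.X k (G i)) L := sumvert _
  have hB := congrArg (T.X k) hc
  rw [X_hor, two_mul, map_add, X_vert] at hB
  -- horizontal derivative of `hA`
  have hH := congrArg T.hor (hA k)
  have hH' : T.hor (T.vert (fun j => T.Y k (G j)) L)
      = ∑ i, T.Y i L * T.hor (T.Y k (G i)) + T.vert (fun j => T.Y k (G j)) (T.hor L)
        - T.vert (fun j => T.Y k (G j)) L * 0 - ∑ i, T.Y k (G i) * T.X i L := by
    rw [vert_apply T _ (T.hor L)]
    simp only [Y_hor, mul_add, Finset.sum_add_distrib]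
    rw [vert_apply, map_sum]
    simp only [Derivation.leibniz, smul_eq_mul, Finset.sum_add_distrib]
    ring
  have hV := congrArg (T.vert G) (hA k)
  have hV' : T.vert G (T.vert (fun j => T.Y k (G j)) L)
      = ∑ i, T.Y i L * T.vert G (T.Y k (G i)) + ∑ i, T.Y k (G i) * T.vert G (T.Y i L) := by
    rw [vert_apply T _ L, map_sum]
    simp only [Derivation.leibniz, smul_eq_mul, Finset.sum_add_distrib]
    ring
  have hVX : T.vert G (T.X k L) = T.vert G (T.X k L) := rfl
  have hM : ∑ i, T.Y i L * T.vert (fun j => T.Y k (G j)) (G i)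
      = ∑ j, T.Y k (G j) * T.vert (fun i => T.Y j (G i)) L := by
    simp only [vert_apply, Finset.mul_sum]
    rw [Finset.sum_comm]
    exact Finset.sum_congr rfl fun i _ => Finset.sum_congr rfl fun j _ => by ring
  have hE : ∑ i, T.Y k (G i) * T.EL L G i = 0 :=
    Finset.sum_eq_zero fun i _ => by rw [hEL, mul_zero]
  have hhor : T.vert (fun j => T.Y k (G j)) (T.hor L) = ∑ i, T.Y k (G i) * T.X i L
      + ∑ i, T.Y k (G i) * T.hor (T.Y i L) := by
    rw [vert_apply]; simp only [Y_hor, mul_add, Finset.sum_add_distrib]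
  simp only [← hA] at hM
  simp only [EL, mul_sub, Finset.sum_sub_distrib] at hE
  have e2 : ∑ i, T.Y k (G i) * (2 * T.vert G (T.Y i L)) = 2 * ∑ i, T.Y k (G i) * T.vert G (T.Y i L) := by
    rw [Finset.mul_sum]; exact Finset.sum_congr rfl fun _ _ => by ring
  have hsplit : ∑ i, T.Y i L * (2 * T.curv G i k) = 2 * (2 * ∑ i, T.Y i L * T.X k (G i)
      - ∑ i, T.Y i L * T.hor (T.Y k (G i)) + 2 * ∑ i, T.Y i L * T.vert G (T.Y k (G i))
      - ∑ i, T.Y i L * T.vert (fun j => T.Y k (G j)) (G i)) := by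
    simp only [Finset.mul_sum, ← Finset.sum_sub_distrib, ← Finset.sum_add_distrib, curv]
    exact Finset.sum_congr rfl fun _ _ => by ring
  rw [hsplit, hX, hM]
  rw [hH', hhor] at hH
  rw [hV'] at hV
  rw [e2] at hE
  linear_combination 2 * hE + 2 * hH - 4 * hV - 2 * hB

end TanCalc

section Slit

open TopologicalSpace SmoothAlg

variable {n : ℕ}

/-- The slit tangent bundle over an open set of `ℝⁿ`. -/
def slit (U : Opens (Vec n)) : Opens (Vec n × Vec n) :=
  ⟨{p | p.1 ∈ U ∧ p.2 ≠ 0},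
    (U.isOpen.preimage continuous_fst).inter (isOpen_ne.preimage continuous_snd)⟩

/-- A point of the slit tangent bundle. -/
def slitPt {U : Opens (Vec n)} (x : Vec n) (hx : x ∈ U) (y : Vec n) (hy : y ≠ 0) : slit U :=
  ⟨(x, y), hx, hy⟩

/-- The fibre coordinates on the slit tangent bundle. -/
def fibreCoord (U : Opens (Vec n)) (i : Fin n) : SmoothAlg (slit U) :=
  SmoothAlg.mk (fun p => p.2 i) (by fun_prop)

lemma sum_single_smul (v : Vec n) : ∑ i, v i • (Pi.single i (1 : ℝ) : Vec n) = v := by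
  ext j; simp [Finset.sum_apply, Pi.single_apply]

/-- The calculus of smooth functions on the slit tangent bundle. -/
def tan (U : Opens (Vec n)) : TanCalc n (SmoothAlg (slit U)) where
  X k := dir (Pi.single k 1, 0)
  Y k := dir (0, Pi.single k 1)
  y := fibreCoord U
  XX _ _ _ := dir_comm _ _ _
  YX _ _ _ := dir_comm _ _ _
  YY _ _ _ := dir_comm _ _ _
  Yy k i := ext_ev fun p => by
    rw [ev_dir _ (fibreCoord U i) (g := fun p => p.2 i) fun _ => rfl]
    have : (fun p : Vec n × Vec n => p.2 i)
      = ((ContinuousLinearMap.proj i).comp (ContinuousLinearMap.snd ℝ (Vec n) (Vec n))) := rfl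
    rw [this, ContinuousLinearMap.fderiv]
    split_ifs with h <;> simp [h]
  Xy k i := ext_ev fun p => by
    rw [ev_dir _ (fibreCoord U i) (g := fun p => p.2 i) fun _ => rfl]
    have : (fun p : Vec n × Vec n => p.2 i)
      = ((ContinuousLinearMap.proj i).comp (ContinuousLinearMap.snd ℝ (Vec n) (Vec n))) := rfl
    rw [this, ContinuousLinearMap.fderiv]
    simp

variable {U : Opens (Vec n)}

@[simp] lemma ev_y (p : slit U) (i : Fin n) : ev p ((tan U).y i) = p.1.2 i := rfl

/-- `f` represents the element `g` of the algebra of the slit tangent bundle. -/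
def Represents (f : Vec n → Vec n → ℝ) (g : SmoothAlg (slit U)) : Prop :=
  ∀ p : slit U, ev p g = f p.1.1 p.1.2

lemma Represents.pdx {f : Vec n → Vec n → ℝ} {g : SmoothAlg (slit U)} (h : Represents f g) (k : Fin n) :
    Represents (fun x y => pdx f k x y) ((tan U).X k g) := by
  intro p
  have hp := differentiableAt_toFn g p
  have h1 : (fun x' => f x' p.1.2) =ᶠ[nhds p.1.1] fun x' => toFn g (x', p.1.2) := by
    filter_upwards [U.isOpen.mem_nhds p.2.1] with x hx
    exact ((toFn_coe g (slitPt x hx p.1.2 p.2.2)).trans (h _)).symm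
  simp only [_root_.pdx]
  rw [h1.fderiv_eq]
  have h2 : HasFDerivAt (fun x' : Vec n => (x', p.1.2)) (ContinuousLinearMap.inl ℝ (Vec n) (Vec n)) p.1.1 :=
    hasFDerivAt_prodMk_left _ _
  have h3 := (hp.hasFDerivAt (x := p.1)).comp p.1.1 (f := fun x' : Vec n => (x', p.1.2)) h2
  have h4 := h3.fderiv
  simp only [Function.comp_def] at h4
  rw [h4]
  rfl

lemma Represents.pdy {f : Vec n → Vec n → ℝ} {g : SmoothAlg (slit U)} (h : Represents f g) (k : Fin n) :
    Represents (fun x y => pdy f k x y) ((tan U).Y k g) := by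
  intro p
  have hp := differentiableAt_toFn g p
  have h1 : (fun y' => f p.1.1 y') =ᶠ[nhds p.1.2] fun y' => toFn g (p.1.1, y') := by
    filter_upwards [isOpen_ne.mem_nhds p.2.2] with y hy
    exact ((toFn_coe g (slitPt p.1.1 p.2.1 y hy)).trans (h _)).symm
  simp only [_root_.pdy]
  rw [h1.fderiv_eq]
  have h2 : HasFDerivAt (fun y' : Vec n => (p.1.1, y')) (ContinuousLinearMap.inr ℝ (Vec n) (Vec n)) p.1.2 :=
    hasFDerivAt_prodMk_right _ _
  have h3 := (hp.hasFDerivAt (x := p.1)).comp p.1.2 (f := fun y' : Vec n => (p.1.1, y')) h2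
  have h4 := h3.fderiv
  simp only [Function.comp_def] at h4
  rw [h4]
  rfl

lemma ev_hor (p : slit U) (f : SmoothAlg (slit U)) :
    ev p ((tan U).hor f) = ∑ k, p.1.2 k * ev p ((tan U).X k f) := by
  simp [TanCalc.hor_apply]

lemma ev_vert (p : slit U) (V : Fin n → SmoothAlg (slit U)) (f : SmoothAlg (slit U)) :
    ev p ((tan U).vert V f) = ∑ k, ev p (V k) * ev p ((tan U).Y k f) := by
  simp [TanCalc.vert_apply]

lemma curvOfSpray_eq {G : Fin n → Vec n → Vec n → ℝ} {H : Fin n → SmoothAlg (slit U)}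
    (h : ∀ i, Represents (G i) (H i)) (i k : Fin n) (p : slit U) :
    curvOfSpray G i k p.1.1 p.1.2 = ev p ((tan U).curv H i k) := by
  have h1 := fun k => (h i).pdx k p
  have h2 := fun k => (h i).pdy k
  simp only [curvOfSpray, TanCalc.curv, map_add, map_sub, map_mul, map_ofNat, ev_hor, ev_vert, h1]
  simp only [fun j => h j p, fun j => (h2 k).pdx j p, fun j => (h2 k).pdy j p,
    fun j => (h j).pdy k p, fun j => h2 j p]
  simp only [mul_comm]

lemma fundTensor_eq {F : Vec n → Vec n → ℝ} {L : SmoothAlg (slit U)}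
    (h : Represents (fun x y => F x y ^ 2) L) (i j : Fin n) (p : slit U) :
    fundTensor F p.1.1 p.1.2 i j = 1 / 2 * ev p ((tan U).Y i ((tan U).Y j L)) := by
  rw [((h.pdy j).pdy i) p]; rfl

lemma geoCoeff_eq {F : Vec n → Vec n → ℝ} {L : SmoothAlg (slit U)}
    (h : Represents (fun x y => F x y ^ 2) L) (p : slit U) (hdet : IsUnit (fundTensor F p.1.1 p.1.2).det)
    (G : Fin n → ℝ) (hG : ∀ l, ev p ((tan U).hor ((tan U).Y l L)) - ev p ((tan U).X l L)
      = 2 * ∑ j, G j * ev p ((tan U).Y j ((tan U).Y l L))) (i : Fin n) :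
    geoCoeff F i p.1.1 p.1.2 = G i := by
  have h1 : ∀ l, (∑ k, p.1.2 k * pdx (fun x y => pdy (fun x y => (F x y)^2) l x y) k p.1.1 p.1.2)
      - pdx (fun x y => (F x y)^2) l p.1.1 p.1.2 = 4 * (fundTensor F p.1.1 p.1.2).mulVec G l := by
    intro l
    have e1 := fun k => ((h.pdy l).pdx k) p
    have e2 := h.pdx l p
    have e3 := hG l
    rw [ev_hor, e2] at e3
    simp only [e1] at e3
    rw [e3, Matrix.mulVec, dotProduct, Finset.mul_sum, Finset.mul_sum]
    refine Finset.sum_congr rfl fun j _ => ?_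
    rw [fundTensor_eq h, (tan U).YY l j]
    ring
  rw [geoCoeff]
  simp only [h1]
  have h2 : ∑ l, (fundTensor F p.1.1 p.1.2)⁻¹ i l * (4 * (fundTensor F p.1.1 p.1.2).mulVec G l)
      = 4 * ((fundTensor F p.1.1 p.1.2)⁻¹.mulVec ((fundTensor F p.1.1 p.1.2).mulVec G)) i := by
    rw [Matrix.mulVec.eq_1 (fundTensor F p.1.1 p.1.2)⁻¹, dotProduct, Finset.mul_sum]
    exact Finset.sum_congr rfl fun _ _ => by ring
  rw [h2, Matrix.mulVec_mulVec, Matrix.nonsing_inv_mul _ hdet, Matrix.one_mulVec]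
  ring

/-- Pull-back of functions of the base point. -/
def base (U : Opens (Vec n)) : SmoothAlg U →ₐ[ℝ] SmoothAlg (slit U) where
  toFun f := SmoothAlg.mk (fun p => toFn f p.1)
    ((contDiffOn_toFn f).comp contDiff_fst.contDiffOn fun p hp => hp.1)
  map_one' := ext_ev fun p => by simpa using toFn_coe (1 : SmoothAlg U) ⟨p.1.1, p.2.1⟩
  map_mul' f g := ext_ev fun p => by
    have h := fun f : SmoothAlg U => toFn_coe f ⟨p.1.1, p.2.1⟩
    change toFn (f * g) p.1.1 = toFn f p.1.1 * toFn g p.1.1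
    simp only at h
    rw [h, h, h, map_mul]
  map_zero' := ext_ev fun p => by simpa using toFn_coe (0 : SmoothAlg U) ⟨p.1.1, p.2.1⟩
  map_add' f g := ext_ev fun p => by
    have h := fun f : SmoothAlg U => toFn_coe f ⟨p.1.1, p.2.1⟩
    change toFn (f + g) p.1.1 = toFn f p.1.1 + toFn g p.1.1
    simp only at h
    rw [h, h, h, map_add]
  commutes' r := ext_ev fun p => by
    simpa using toFn_coe (algebraMap ℝ (SmoothAlg U) r) ⟨p.1.1, p.2.1⟩

lemma ev_base (f : SmoothAlg U) (p : slit U) : ev p (base U f) = ev ⟨p.1.1, p.2.1⟩ f :=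
  toFn_coe f ⟨p.1.1, p.2.1⟩

lemma ev_base_fn (f : SmoothAlg U) (p : slit U) : ev p (base U f) = toFn f p.1.1 := rfl

lemma Y_base (k : Fin n) (f : SmoothAlg U) : (tan U).Y k (base U f) = 0 := by
  refine ext_ev fun p => ?_
  have h : Represents (fun x _ => toFn f x) (base U f) := fun p => rfl
  rw [h.pdy k p]
  simp [pdy]

lemma X_base (k : Fin n) (f : SmoothAlg U) :
    (tan U).X k (base U f) = base U (dir (Pi.single k 1) f) := by
  refine ext_ev fun p => ?_
  have h : Represents (fun x _ => toFn f x) (base U f) := fun p => rfl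
  rw [h.pdx k p, ev_base]
  rfl

end Slit

section SquareMetricCalculus

variable {n : ℕ} {A : Type*} [CommRing A] [Algebra ℝ A]

/-- The element `1/2` of a real algebra. -/
def half (A : Type*) [CommRing A] [Algebra ℝ A] : A := algebraMap ℝ A 2⁻¹

lemma two_mul_half : 2 * half A = 1 := by
  rw [half, ← map_ofNat (algebraMap ℝ A) 2, ← map_mul]; norm_num

@[simp] lemma Derivation.map_half (D : Derivation ℝ A A) : D (half A) = 0 := D.map_algebraMap _

lemma Derivation.map_two_eq_zero (D : Derivation ℝ A A) : D 2 = 0 := by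
  exact_mod_cast D.map_natCast 2

lemma two_cancel {x y : A} (h : 2 * x = 2 * y) : x = y := by
  linear_combination half A * h - (x - y) * two_mul_half (A := A)

lemma Derivation.map_inv_of_mul_eq_one (D : Derivation ℝ A A) {f g : A} (h : f * g = 1) :
    D g = -(g ^ 2 * D f) := by
  have := congrArg D h
  rw [D.leibniz, D.map_one_eq_zero, smul_eq_mul, smul_eq_mul] at this
  linear_combination g * this - D g * h

/-- The algebraic data of a square metric over a calculus on the slit tangent bundle. -/
structure SqCalc (T : TanCalc n A) where
  a : Fin n → Fin n → A
  ainv : Fin n → Fin n → A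
  b : Fin n → A
  α : A
  αi : A
  Li : A
  Di : A
  ei : A
  a_symm : ∀ i j, a i j = a j i
  ainv_symm : ∀ i j, ainv i j = ainv j i
  ainv_mul : ∀ i k, ∑ j, ainv i j * a j k = if i = k then 1 else 0
  Y_a : ∀ k i j, T.Y k (a i j) = 0
  Y_ainv : ∀ k i j, T.Y k (ainv i j) = 0
  Y_b : ∀ k i, T.Y k (b i) = 0
  α_sq : α ^ 2 = ∑ i, T.y i * ∑ j, a i j * T.y j
  α_inv : α * αi = 1
  L_inv : (α - ∑ i, b i * T.y i) * Li = 1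
  e_inv : (α + ∑ i, b i * T.y i) * ei = 1
  D_inv : ((1 + 2 * ∑ i, (∑ j, ainv i j * b j) * b i) * α ^ 2 - 3 * (∑ i, b i * T.y i) ^ 2) * Di = 1

namespace SqCalc

variable {T : TanCalc n A} (M : SqCalc T)

def β : A := ∑ i, M.b i * T.y i
def yl (k : Fin n) : A := ∑ j, M.a k j * T.y j
def bu (i : Fin n) : A := ∑ j, M.ainv i j * M.b j
def b2 : A := ∑ i, M.bu i * M.b i
def L : A := M.α - M.β
def D : A := (1 + 2 * M.b2) * M.α ^ 2 - 3 * M.β ^ 2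

lemma L_mul_Li : M.L * M.Li = 1 := M.L_inv
lemma D_mul_Di : M.D * M.Di = 1 := M.D_inv

/-- The geodesic coefficients of `α`. -/
def Gα (i : Fin n) : A :=
  half A * ∑ l, M.ainv i l * (T.hor (M.yl l) - half A * T.X l (M.α ^ 2))

def sl (l : Fin n) : A := half A * (T.hor (M.b l) - T.X l M.β)
def S (i : Fin n) : A := ∑ l, M.ainv i l * M.sl l
def s0 : A := ∑ i, M.S i * M.b i
def r00 : A := T.hor M.β - 2 * T.vert M.Gα M.β

lemma mul_ainv (i k : Fin n) : ∑ j, M.a i j * M.ainv j k = if i = k then 1 else 0 := by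
  have h : Matrix.of M.ainv * Matrix.of M.a = 1 := by
    ext i k
    simpa [Matrix.mul_apply, Matrix.one_apply] using M.ainv_mul i k
  have h2 := congrFun (congrFun ((mul_eq_one_comm (M := Matrix (Fin n) (Fin n) A)).1 h) i) k
  simpa [Matrix.mul_apply, Matrix.one_apply] using h2

lemma lower_ainv (i : Fin n) (v : Fin n → A) :
    ∑ l, M.a i l * ∑ j, M.ainv l j * v j = v i := by
  simp only [Finset.mul_sum, ← mul_assoc]
  rw [Finset.sum_comm]
  simp only [← Finset.sum_mul, M.mul_ainv]
  simp

lemma lower_swap (u v : Fin n → A) :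
    ∑ i, u i * ∑ j, M.a i j * v j = ∑ i, v i * ∑ j, M.a i j * u j := by
  simp only [Finset.mul_sum]
  rw [Finset.sum_comm]
  exact Finset.sum_congr rfl fun i _ => Finset.sum_congr rfl fun j _ => by
    rw [M.a_symm]; ring

lemma lower_S (i : Fin n) : ∑ l, M.a i l * M.S l = M.sl i := M.lower_ainv _ _
lemma lower_bu (i : Fin n) : ∑ l, M.a i l * M.bu l = M.b i := M.lower_ainv _ _

lemma lower_Gα (i : Fin n) :
    2 * ∑ l, M.a i l * M.Gα l = T.hor (M.yl i) - half A * T.X i (M.α ^ 2) := by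
  have : ∀ l, M.a i l * M.Gα l = half A * (M.a i l * ∑ j, M.ainv l j *
      (T.hor (M.yl j) - half A * T.X j (M.α ^ 2))) := fun l => by rw [Gα]; ring
  simp only [this, ← Finset.mul_sum]
  rw [M.lower_ainv i (fun j => T.hor (M.yl j) - half A * T.X j (M.α ^ 2)), ← mul_assoc,
    two_mul_half, one_mul]

lemma α_sq' : M.α ^ 2 = ∑ i, T.y i * M.yl i := M.α_sq

lemma yl_dot (V : Fin n → A) : ∑ i, V i * M.yl i = ∑ i, T.y i * ∑ j, M.a i j * V j := M.lower_swap _ _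

lemma Y_yl (k i : Fin n) : T.Y k (M.yl i) = M.a i k := by
  simp [yl, M.Y_a, Derivation.leibniz, T.Yy]

lemma Y_β (k : Fin n) : T.Y k M.β = M.b k := by
  simp [β, M.Y_b, Derivation.leibniz, T.Yy]

lemma Y_bu (k i : Fin n) : T.Y k (M.bu i) = 0 := by
  simp [bu, M.Y_b, M.Y_ainv, Derivation.leibniz]

lemma Y_b2 (k : Fin n) : T.Y k M.b2 = 0 := by
  simp [b2, M.Y_b, M.Y_bu, Derivation.leibniz]

lemma Y_α_sq (k : Fin n) : T.Y k (M.α ^ 2) = 2 * M.yl k := by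
  rw [M.α_sq', map_sum]
  simp only [Derivation.leibniz, M.Y_yl, T.Yy, smul_eq_mul, mul_ite, mul_one, mul_zero,
    Finset.sum_add_distrib]
  have : ∑ i, T.y i * M.a i k = M.yl k := by
    rw [yl]; exact Finset.sum_congr rfl fun i _ => by rw [M.a_symm]; ring
  rw [this]
  simp
  ring

lemma α_mul_derivation (E : Derivation ℝ A A) : E (M.α ^ 2) = 2 * (M.α * E M.α) := by
  rw [pow_two, E.leibniz, smul_eq_mul]; ring

lemma αi_cancel {x : A} {y : A} (h : M.α * x = M.α * y) : x = y := by
  linear_combination M.αi * h - (x - y) * M.α_inv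

lemma Y_α (k : Fin n) : T.Y k M.α = M.αi * M.yl k := by
  have h := M.Y_α_sq k
  rw [α_mul_derivation] at h
  exact M.αi_cancel (by linear_combination two_cancel h - M.yl k * M.α_inv)

lemma vert_α (V : Fin n → A) : T.vert V M.α = M.αi * ∑ i, V i * M.yl i := by
  simp only [T.vert_apply, M.Y_α, Finset.mul_sum]
  exact Finset.sum_congr rfl fun i _ => by ring

lemma vert_β (V : Fin n → A) : T.vert V M.β = ∑ i, V i * M.b i := by
  simp only [T.vert_apply, M.Y_β]

lemma vert_yl (V : Fin n → A) (l : Fin n) : T.vert V (M.yl l) = ∑ i, M.a l i * V i := by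
  simp only [T.vert_apply, M.Y_yl, mul_comm]

lemma euler_α : T.euler M.α = M.α := by
  rw [TanCalc.euler, vert_α, ← M.α_sq']
  linear_combination M.α * M.α_inv

lemma euler_β : T.euler M.β = M.β := by
  rw [TanCalc.euler, vert_β, β]; exact Finset.sum_congr rfl fun i _ => mul_comm _ _

lemma hor_α_sq : T.hor (M.α ^ 2) = 2 * T.vert M.Gα (M.α ^ 2) := by
  have h1 : T.vert M.Gα (M.α ^ 2) = ∑ l, T.y l * (2 * ∑ j, M.a l j * M.Gα j) := by
    rw [T.vert_apply]
    simp only [M.Y_α_sq, mul_left_comm _ (2 : A), ← Finset.mul_sum]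
    rw [M.yl_dot]
  have h2 : T.hor (M.α ^ 2) = ∑ l, T.y l * T.hor (M.yl l) := by
    rw [M.α_sq', map_sum]
    simp [T.hor_coord, Derivation.leibniz]
  have h3 : T.hor (M.α ^ 2) = ∑ l, T.y l * T.X l (M.α ^ 2) := T.hor_apply _
  simp only [M.lower_Gα, mul_sub, Finset.sum_sub_distrib, ← h2] at h1
  simp only [mul_left_comm _ (half A), ← Finset.mul_sum, ← h3] at h1
  linear_combination -2 * h1 + T.hor (M.α ^ 2) * two_mul_half (A := A)

lemma hor_α : T.hor M.α = 2 * T.vert M.Gα M.α := by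
  have h := M.hor_α_sq
  rw [α_mul_derivation, α_mul_derivation] at h
  exact M.αi_cancel (two_cancel (by linear_combination h))

lemma EL_α (l : Fin n) : T.hor (T.Y l M.α) - 2 * T.vert M.Gα (T.Y l M.α) = T.X l M.α := by
  have h1 := M.lower_Gα l
  rw [← M.vert_yl, α_mul_derivation] at h1
  have h2 : M.yl l = M.α * T.Y l M.α := by
    rw [M.Y_α]; linear_combination -M.yl l * M.α_inv
  rw [h2, Derivation.leibniz, Derivation.leibniz, M.hor_α] at h1
  simp only [smul_eq_mul] at h1
  refine M.αi_cancel ?_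
  linear_combination -h1 + M.α * T.X l M.α * two_mul_half (A := A)

lemma hor_b (l : Fin n) : T.hor (M.b l) = T.X l M.β + 2 * M.sl l := by
  rw [sl]; linear_combination -(T.hor (M.b l) - T.X l M.β) * two_mul_half (A := A)

lemma vert_b (V : Fin n → A) (l : Fin n) : T.vert V (M.b l) = 0 := by
  simp [T.vert_apply, M.Y_b]

lemma sl_dot_y : ∑ l, T.y l * M.sl l = 0 := by
  have h : T.hor M.β = ∑ l, T.y l * T.hor (M.b l) := by
    rw [β, map_sum]; simp [T.hor_coord, Derivation.leibniz]
  simp only [M.hor_b, mul_add, Finset.sum_add_distrib, ← T.hor_apply] at h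
  apply two_cancel
  simp only [mul_left_comm _ (2 : A), ← Finset.mul_sum] at h
  linear_combination -h

lemma S_dot_y : ∑ i, M.S i * M.yl i = 0 := by
  rw [M.yl_dot]; simp only [M.lower_S, M.sl_dot_y]

lemma bu_dot_y : ∑ i, M.bu i * M.yl i = M.β := by
  rw [M.yl_dot]; simp only [M.lower_bu, β, mul_comm (T.y _)]

/-- The coefficient of `Sⁱ` in the projective spray. -/
def A1 : A := 2 * M.α ^ 2 * M.Li
/-- The coefficient of `bⁱ` in the projective spray. -/
def B : A := M.α ^ 2 * (M.r00 - 2 * M.A1 * M.s0) * M.Di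
/-- A spray projectively equivalent to that of the square metric. -/
def H (i : Fin n) : A := M.Gα i + (M.A1 * M.S i + M.B * M.bu i)

/-- The square metric. -/
def F : A := (M.α + M.β) ^ 2 * M.αi
/-- The inverse of the square metric. -/
def Fi : A := M.α * M.ei ^ 2

lemma F_mul_Fi : M.F * M.Fi = 1 := by
  have h : (M.α + M.β) * M.ei = 1 := M.e_inv
  rw [F, Fi]
  linear_combination (M.α + M.β) ^ 2 * M.ei ^ 2 * M.α_inv + ((M.α + M.β) * M.ei + 1) * h

def P : A := half A * (T.hor M.F - 2 * T.vert M.H M.F) * M.Fi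
/-- The geodesic coefficients of the square metric. -/
def G (i : Fin n) : A := M.H i + M.P * T.y i

lemma derivation_F (E : Derivation ℝ A A) : E M.F =
    (1 - M.β ^ 2 * M.αi ^ 2) * E M.α + (2 + 2 * M.β * M.αi) * E M.β := by
  rw [F, E.leibniz, E.map_inv_of_mul_eq_one M.α_inv, E.leibniz_pow]
  simp only [smul_eq_mul, map_add, nsmul_eq_mul, Nat.cast_ofNat]
  linear_combination (E M.α - M.α * M.αi * E M.α + 2 * E M.β - 2 * M.β * M.αi * E M.α) * M.α_inv

lemma euler_F : T.euler M.F = M.F := by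
  rw [derivation_F, euler_α, euler_β, F]
  linear_combination (-M.α - 2 * M.β - M.β ^ 2 * M.αi) * M.α_inv

lemma vert_T (f : A) : T.vert M.H f = T.vert M.Gα f + (M.A1 * T.vert M.S f + M.B * T.vert M.bu f) := by
  unfold H
  rw [T.vert_add, T.vert_add, T.vert_smul, T.vert_smul]

lemma EL_F (l : Fin n) : T.hor (T.Y l M.F) - 2 * T.vert M.H (T.Y l M.F) = T.X l M.F := by
  have hYi := fun E : Derivation ℝ A A => E.map_inv_of_mul_eq_one M.α_inv
  have e1 := M.EL_α l
  have e2 := M.hor_α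
  have e3 : M.r00 = T.hor M.β - 2 * T.vert M.Gα M.β := rfl
  have e4 := M.hor_b l
  have v1 : T.vert M.S (T.Y l M.α) = M.αi * M.sl l := by
    rw [M.Y_α, Derivation.leibniz, hYi, vert_α, S_dot_y, vert_yl, lower_S]
    simp
  have v2 : T.vert M.bu (T.Y l M.α) = M.αi * M.b l - M.αi ^ 3 * M.β * M.yl l := by
    rw [M.Y_α, Derivation.leibniz, hYi, vert_α, bu_dot_y, vert_yl, lower_bu]
    simp only [smul_eq_mul]; ring
  have v3 : T.vert M.S M.α = 0 := by rw [vert_α, S_dot_y, mul_zero]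
  have v4 : T.vert M.bu M.α = M.αi * M.β := by rw [vert_α, bu_dot_y]
  have v5 : T.vert M.S M.β = M.s0 := M.vert_β _
  have v6 : T.vert M.bu M.β = M.b2 := M.vert_β _
  have hB : M.B * M.D = M.α ^ 2 * (M.r00 - 2 * M.A1 * M.s0) := by
    rw [B]; linear_combination M.α ^ 2 * (M.r00 - 2 * M.A1 * M.s0) * M.D_mul_Di
  have hA : M.A1 * M.L = 2 * M.α ^ 2 := by
    rw [A1]; linear_combination 2 * M.α ^ 2 * M.L_mul_Li
  rw [derivation_F, derivation_F]
  simp only [vert_T, map_add, Derivation.leibniz, map_sub, Derivation.map_one_eq_zero, M.Y_β,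
    smul_eq_mul, Derivation.leibniz_pow, hYi, nsmul_eq_mul, vert_b, v1, v2, v3, v4, v5, v6, e2, e4,
    Nat.cast_ofNat, ← e1, pow_one, Nat.add_one_sub_one, Derivation.map_two_eq_zero]
  have hi := M.α_inv
  have hw := M.Y_α l
  have hL : M.L = M.α - M.β := rfl
  have hD : M.D = (1 + 2 * M.b2) * M.α ^ 2 - 3 * M.β ^ 2 := rfl
  rw [hL] at hA
  rw [hD, e3] at hB
  have k1 : 2 * (1 + M.β * M.αi) = (1 - M.β ^ 2 * M.αi ^ 2) * M.αi * M.A1 := by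
    linear_combination -(M.αi ^ 3 * (M.α + M.β)) * hA
      - (2 * (1 + M.α * M.αi) * (M.α * M.αi + M.β * M.αi) + 2 - (M.α * M.αi + 1) * M.αi * M.A1) * hi
  have k2 : M.B * (1 + 2 * M.b2 - 3 * M.β ^ 2 * M.αi ^ 2)
      = T.hor M.β - 2 * T.vert M.Gα M.β - 2 * M.A1 * M.s0 := by
    linear_combination M.αi ^ 2 * hB + (M.α * M.αi + 1) *
      (T.hor M.β - 2 * T.vert M.Gα M.β - 2 * M.A1 * M.s0 - M.B * (1 + 2 * M.b2)) * hi
  rw [hw]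
  linear_combination 2 * M.sl l * k1 - 2 * M.αi * M.b l * k2 + 2 * M.β * M.αi ^ 3 * M.yl l * k2

lemma euler_mul (f g : A) : T.euler (f * g) = f * T.euler g + T.euler f * g := by
  rw [Derivation.leibniz, smul_eq_mul, smul_eq_mul, mul_comm g]

lemma euler_of_Y {f : A} (h : ∀ k, T.Y k f = 0) : T.euler f = 0 := by
  simp [TanCalc.euler, T.vert_apply, h]

lemma euler_sum_mul {c v : Fin n → A} {r : A} (hc : ∀ k i, T.Y k (c i) = 0)
    (hv : ∀ i, T.euler (v i) = r * v i) : T.euler (∑ i, c i * v i) = r * ∑ i, c i * v i := by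
  rw [map_sum, Finset.mul_sum]
  refine Finset.sum_congr rfl fun i _ => ?_
  rw [euler_mul, hv, euler_of_Y fun k => hc k i]; ring

lemma euler_X {f : A} {r : A} (h : T.euler f = r * f) (hr : ∀ k, T.X k r = 0) (k : Fin n) :
    T.euler (T.X k f) = r * T.X k f := by
  rw [← T.X_euler, h, Derivation.leibniz, hr]; simp

lemma X_two (k : Fin n) : T.X k 2 = 0 := Derivation.map_two_eq_zero _

lemma euler_α_sq : T.euler (M.α ^ 2) = 2 * M.α ^ 2 := by
  rw [M.α_mul_derivation, euler_α]; ring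

lemma euler_yl (k : Fin n) : T.euler (M.yl k) = M.yl k := by
  have := euler_sum_mul (T := T) (c := M.a k) (v := T.y) (r := 1) (fun i j => M.Y_a i k j)
    fun i => by rw [T.euler_coord, one_mul]
  rwa [one_mul] at this

lemma euler_Gα (i : Fin n) : T.euler (M.Gα i) = 2 * M.Gα i := by
  have h : ∀ l, T.euler (T.hor (M.yl l) - half A * T.X l (M.α ^ 2))
      = 2 * (T.hor (M.yl l) - half A * T.X l (M.α ^ 2)) := fun l => by
    rw [map_sub, T.euler_hor, euler_yl, euler_mul, euler_X M.euler_α_sq X_two,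
      Derivation.map_half]
    ring
  rw [Gα, euler_mul, euler_sum_mul (M.Y_ainv · i ·) h, Derivation.map_half]
  ring

lemma euler_sl (l : Fin n) : T.euler (M.sl l) = M.sl l := by
  have h := euler_X (T := T) (f := M.β) (r := 1) (by rw [M.euler_β, one_mul]) (by simp) l
  rw [sl, euler_mul, map_sub, T.euler_hor, euler_of_Y (M.Y_b · l), h, Derivation.map_half]
  simp

lemma euler_S (i : Fin n) : T.euler (M.S i) = M.S i := by
  have := euler_sum_mul (T := T) (c := M.ainv i) (v := M.sl) (r := 1) (M.Y_ainv · i ·)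
    fun l => by rw [M.euler_sl, one_mul]
  simpa [S] using this

lemma euler_s0 : T.euler M.s0 = M.s0 := by
  have := euler_sum_mul (T := T) (c := M.b) (v := M.S) (r := 1) M.Y_b
    fun l => by rw [M.euler_S, one_mul]
  simpa [s0, mul_comm] using this

lemma euler_vert_two {V : Fin n → A} {f : A} (hV : ∀ i, T.euler (V i) = 2 * V i)
    (hf : T.euler f = f) : T.euler (T.vert V f) = 2 * T.vert V f := by
  rw [T.euler_vert, hf]
  simp only [hV, T.vert_smul]
  ring

lemma euler_r00 : T.euler M.r00 = 2 * M.r00 := by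
  rw [r00, map_sub, T.euler_hor, euler_β, euler_mul, euler_vert_two M.euler_Gα M.euler_β,
    Derivation.map_two_eq_zero]
  ring

lemma euler_A1 : T.euler M.A1 = M.A1 := by
  rw [A1, euler_mul, euler_mul, euler_α_sq, Derivation.map_inv_of_mul_eq_one T.euler M.L_mul_Li,
    Derivation.map_two_eq_zero, L, map_sub, euler_α, euler_β]
  have h := M.L_mul_Li
  rw [L] at h
  linear_combination -2 * M.α ^ 2 * M.Li * h

lemma euler_B : T.euler M.B = 2 * M.B := by
  have hb : T.euler M.b2 = 0 := euler_of_Y M.Y_b2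
  have hDi : T.euler M.Di = - (2 * M.Di) := by
    rw [Derivation.map_inv_of_mul_eq_one T.euler M.D_mul_Di, D]
    simp only [map_sub, map_add, euler_mul, euler_α_sq, pow_two M.β, euler_β, hb,
      Derivation.map_one_eq_zero, Derivation.map_two_eq_zero]
    have h := M.D_mul_Di
    have h3 : T.euler 3 = 0 := by exact_mod_cast T.euler.map_natCast 3
    rw [D] at h
    rw [h3]
    linear_combination -2 * M.Di * h
  rw [B, euler_mul, euler_mul, map_sub, euler_mul, euler_mul, euler_r00, euler_A1, euler_s0,
    euler_α_sq, hDi, Derivation.map_two_eq_zero]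
  ring

lemma euler_H (i : Fin n) : T.euler (M.H i) = 2 * M.H i := by
  rw [H, map_add, map_add, euler_mul, euler_mul, euler_Gα, euler_A1, euler_S, euler_B,
    euler_of_Y (M.Y_bu · i)]
  ring

lemma euler_P : T.euler M.P = M.P := by
  have hF : T.euler M.Fi = - M.Fi := by
    rw [Derivation.map_inv_of_mul_eq_one T.euler M.F_mul_Fi, euler_F]
    linear_combination -M.Fi * M.F_mul_Fi
  rw [P, euler_mul, euler_mul, map_sub, euler_mul, T.euler_hor, euler_vert_two M.euler_H M.euler_F,
    euler_F, hF, Derivation.map_half, Derivation.map_two_eq_zero]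
  ring

lemma euler_G (i : Fin n) : T.euler (M.G i) = 2 * M.G i := by
  rw [G, map_add, euler_mul, euler_H, euler_P, T.euler_coord]
  ring

lemma vert_G (f : A) : T.vert M.G f = T.vert M.H f + M.P * T.euler f := by
  unfold G
  rw [T.vert_add, T.vert_smul]; rfl

lemma hor_F : T.hor M.F = 2 * T.vert M.G M.F := by
  rw [vert_G, euler_F, P]
  linear_combination -(T.hor M.F - 2 * T.vert M.H M.F) * two_mul_half (A := A)
    - 2 * half A * (T.hor M.F - 2 * T.vert M.H M.F) * M.F_mul_Fi

lemma hor_F_sq : T.hor (M.F ^ 2) = 2 * T.vert M.G (M.F ^ 2) := by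
  simp only [pow_two, Derivation.leibniz, smul_eq_mul, hor_F]
  ring

lemma EL_F_sq (l : Fin n) : T.EL (M.F ^ 2) M.G l = 0 := by
  have h1 := M.EL_F l
  have h2 : T.vert M.G (T.Y l M.F) = T.vert M.H (T.Y l M.F) := by
    rw [vert_G, T.euler_Y_one M.euler_F, mul_zero, add_zero]
  rw [TanCalc.EL]
  simp only [pow_two, Derivation.leibniz, smul_eq_mul, hor_F, map_add, h2]
  linear_combination 2 * M.F * h1

end SqCalc
end SquareMetricCalculus

section SquareMetricField

open TopologicalSpace SmoothAlg

variable {n : ℕ}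

/-- The data of a square metric on an open set. -/
structure SqField (U : Opens (Vec n)) where
  a : Vec n → Matrix (Fin n) (Fin n) ℝ
  b : Vec n → Vec n
  ha : ∀ i j, ContDiffOn ℝ (⊤ : ℕ∞) (fun x => a x i j) U
  hsym : ∀ x ∈ U, (a x).IsSymm
  hpos : ∀ x ∈ U, (a x).PosDef
  hb : ∀ i, ContDiffOn ℝ (⊤ : ℕ∞) (fun x => b x i) U
  hb2 : ∀ x ∈ U, 0 < bsq a b x ∧ bsq a b x < 1

namespace SqField

variable {U : Opens (Vec n)} (Q : SqField U)

/-- The inner product of the Riemannian metric. -/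
def ip (x u v : Vec n) : ℝ := u ⬝ᵥ (Q.a x).mulVec v

/-- The one-form. -/
def bf (x y : Vec n) : ℝ := Q.b x ⬝ᵥ y

/-- The vector dual to the one-form. -/
def bv (x : Vec n) : Vec n := (Q.a x)⁻¹.mulVec (Q.b x)

lemma ip_add_left (x u v w : Vec n) : Q.ip x (u + v) w = Q.ip x u w + Q.ip x v w := by
  simp [ip, add_dotProduct]

lemma ip_add_right (x u v w : Vec n) : Q.ip x u (v + w) = Q.ip x u v + Q.ip x u w := by
  simp [ip, Matrix.mulVec_add, dotProduct_add]

lemma ip_smul_left (x u v : Vec n) (c : ℝ) : Q.ip x (c • u) v = c * Q.ip x u v := by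
  simp [ip, smul_dotProduct]

lemma ip_smul_right (x u v : Vec n) (c : ℝ) : Q.ip x u (c • v) = c * Q.ip x u v := by
  simp [ip, Matrix.mulVec_smul, dotProduct_smul]

lemma ip_comm {x : Vec n} (hx : x ∈ U) (u v : Vec n) : Q.ip x u v = Q.ip x v u := by
  have h := (Q.hsym x hx)
  rw [ip, ip, Matrix.dotProduct_mulVec, ← Matrix.mulVec_transpose, h, dotProduct_comm]

lemma ip_pos {x : Vec n} (hx : x ∈ U) {v : Vec n} (hv : v ≠ 0) : 0 < Q.ip x v v := by
  simpa [ip] using (Q.hpos x hx).dotProduct_mulVec_pos hv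

lemma ip_self_eq_zero {x : Vec n} (hx : x ∈ U) {v : Vec n} (hv : Q.ip x v v = 0) : v = 0 := by
  by_contra h
  exact (Q.ip_pos hx h).ne' hv

lemma det_isUnit {x : Vec n} (hx : x ∈ U) : IsUnit (Q.a x).det :=
  (Q.hpos x hx).det_pos.ne'.isUnit

lemma ip_bv_right {x : Vec n} (hx : x ∈ U) (y : Vec n) : Q.ip x y (Q.bv x) = Q.bf x y := by
  rw [ip, bv, Matrix.mulVec_mulVec, Matrix.mul_nonsing_inv _ (Q.det_isUnit hx), Matrix.one_mulVec,
    bf, dotProduct_comm]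

lemma ip_bv_left {x : Vec n} (hx : x ∈ U) (y : Vec n) : Q.ip x (Q.bv x) y = Q.bf x y := by
  rw [Q.ip_comm hx, Q.ip_bv_right hx]

lemma bf_add (x u v : Vec n) : Q.bf x (u + v) = Q.bf x u + Q.bf x v := by simp [bf]

lemma bf_smul (x u : Vec n) (c : ℝ) : Q.bf x (c • u) = c * Q.bf x u := by simp [bf]

lemma bf_bv (x : Vec n) : Q.bf x (Q.bv x) = bsq Q.a Q.b x := by
  simp only [bf, bv, bsq, dotProduct, Matrix.mulVec, Finset.mul_sum]
  exact Finset.sum_congr rfl fun i _ => Finset.sum_congr rfl fun j _ => by ring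

lemma cauchy {x : Vec n} (hx : x ∈ U) (y : Vec n) :
    Q.bf x y ^ 2 ≤ bsq Q.a Q.b x * Q.ip x y y := by
  have h0 := (Q.hb2 x hx).1
  have h : 0 ≤ Q.ip x (bsq Q.a Q.b x • y + (- Q.bf x y) • Q.bv x)
      (bsq Q.a Q.b x • y + (- Q.bf x y) • Q.bv x) := by
    by_cases h : bsq Q.a Q.b x • y + (- Q.bf x y) • Q.bv x = 0
    · rw [h]; simp [ip]
    · exact (Q.ip_pos hx h).le
  simp only [ip_add_left, ip_add_right, ip_smul_left, ip_smul_right, Q.ip_bv_right hx,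
    Q.ip_bv_left hx, Q.bf_bv, Q.bf_add, Q.bf_smul] at h
  have h' : 0 ≤ bsq Q.a Q.b x * (bsq Q.a Q.b x * Q.ip x y y - Q.bf x y ^ 2) := by
    linarith
  nlinarith [nonneg_of_mul_nonneg_right h' h0]

lemma alphaOf_eq (x y : Vec n) : alphaOf Q.a x y = Real.sqrt (Q.ip x y y) := by
  rw [alphaOf, ip]
  congr 1
  simp only [dotProduct, Matrix.mulVec, Finset.mul_sum]
  exact Finset.sum_congr rfl fun i _ => Finset.sum_congr rfl fun j _ => by ring

lemma betaOf_eq (x y : Vec n) : betaOf Q.b x y = Q.bf x y := rfl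

lemma alphaOf_pos {x : Vec n} (hx : x ∈ U) {y : Vec n} (hy : y ≠ 0) : 0 < alphaOf Q.a x y := by
  rw [alphaOf_eq]; exact Real.sqrt_pos.2 (Q.ip_pos hx hy)

lemma alphaOf_sq {x : Vec n} (hx : x ∈ U) {y : Vec n} (hy : y ≠ 0) :
    alphaOf Q.a x y ^ 2 = Q.ip x y y := by
  rw [alphaOf_eq]; exact Real.sq_sqrt (Q.ip_pos hx hy).le

lemma bf_lt {x : Vec n} (hx : x ∈ U) {y : Vec n} (hy : y ≠ 0) :
    |Q.bf x y| < alphaOf Q.a x y := by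
  refine abs_lt_of_sq_lt_sq ?_ (Q.alphaOf_pos hx hy).le
  rw [Q.alphaOf_sq hx hy]
  nlinarith [Q.cauchy hx y, Q.hb2 x hx, Q.ip_pos hx hy]

lemma denominator_pos {x : Vec n} (hx : x ∈ U) {y : Vec n} (hy : y ≠ 0) :
    0 < (1 + 2 * bsq Q.a Q.b x) * alphaOf Q.a x y ^ 2 - 3 * Q.bf x y ^ 2 := by
  rw [Q.alphaOf_sq hx hy]
  nlinarith [Q.cauchy hx y, Q.hb2 x hx, Q.ip_pos hx hy]

/-- The metric as a matrix of smooth functions. -/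
def am : Matrix (Fin n) (Fin n) (SmoothAlg U) :=
  Matrix.of fun i j => SmoothAlg.mk (fun x => Q.a x i j) (Q.ha i j)

/-- The one-form as a vector of smooth functions. -/
def bm (i : Fin n) : SmoothAlg U := SmoothAlg.mk (fun x => Q.b x i) (Q.hb i)

lemma map_am (x : U) : Q.am.map (ev x : SmoothAlg U →ₐ[ℝ] ℝ) = Q.a x := by ext i j; rfl

lemma am_symm : Q.am.transpose = Q.am := by
  ext i j
  exact ext_ev fun x => (Q.hsym x x.2).apply i j

lemma det_am_isUnit : IsUnit Q.am.det := by
  obtain ⟨g, hg⟩ := exists_inv Q.am.det fun x => by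
    rw [AlgHom.map_det, AlgHom.mapMatrix_apply, map_am]
    exact (Q.det_isUnit x.2).ne_zero
  exact IsUnit.of_mul_eq_one g hg

lemma ev_inv_am (x : U) (i j : Fin n) : ev x (Q.am⁻¹ i j) = (Q.a x)⁻¹ i j := by
  have h : (Q.am⁻¹).map (ev x : SmoothAlg U →ₐ[ℝ] ℝ) * Q.a x = 1 := by
    rw [← Q.map_am x]
    have := congrArg (fun m : Matrix (Fin n) (Fin n) (SmoothAlg U) => (ev x).mapMatrix m)
      (Matrix.nonsing_inv_mul _ Q.det_am_isUnit)
    simpa only [map_mul, map_one, AlgHom.mapMatrix_apply] using this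
  rw [Matrix.inv_eq_left_inv h]
  rfl

/-- The Riemannian norm as a smooth function on the slit tangent bundle. -/
def alphaS : SmoothAlg (slit U) := SmoothAlg.mk (fun p => alphaOf Q.a p.1 p.2) <| by
  have h : ContDiffOn ℝ (⊤ : ℕ∞)
      (fun p : Vec n × Vec n => ∑ i, ∑ j, Q.a p.1 i j * p.2 i * p.2 j) (slit U) := by
    refine ContDiffOn.sum fun i _ => ContDiffOn.sum fun j _ => ContDiffOn.mul (ContDiffOn.mul
      ((Q.ha i j).comp contDiff_fst.contDiffOn fun p hp => hp.1) ?_) ?_ <;> fun_prop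
  refine h.sqrt fun p hp h0 => ?_
  have := Q.alphaOf_pos hp.1 hp.2
  rw [alphaOf, h0] at this
  simp at this

def betaS : SmoothAlg (slit U) := ∑ i, base U (Q.bm i) * (tan U).y i

def b2S : SmoothAlg (slit U) :=
  ∑ i, (∑ j, base U (Q.am⁻¹ i j) * base U (Q.bm j)) * base U (Q.bm i)

lemma ev_alphaS (p : slit U) : ev p Q.alphaS = alphaOf Q.a p.1.1 p.1.2 := rfl

lemma ev_bm (p : slit U) (i : Fin n) : ev p (base U (Q.bm i)) = Q.b p.1.1 i := ev_base _ _

lemma ev_am (p : slit U) (i j : Fin n) : ev p (base U (Q.am i j)) = Q.a p.1.1 i j := ev_base _ _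

lemma ev_am_inv (p : slit U) (i j : Fin n) :
    ev p (base U (Q.am⁻¹ i j)) = (Q.a p.1.1)⁻¹ i j :=
  (ev_base _ _).trans (Q.ev_inv_am _ _ _)

lemma ev_betaS (p : slit U) : ev p Q.betaS = Q.bf p.1.1 p.1.2 := by
  simp [betaS, ev_bm, bf, dotProduct]

lemma ev_b2S (p : slit U) : ev p Q.b2S = bsq Q.a Q.b p.1.1 := by
  rw [← bf_bv]
  simp only [b2S, map_sum, map_mul, ev_bm, ev_am_inv, bf, dotProduct, bv, Matrix.mulVec]
  exact Finset.sum_congr rfl fun i _ => mul_comm _ _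

lemma exists_L_inv : ∃ g, (Q.alphaS - Q.betaS) * g = 1 := exists_inv _ fun p => by
  rw [map_sub, ev_alphaS, ev_betaS]
  have := (abs_lt.1 (Q.bf_lt p.2.1 p.2.2)).2
  linarith

lemma exists_e_inv : ∃ g, (Q.alphaS + Q.betaS) * g = 1 := exists_inv _ fun p => by
  rw [map_add, ev_alphaS, ev_betaS]
  have := (abs_lt.1 (Q.bf_lt p.2.1 p.2.2)).1
  linarith

lemma exists_D_inv : ∃ g, ((1 + 2 * Q.b2S) * Q.alphaS ^ 2 - 3 * Q.betaS ^ 2) * g = 1 :=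
  exists_inv _ fun p => by
    simp only [map_sub, map_add, map_mul, map_pow, map_one, map_ofNat, ev_alphaS, ev_betaS, ev_b2S]
    exact (Q.denominator_pos p.2.1 p.2.2).ne'

lemma exists_alpha_inv : ∃ g, Q.alphaS * g = 1 := exists_inv _ fun p =>
  (Q.alphaOf_pos p.2.1 p.2.2).ne'

/-- The algebraic data of a square metric. -/
def sq : SqCalc (tan U) where
  a i j := base U (Q.am i j)
  ainv i j := base U (Q.am⁻¹ i j)
  b i := base U (Q.bm i)
  α := Q.alphaS
  αi := Q.exists_alpha_inv.choose
  Li := Q.exists_L_inv.choose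
  Di := Q.exists_D_inv.choose
  ei := Q.exists_e_inv.choose
  a_symm i j := congrArg (base U) (congrFun (congrFun Q.am_symm j) i)
  ainv_symm i j := by
    have h : (Q.am⁻¹).transpose = Q.am⁻¹ := by rw [Matrix.transpose_nonsing_inv, Q.am_symm]
    exact congrArg (base U) (congrFun (congrFun h j) i)
  ainv_mul i k := by
    have := congrArg (base U) (congrFun (congrFun (Matrix.nonsing_inv_mul _ Q.det_am_isUnit) i) k)
    rw [Matrix.mul_apply, map_sum] at this
    simp only [map_mul] at this
    rw [this, Matrix.one_apply]
    split_ifs <;> simp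
  Y_a _ _ _ := Y_base _ _
  Y_ainv _ _ _ := Y_base _ _
  Y_b _ _ := Y_base _ _
  α_sq := ext_ev fun p => by
    rw [map_pow, ev_alphaS, Q.alphaOf_sq p.2.1 p.2.2]
    simp [ev_am, ip, dotProduct, Matrix.mulVec]
  α_inv := Q.exists_alpha_inv.choose_spec
  L_inv := Q.exists_L_inv.choose_spec
  e_inv := Q.exists_e_inv.choose_spec
  D_inv := Q.exists_D_inv.choose_spec

lemma ev_α (p : slit U) : ev p Q.sq.α = alphaOf Q.a p.1.1 p.1.2 := rfl
lemma ev_β (p : slit U) : ev p Q.sq.β = Q.bf p.1.1 p.1.2 := Q.ev_betaS p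
lemma ev_b2 (p : slit U) : ev p Q.sq.b2 = bsq Q.a Q.b p.1.1 := Q.ev_b2S p

lemma ev_αi (p : slit U) : ev p Q.sq.αi = (alphaOf Q.a p.1.1 p.1.2)⁻¹ := by
  have := congrArg (ev p) Q.sq.α_inv
  rw [map_mul, map_one, ev_α] at this
  exact eq_inv_of_mul_eq_one_right this

lemma represents_F : Represents (sqMetric Q.a Q.b) Q.sq.F := fun p => by
  rw [SqCalc.F, map_mul, map_pow, map_add, ev_αi, ev_α, ev_β]
  rfl

lemma represents_F_sq : Represents (fun x y => sqMetric Q.a Q.b x y ^ 2) (Q.sq.F ^ 2) := fun p => by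
  rw [map_pow, Q.represents_F p]

end SqField
end SquareMetricField

section Nondegeneracy

open TopologicalSpace SmoothAlg

variable {n : ℕ}

namespace SqCalc

variable {A : Type*} [CommRing A] [Algebra ℝ A] {T : TanCalc n A} (M : SqCalc T)

lemma YY_F_sq (i j : Fin n) : T.Y i (T.Y j (M.F ^ 2)) =
    2 * (((1 - M.β ^ 2 * M.αi ^ 2) * M.αi * M.yl i + (2 + 2 * M.β * M.αi) * M.b i)
        * ((1 - M.β ^ 2 * M.αi ^ 2) * M.αi * M.yl j + (2 + 2 * M.β * M.αi) * M.b j))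
      + 2 * M.F * ((1 - M.β ^ 2 * M.αi ^ 2) * M.αi * (M.a i j - M.αi ^ 2 * (M.yl i * M.yl j))
        + 2 * M.αi * ((M.b i - M.β * M.αi ^ 2 * M.yl i) * (M.b j - M.β * M.αi ^ 2 * M.yl j))) := by
  have hYi := fun E : Derivation ℝ A A => E.map_inv_of_mul_eq_one M.α_inv
  have h1 : ∀ k, T.Y k M.F = (1 - M.β ^ 2 * M.αi ^ 2) * M.αi * M.yl k
      + (2 + 2 * M.β * M.αi) * M.b k := fun k => by
    rw [derivation_F, Y_α, Y_β]; ring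
  have h2 : T.Y j (M.F ^ 2) = 2 * (M.F * T.Y j M.F) := by
    rw [pow_two, Derivation.leibniz, smul_eq_mul]; ring
  rw [h2, h1 j]
  simp only [map_add, map_sub, Derivation.leibniz, Derivation.leibniz_pow, h1 i, hYi, Y_α, Y_β, Y_yl,
    M.Y_b, Derivation.map_two_eq_zero, Derivation.map_one_eq_zero, smul_eq_mul, nsmul_eq_mul,
    M.a_symm j i, Nat.cast_ofNat, pow_one, Nat.add_one_sub_one]
  ring

end SqCalc

namespace SqField

variable {U : Opens (Vec n)} (Q : SqField U)

lemma ev_yl (p : slit U) (i : Fin n) : ev p (Q.sq.yl i) = (Q.a p.1.1).mulVec p.1.2 i := by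
  change ev p (∑ j, base U (Q.am i j) * (tan U).y j) = _
  simp [ev_am, Matrix.mulVec, dotProduct]

lemma ev_b (p : slit U) (i : Fin n) : ev p (Q.sq.b i) = Q.b p.1.1 i := Q.ev_bm p i

lemma ev_a (p : slit U) (i j : Fin n) : ev p (Q.sq.a i j) = Q.a p.1.1 i j := Q.ev_am p i j

lemma dotProduct_fundTensor (p : slit U) (v : Vec n) :
    v ⬝ᵥ (fundTensor (sqMetric Q.a Q.b) p.1.1 p.1.2).mulVec v =
      ((1 - ev p Q.sq.β ^ 2 * ev p Q.sq.αi ^ 2) * ev p Q.sq.αi * Q.ip p.1.1 v p.1.2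
        + (2 + 2 * ev p Q.sq.β * ev p Q.sq.αi) * Q.bf p.1.1 v) ^ 2
      + ev p Q.sq.F * ((1 - ev p Q.sq.β ^ 2 * ev p Q.sq.αi ^ 2) * ev p Q.sq.αi
            * (Q.ip p.1.1 v v - ev p Q.sq.αi ^ 2 * Q.ip p.1.1 v p.1.2 ^ 2)
        + 2 * ev p Q.sq.αi
          * (Q.bf p.1.1 v - ev p Q.sq.β * ev p Q.sq.αi ^ 2 * Q.ip p.1.1 v p.1.2) ^ 2) := by
  have hsum : ∀ f g : Fin n → ℝ, ∑ i, ∑ j, v i * (f i * g j) * v j = (v ⬝ᵥ f) * (v ⬝ᵥ g) := by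
    intro f g
    simp only [dotProduct, Finset.sum_mul_sum]
    exact Finset.sum_congr rfl fun i _ => Finset.sum_congr rfl fun j _ => by ring
  have h0 : v ⬝ᵥ (fundTensor (sqMetric Q.a Q.b) p.1.1 p.1.2).mulVec v =
      ∑ i, ∑ j, v i * fundTensor (sqMetric Q.a Q.b) p.1.1 p.1.2 i j * v j := by
    simp only [dotProduct, Matrix.mulVec, Finset.mul_sum, mul_assoc]
  have ha : ∑ i, ∑ j, v i * Q.a p.1.1 i j * v j = Q.ip p.1.1 v v := by
    simp only [ip, dotProduct, Matrix.mulVec, Finset.mul_sum, mul_assoc]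
  have e1 : Q.ip p.1.1 v p.1.2 = v ⬝ᵥ (Q.a p.1.1).mulVec p.1.2 := rfl
  have e2 : Q.bf p.1.1 v = v ⬝ᵥ Q.b p.1.1 := dotProduct_comm _ _
  obtain ⟨y', hy'⟩ : ∃ y', y' = (Q.a p.1.1).mulVec p.1.2 := ⟨_, rfl⟩
  obtain ⟨b', hb'⟩ : ∃ b', b' = Q.b p.1.1 := ⟨_, rfl⟩
  obtain ⟨β, hβ⟩ : ∃ β, β = ev p Q.sq.β := ⟨_, rfl⟩
  obtain ⟨r, hr⟩ : ∃ r, r = ev p Q.sq.αi := ⟨_, rfl⟩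
  obtain ⟨F, hF⟩ : ∃ F, F = ev p Q.sq.F := ⟨_, rfl⟩
  rw [h0, e1, e2, ← ha, ← hy', ← hb', ← hβ, ← hr, ← hF]
  have hu := hsum (fun i => (1 - β ^ 2 * r ^ 2) * r * y' i + (2 + 2 * β * r) * b' i)
    (fun i => (1 - β ^ 2 * r ^ 2) * r * y' i + (2 + 2 * β * r) * b' i)
  have hw := hsum (fun i => b' i - β * r ^ 2 * y' i) (fun i => b' i - β * r ^ 2 * y' i)
  have hy := hsum y' y'
  have du : v ⬝ᵥ (fun i => (1 - β ^ 2 * r ^ 2) * r * y' i + (2 + 2 * β * r) * b' i)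
      = (1 - β ^ 2 * r ^ 2) * r * (v ⬝ᵥ y') + (2 + 2 * β * r) * (v ⬝ᵥ b') := by
    simp only [dotProduct, Finset.mul_sum, ← Finset.sum_add_distrib]
    exact Finset.sum_congr rfl fun i _ => by ring
  have dw : v ⬝ᵥ (fun i => b' i - β * r ^ 2 * y' i) = v ⬝ᵥ b' - β * r ^ 2 * (v ⬝ᵥ y') := by
    simp only [dotProduct, Finset.mul_sum, ← Finset.sum_sub_distrib]
    exact Finset.sum_congr rfl fun i _ => by ring
  rw [du] at hu
  rw [dw] at hw
  have key : ∀ i j, v i * fundTensor (sqMetric Q.a Q.b) p.1.1 p.1.2 i j * v j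
      = v i * (((1 - β ^ 2 * r ^ 2) * r * y' i + (2 + 2 * β * r) * b' i)
        * ((1 - β ^ 2 * r ^ 2) * r * y' j + (2 + 2 * β * r) * b' j)) * v j
      + F * (1 - β ^ 2 * r ^ 2) * r * (v i * Q.a p.1.1 i j * v j)
      - F * (1 - β ^ 2 * r ^ 2) * r ^ 3 * (v i * (y' i * y' j) * v j)
      + 2 * F * r * (v i * ((b' i - β * r ^ 2 * y' i) * (b' j - β * r ^ 2 * y' j)) * v j) :=
    fun i j => by
      rw [fundTensor_eq Q.represents_F_sq i j p, Q.sq.YY_F_sq]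
      simp only [map_add, map_mul, map_sub, map_pow, map_one, map_ofNat, ev_yl, ev_b, ev_a,
        ← hy', ← hb', ← hβ, ← hr, ← hF]
      ring
  simp only [key, Finset.sum_add_distrib, Finset.sum_sub_distrib, ← Finset.mul_sum, hu, hw, hy]
  ring

lemma fundTensor_det_isUnit (p : slit U) :
    IsUnit (fundTensor (sqMetric Q.a Q.b) p.1.1 p.1.2).det := by
  rw [isUnit_iff_ne_zero]
  intro h0
  obtain ⟨v, hv, hgv⟩ := Matrix.exists_mulVec_eq_zero_iff.2 h0
  have hx := p.2.1
  have hy := p.2.2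
  have key := Q.dotProduct_fundTensor p v
  rw [hgv, dotProduct_zero] at key
  have hα := Q.alphaOf_pos hx hy
  have hα2 := Q.alphaOf_sq hx hy
  have hβ := abs_lt.1 (Q.bf_lt hx hy)
  have hF := Q.represents_F p
  rw [sqMetric, betaOf_eq] at hF
  rw [hF, ev_β, ev_αi] at key
  set α := alphaOf Q.a p.1.1 p.1.2
  set β := Q.bf p.1.1 p.1.2
  have hFpos : 0 < (α + β) ^ 2 / α := by
    have : 0 < α + β := by linarith
    positivity
  have hs : 0 < 1 - β ^ 2 * α⁻¹ ^ 2 := by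
    have : β ^ 2 < α ^ 2 := by nlinarith
    have h2 : 1 - β ^ 2 * α⁻¹ ^ 2 = (α ^ 2 - β ^ 2) / α ^ 2 := by field_simp
    rw [h2]
    exact div_pos (by linarith) (by positivity)
  have hproj : Q.ip p.1.1 v v - α⁻¹ ^ 2 * Q.ip p.1.1 v p.1.2 ^ 2
      = Q.ip p.1.1 (v + (-(α⁻¹ ^ 2 * Q.ip p.1.1 v p.1.2)) • p.1.2)
        (v + (-(α⁻¹ ^ 2 * Q.ip p.1.1 v p.1.2)) • p.1.2) := by
    simp only [ip_add_left, ip_add_right, ip_smul_left, ip_smul_right, Q.ip_comm hx p.1.2 v,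
      ← hα2]
    field_simp
    ring
  set w := v + (-(α⁻¹ ^ 2 * Q.ip p.1.1 v p.1.2)) • p.1.2
  have hw : 0 ≤ Q.ip p.1.1 w w := by
    by_cases h : w = 0
    · rw [h]; simp [ip]
    · exact (Q.ip_pos hx h).le
  rw [hproj] at key
  set X := (1 - β ^ 2 * α⁻¹ ^ 2) * α⁻¹ * Q.ip p.1.1 v p.1.2
        + (2 + 2 * β * α⁻¹) * Q.bf p.1.1 v with hX
  set Z := Q.bf p.1.1 v - β * α⁻¹ ^ 2 * Q.ip p.1.1 v p.1.2
  have hk : 0 < (1 - β ^ 2 * α⁻¹ ^ 2) * α⁻¹ := by positivity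
  have hw0 : Q.ip p.1.1 w w = 0 := by
    by_contra h
    have : 0 < Q.ip p.1.1 w w := lt_of_le_of_ne hw (Ne.symm h)
    have : 0 < X ^ 2 + (α + β) ^ 2 / α * ((1 - β ^ 2 * α⁻¹ ^ 2) * α⁻¹ * Q.ip p.1.1 w w
      + 2 * α⁻¹ * Z ^ 2) := by positivity
    linarith
  have hX0 : X = 0 := by
    have : 0 ≤ (α + β) ^ 2 / α * ((1 - β ^ 2 * α⁻¹ ^ 2) * α⁻¹ * Q.ip p.1.1 w w
      + 2 * α⁻¹ * Z ^ 2) := by positivity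
    have : X ^ 2 = 0 := le_antisymm (by linarith) (sq_nonneg _)
    exact pow_eq_zero_iff two_ne_zero |>.1 this
  have hv2 : v = (α⁻¹ ^ 2 * Q.ip p.1.1 v p.1.2) • p.1.2 := by
    have := Q.ip_self_eq_zero hx hw0
    simp only [w, neg_smul] at this
    exact eq_of_sub_eq_zero (by rw [sub_eq_add_neg, this])
  generalize α⁻¹ ^ 2 * Q.ip p.1.1 v p.1.2 = c at hv2
  rw [hX, hv2, ip_smul_left, bf_smul, ← hα2] at hX0
  have : c * ((α + β) ^ 2 / α) = 0 := by
    rw [← hX0]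
    field_simp
    ring
  rcases mul_eq_zero.1 this with h | h
  · exact hv (by rw [hv2, h, zero_smul])
  · exact hFpos.ne' h

lemma represents_G (i : Fin n) : Represents (geoCoeff (sqMetric Q.a Q.b) i) (Q.sq.G i) := fun p => by
  refine (geoCoeff_eq Q.represents_F_sq p (Q.fundTensor_det_isUnit p) (fun i => ev p (Q.sq.G i))
    (fun l => ?_) i).symm
  have := congrArg (ev p) (Q.sq.EL_F_sq l)
  rw [TanCalc.EL, map_sub, map_sub, map_mul, map_ofNat, map_zero, ev_vert] at this
  linarith

end SqField
end Nondegeneracy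

section Isotropy

open TopologicalSpace SmoothAlg

variable {n : ℕ}

namespace TanCalc

variable {A : Type*} [CommRing A] [Algebra ℝ A] (T : TanCalc n A)

/-- The curvature of the spray is a multiple of the identity modulo the radial direction. -/
def Isotropic (G : Fin n → A) : Prop :=
  ∃ (l : A) (θ : Fin n → A), ∀ i k, T.curv G i k = l * (if i = k then 1 else 0) + θ k * T.y i

variable {T}

lemma Isotropic.projective {G : Fin n → A} (h : T.Isotropic G) {P : A}
    (hG : ∀ i, T.euler (G i) = 2 * G i) (hP : T.euler P = P) :
    T.Isotropic (fun i => G i + P * T.y i) := by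
  obtain ⟨l, θ, h⟩ := h
  refine ⟨l + (P ^ 2 - T.hor P + 2 * T.vert G P), fun k => θ k + (2 * T.X k P - T.hor (T.Y k P)
    + 2 * T.vert G (T.Y k P) - P * T.Y k P - T.vert (fun j => T.Y k (G j)) P), fun i k => ?_⟩
  rw [T.curv_projective hG hP, h]
  ring

lemma Isotropic.projective' {G H : Fin n → A} (h : T.Isotropic G) {P : A}
    (hG : ∀ i, T.euler (G i) = 2 * G i) (hP : T.euler P = P) (hH : ∀ i, G i = H i + P * T.y i) :
    T.Isotropic H := by
  have := h.projective hG (P := -P) (by rw [map_neg, hP])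
  convert this using 2 with i
  rw [hH]; ring

end TanCalc

variable {U : Opens (Vec n)}

lemma isotropic_radial {H : Fin n → SmoothAlg (slit U)} {l : SmoothAlg (slit U)}
    {θ : Fin n → SmoothAlg (slit U)} (hH : ∀ i, (tan U).euler (H i) = 2 * H i)
    (h : ∀ i k, (tan U).curv H i k = l * (if i = k then 1 else 0) + θ k * (tan U).y i) :
    l + ∑ k, θ k * (tan U).y k = 0 := by
  refine ext_ev fun p => ?_
  have : ∃ i, p.1.2 i ≠ 0 := by
    by_contra! hc
    exact p.2.2 (funext hc)
  obtain ⟨i, hi⟩ := this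
  have e := congrArg (ev p) ((tan U).curv_contract hH i)
  simp only [h] at e
  have e2 : ∑ k, (l * (if i = k then 1 else 0) + θ k * (tan U).y i) * (tan U).y k
      = (l + ∑ k, θ k * (tan U).y k) * (tan U).y i := by
    simp only [add_mul, Finset.sum_add_distrib, mul_ite, mul_one, mul_zero, ite_mul, zero_mul,
      Finset.sum_ite_eq, Finset.mem_univ, if_true, Finset.sum_mul]
    congr 1
    exact Finset.sum_congr rfl fun k _ => by ring
  rw [e2, map_mul, map_zero, ev_y] at e
  rw [map_zero]
  exact (mul_eq_zero.1 e).resolve_right hi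

lemma isotropic_trace {H : Fin n → SmoothAlg (slit U)} {l : SmoothAlg (slit U)}
    {θ : Fin n → SmoothAlg (slit U)} (hH : ∀ i, (tan U).euler (H i) = 2 * H i)
    (h : ∀ i k, (tan U).curv H i k = l * (if i = k then 1 else 0) + θ k * (tan U).y i) :
    ∑ i, (tan U).curv H i i = (n - 1) * l := by
  simp only [h, if_true, mul_one, Finset.sum_add_distrib, Finset.sum_const, Finset.card_univ,
    Fintype.card_fin, nsmul_eq_mul]
  linear_combination isotropic_radial hH h

lemma TanCalc.Isotropic.trace {H : Fin n → SmoothAlg (slit U)} (h : (tan U).Isotropic H)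
    (hH : ∀ i, (tan U).euler (H i) = 2 * H i) (q v : Fin n → SmoothAlg (slit U))
    (hq : ∑ i, q i * (tan U).y i = 0) :
    ((n : SmoothAlg (slit U)) - 1) * ∑ i, ∑ k, q i * (tan U).curv H i k * v k
      = (∑ i, (tan U).curv H i i) * ∑ i, q i * v i := by
  obtain ⟨l, θ, h⟩ := h
  have h2 := isotropic_trace hH h
  have h3 : ∑ i, ∑ k, q i * (tan U).curv H i k * v k
      = l * ∑ i, q i * v i + (∑ i, q i * (tan U).y i) * ∑ k, θ k * v k := by
    simp only [h, mul_add, add_mul, Finset.sum_add_distrib, mul_ite, mul_one, mul_zero, ite_mul,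
      zero_mul, Finset.sum_ite_eq, Finset.mem_univ, if_true, Finset.mul_sum, Finset.sum_mul]
    congr 1
    · exact Finset.sum_congr rfl fun k _ => by ring
    · rw [Finset.sum_comm]
      exact Finset.sum_congr rfl fun k _ => Finset.sum_congr rfl fun j _ => by ring
  rw [h3, h2, hq]
  ring

namespace SqField

variable (Q : SqField U)

open Classical in
lemma isScalarFlag_iff (hn : 2 ≤ n) :
    IsScalarFlag (U : Set (Vec n)) (sqMetric Q.a Q.b) ↔ (tan U).Isotropic Q.sq.G := by
  have hR : ∀ (p : slit U) i k, curvOfSpray (geoCoeff (sqMetric Q.a Q.b)) i k p.1.1 p.1.2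
      = ev p ((tan U).curv Q.sq.G i k) := fun p i k => curvOfSpray_eq Q.represents_G i k p
  have hE : (tan U).euler (Q.sq.F ^ 2) = 2 * Q.sq.F ^ 2 := by
    rw [pow_two, Derivation.leibniz, Q.sq.euler_F, smul_eq_mul]; ring
  have hY : ∀ (p : slit U) k, ∑ j, fundTensor (sqMetric Q.a Q.b) p.1.1 p.1.2 k j * p.1.2 j
      = 1 / 2 * ev p ((tan U).Y k (Q.sq.F ^ 2)) := fun p k => by
    rw [← (tan U).euler_Y_two hE k, TanCalc.euler, ev_vert, Finset.mul_sum]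
    refine Finset.sum_congr rfl fun j _ => ?_
    rw [fundTensor_eq Q.represents_F_sq, (tan U).YY k j, ev_y]; ring
  have hF : ∀ p : slit U, (sqMetric Q.a Q.b p.1.1 p.1.2) ^ 2 = ev p (Q.sq.F ^ 2) := fun p =>
    (Q.represents_F_sq p).symm
  have hF0 : ∀ p : slit U, ev p (Q.sq.F) * ev p (Q.sq.Fi) = 1 := fun p => by
    rw [← map_mul, Q.sq.F_mul_Fi, map_one]
  have hEp : ∀ p : slit U, ∑ k, p.1.2 k * ev p ((tan U).Y k (Q.sq.F ^ 2))
      = 2 * ev p (Q.sq.F ^ 2) := fun p => by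
    have := congrArg (ev p) hE
    rw [TanCalc.euler, ev_vert, map_mul, map_ofNat] at this
    exact this
  constructor
  · rintro ⟨K, hK⟩
    set c : SmoothAlg (slit U) := algebraMap ℝ _ ((n : ℝ) - 1)⁻¹ with hc
    refine ⟨c * ∑ i, (tan U).curv Q.sq.G i i,
      fun k => - (c * (∑ i, (tan U).curv Q.sq.G i i) * half _ * Q.sq.Fi ^ 2
        * (tan U).Y k (Q.sq.F ^ 2)), fun i k => ext_ev fun p => ?_⟩
    have h1 := fun i k => hK p.1.1 p.2.1 p.1.2 p.2.2 i k
    simp only [hR, hY, hF] at h1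
    have h2 : ev p (∑ i, (tan U).curv Q.sq.G i i)
        = (n - 1) * (K p.1.1 p.1.2 * ev p (Q.sq.F ^ 2)) := by
      rw [map_sum]
      simp only [h1, if_true, mul_one, mul_sub, Finset.sum_sub_distrib, Finset.sum_const,
        Finset.card_univ, Fintype.card_fin, nsmul_eq_mul]
      have : ∑ i, K p.1.1 p.1.2 * (p.1.2 i * (1 / 2 * ev p ((tan U).Y i (Q.sq.F ^ 2))))
          = K p.1.1 p.1.2 * (1 / 2 * ∑ i, p.1.2 i * ev p ((tan U).Y i (Q.sq.F ^ 2))) := by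
        simp only [Finset.mul_sum]
        exact Finset.sum_congr rfl fun k _ => by ring
      rw [this, hEp]
      ring
    have h3 : ev p c * ev p (∑ i, (tan U).curv Q.sq.G i i) = K p.1.1 p.1.2 * ev p (Q.sq.F ^ 2) := by
      have : (n : ℝ) - 1 ≠ 0 := by
        have : (2 : ℝ) ≤ n := by exact_mod_cast hn
        linarith
      rw [h2, hc, AlgHom.commutes, Algebra.algebraMap_self_apply]
      field_simp
    have h4 : ev p (half (SmoothAlg (slit U))) = 1 / 2 := by
      rw [half, AlgHom.commutes, Algebra.algebraMap_self_apply]; norm_num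
    have h5 : ev p (if i = k then 1 else 0) = if i = k then (1 : ℝ) else 0 := by
      split_ifs <;> simp
    rw [map_add, map_mul, map_mul, map_mul, map_neg, map_mul, map_mul, map_mul, map_mul, h3, h4, h5,
      h1, ev_y]
    have h6 : ev p (Q.sq.F ^ 2) * ev p (Q.sq.Fi ^ 2) = 1 := by
      rw [map_pow, map_pow, ← mul_pow, hF0, one_pow]
    linear_combination (1 / 2 * K p.1.1 p.1.2 * ev p ((tan U).Y k (Q.sq.F ^ 2)) * p.1.2 i) * h6
  · rintro ⟨l, θ, h⟩
    refine ⟨fun x y => if hp : (x, y) ∈ slit U then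
      ev ⟨(x, y), hp⟩ l * ev ⟨(x, y), hp⟩ (Q.sq.Fi) ^ 2 else 0, fun x hx y hy i k => ?_⟩
    have hp : (x, y) ∈ slit U := ⟨hx, hy⟩
    set p : slit U := ⟨(x, y), hp⟩ with hpdef
    have e1 := hR p i k
    have e2 := hY p k
    have e3 := hF p
    simp only [hpdef] at e1 e2 e3
    simp only [dif_pos hp, e1, e2, e3, h, ← hpdef]
    have e4 := congrArg (ev p) ((tan U).curv_orthogonal Q.sq.EL_F_sq Q.sq.hor_F_sq k)
    have h5 : ∀ i, ev p (if i = k then 1 else 0) = if i = k then (1 : ℝ) else 0 := fun i => by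
      split_ifs <;> simp
    simp only [h, map_sum, map_mul, map_ofNat, map_add, ev_y, h5, map_zero] at e4
    have e5 : ∑ i, ev p ((tan U).Y i (Q.sq.F ^ 2)) *
        (2 * (ev p l * (if i = k then (1 : ℝ) else 0) + ev p (θ k) * p.1.2 i))
        = 2 * ev p l * ev p ((tan U).Y k (Q.sq.F ^ 2))
          + 2 * ev p (θ k) * ∑ i, p.1.2 i * ev p ((tan U).Y i (Q.sq.F ^ 2)) := by
      simp only [mul_add, mul_ite, mul_one, mul_zero, Finset.sum_add_distrib, Finset.mul_sum,
        Finset.sum_ite_eq', Finset.mem_univ, if_true]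
      congr 1
      · ring
      · exact Finset.sum_congr rfl fun k _ => by ring
    rw [e5, hEp] at e4
    rw [map_add, map_mul, map_mul, h5, ev_y, map_pow (ev p) Q.sq.F]
    rw [map_pow (ev p) Q.sq.F] at e4
    have h6 := hF0 p
    have h7 : ev p Q.sq.F ^ 2 * ev p Q.sq.Fi ^ 2 = 1 := by rw [← mul_pow, h6, one_pow]
    change _ + _ * y i = _
    linear_combination 1 / 4 * ev p Q.sq.Fi ^ 2 * y i * e4
      - (ev p l * (if i = k then (1 : ℝ) else 0) + ev p (θ k) * y i) * h7

lemma isotropic_H_iff : (tan U).Isotropic Q.sq.G ↔ (tan U).Isotropic Q.sq.H :=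
  ⟨fun h => h.projective' Q.sq.euler_G Q.sq.euler_P fun _ => rfl,
    fun h => h.projective Q.sq.euler_H Q.sq.euler_P⟩

end SqField
end Isotropy

section Transport

open TopologicalSpace SmoothAlg

variable {n : ℕ}

/-- The coordinates on an open set of `ℝⁿ`. -/
def baseCoord (U : Opens (Vec n)) (i : Fin n) : SmoothAlg U :=
  SmoothAlg.mk (fun x => x i) (by fun_prop)

/-- A smooth diffeomorphism between open sets. -/
structure Chart (V W : Opens (Vec n)) where
  φ : Vec n → Vec n
  ψ : Vec n → Vec n
  smooth_φ : ContDiffOn ℝ (⊤ : ℕ∞) φ V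
  smooth_ψ : ContDiffOn ℝ (⊤ : ℕ∞) ψ W
  maps_φ : Set.MapsTo φ V W
  maps_ψ : Set.MapsTo ψ W V
  left_inv : ∀ x ∈ V, ψ (φ x) = x
  right_inv : ∀ u ∈ W, φ (ψ u) = u

namespace Chart

variable {V W : Opens (Vec n)} (c : Chart V W)

lemma differentiableAt_ψ {u : Vec n} (hu : u ∈ W) : DifferentiableAt ℝ c.ψ u :=
  (c.smooth_ψ.contDiffAt (W.isOpen.mem_nhds hu)).differentiableAt (by simp)

lemma differentiableAt_φ {x : Vec n} (hx : x ∈ V) : DifferentiableAt ℝ c.φ x :=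
  (c.smooth_φ.contDiffAt (V.isOpen.mem_nhds hx)).differentiableAt (by simp)

lemma fderiv_comp {u : Vec n} (hu : u ∈ W) (v : Vec n) :
    fderiv ℝ c.φ (c.ψ u) (fderiv ℝ c.ψ u v) = v := by
  have h1 : fderiv ℝ (c.φ ∘ c.ψ) u = ContinuousLinearMap.id ℝ (Vec n) := by
    rw [← fderiv_id (x := u)]
    refine Filter.EventuallyEq.fderiv_eq ?_
    filter_upwards [W.isOpen.mem_nhds hu] with z hz using c.right_inv z hz
  rw [_root_.fderiv_comp u (c.differentiableAt_φ (c.maps_ψ hu)) (c.differentiableAt_ψ hu)] at h1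
  exact congrArg (fun L : Vec n →L[ℝ] Vec n => L v) h1

/-- The map of slit tangent bundles induced by the inverse chart. -/
def tanMap (p : Vec n × Vec n) : Vec n × Vec n := (c.ψ p.1, fderiv ℝ c.ψ p.1 p.2)

lemma contDiffOn_tanMap : ContDiffOn ℝ (⊤ : ℕ∞) c.tanMap (slit W) := by
  have h1 : Set.MapsTo Prod.fst (slit W : Set (Vec n × Vec n)) W := fun p hp => hp.1
  exact (c.smooth_ψ.comp contDiff_fst.contDiffOn h1).prodMk
    ((((c.smooth_ψ.fderiv_of_isOpen W.isOpen (m := (⊤ : ℕ∞)) (by simp))).comp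
      contDiff_fst.contDiffOn h1).clm_apply contDiff_snd.contDiffOn)

lemma mapsTo_tanMap : Set.MapsTo c.tanMap (slit W) (slit V) := fun p hp =>
  ⟨c.maps_ψ hp.1, fun h => hp.2 (by rw [← c.fderiv_comp hp.1 p.2]; exact (congrArg _ h).trans (map_zero _))⟩

/-- The induced map on points. -/
def pt (p : slit W) : slit V := ⟨c.tanMap p, c.mapsTo_tanMap p.2⟩

/-- Pull-back of functions along the inverse chart. -/
def pull : SmoothAlg (slit V) →ₐ[ℝ] SmoothAlg (slit W) where
  toFun f := SmoothAlg.mk (fun p => toFn f (c.tanMap p))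
    ((contDiffOn_toFn f).comp c.contDiffOn_tanMap c.mapsTo_tanMap)
  map_one' := ext_ev fun p => by
    change toFn (1 : SmoothAlg (slit V)) (c.pt p) = 1
    rw [toFn_coe, map_one]
  map_mul' f g := ext_ev fun p => by
    have h := fun f : SmoothAlg (slit V) => toFn_coe f (c.pt p)
    change toFn (f * g) (c.pt p) = toFn f (c.pt p) * toFn g (c.pt p)
    rw [h, h, h, map_mul]
  map_zero' := ext_ev fun p => by
    change toFn (0 : SmoothAlg (slit V)) (c.pt p) = 0
    rw [toFn_coe, map_zero]
  map_add' f g := ext_ev fun p => by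
    have h := fun f : SmoothAlg (slit V) => toFn_coe f (c.pt p)
    change toFn (f + g) (c.pt p) = toFn f (c.pt p) + toFn g (c.pt p)
    rw [h, h, h, map_add]
  commutes' r := ext_ev fun p => by
    change toFn (algebraMap ℝ (SmoothAlg (slit V)) r) (c.pt p) = r
    rw [toFn_coe, AlgHom.commutes, Algebra.algebraMap_self_apply]

lemma ev_pull (f : SmoothAlg (slit V)) (p : slit W) : ev p (c.pull f) = ev (c.pt p) f :=
  toFn_coe f (c.pt p)

lemma pull_base_coord (l : Fin n) : c.pull (base V (baseCoord V l))
    = base W (SmoothAlg.mk (fun u => c.ψ u l) (contDiffOn_pi.1 c.smooth_ψ l)) :=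
  ext_ev fun p => by rw [ev_pull, ev_base, ev_base]; rfl

lemma pull_y (l : Fin n) : c.pull ((tan V).y l)
    = (tan W).hor (base W (SmoothAlg.mk (fun u => c.ψ u l) (contDiffOn_pi.1 c.smooth_ψ l))) := by
  refine ext_ev fun p => ?_
  rw [ev_pull, ev_hor, ev_y]
  change fderiv ℝ c.ψ p.1.1 p.1.2 l = _
  conv_lhs => rw [← sum_single_smul p.1.2]
  rw [map_sum, Finset.sum_apply]
  refine Finset.sum_congr rfl fun k _ => ?_
  rw [X_base, ev_base, ev_dir _ _ (g := fun u => c.ψ u l) fun _ => rfl, map_smul, Pi.smul_apply, smul_eq_mul]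
  congr 1
  have := (hasFDerivAt_pi'.1 (c.differentiableAt_ψ p.2.1).hasFDerivAt l).fderiv
  rw [this]
  rfl

lemma pull_base_φ (i : Fin n) :
    c.pull (base V (SmoothAlg.mk (fun x => c.φ x i) (contDiffOn_pi.1 c.smooth_φ i)))
      = base W (baseCoord W i) :=
  ext_ev fun p => by
    rw [ev_pull, ev_base, ev_base]
    exact congrFun (c.right_inv p.1.1 p.2.1) i

lemma dir_pull (w : Vec n × Vec n) (f : SmoothAlg (slit V)) : dir w (c.pull f) =
    ∑ l, (c.pull ((tan V).X l f) * dir w (c.pull (base V (baseCoord V l)))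
      + c.pull ((tan V).Y l f) * dir w (c.pull ((tan V).y l))) := by
  refine ext_ev fun p => ?_
  have hT : DifferentiableAt ℝ c.tanMap p :=
    (c.contDiffOn_tanMap.contDiffAt ((slit W).isOpen.mem_nhds p.2)).differentiableAt (by simp)
  have key : ∀ f : SmoothAlg (slit V), ev p (dir w (c.pull f))
      = fderiv ℝ (toFn f) (c.pt p) (fderiv ℝ c.tanMap p w) := by
    intro f
    rw [ev_dir w (c.pull f) (g := toFn f ∘ c.tanMap) fun _ => rfl,
      _root_.fderiv_comp (p : Vec n × Vec n) (differentiableAt_toFn f (c.pt p)) hT]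
    rfl
  set z := fderiv ℝ c.tanMap p w with hz
  have e1 : ∀ l, ev p (dir w (c.pull (base V (baseCoord V l)))) = z.1 l := by
    intro l
    rw [key, ← ev_dir_toFn, ev_dir _ _ (g := fun p => p.1 l) fun p => ev_base _ _]
    have : (fun p : Vec n × Vec n => p.1 l)
      = ((ContinuousLinearMap.proj l).comp (ContinuousLinearMap.fst ℝ (Vec n) (Vec n))) := rfl
    rw [this, ContinuousLinearMap.fderiv]
    rfl
  have e2 : ∀ l, ev p (dir w (c.pull ((tan V).y l))) = z.2 l := by
    intro l
    rw [key, ← ev_dir_toFn, ev_dir _ _ (g := fun p => p.2 l) fun p => rfl]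
    have : (fun p : Vec n × Vec n => p.2 l)
      = ((ContinuousLinearMap.proj l).comp (ContinuousLinearMap.snd ℝ (Vec n) (Vec n))) := rfl
    rw [this, ContinuousLinearMap.fderiv]
    rfl
  have e3 : z = ∑ l, (z.1 l • ((Pi.single l 1, 0) : Vec n × Vec n) + z.2 l • (0, Pi.single l 1)) := by
    rw [Finset.sum_add_distrib]
    ext i <;> simp [Prod.fst_sum, Prod.snd_sum, Finset.sum_apply, Pi.single_apply]
  rw [key]
  conv_lhs => rw [e3]
  rw [map_sum, map_sum]
  refine Finset.sum_congr rfl fun l _ => ?_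
  rw [map_add, map_add, map_mul, map_mul, e1, e2, map_smul, map_smul, ev_pull, ev_pull,
    smul_eq_mul, smul_eq_mul, mul_comm, mul_comm (z.2 l)]
  rfl

/-- The Jacobian of the inverse chart. -/
def jac (l A : Fin n) : SmoothAlg (slit W) :=
  (tan W).X A (base W (SmoothAlg.mk (fun u => c.ψ u l) (contDiffOn_pi.1 c.smooth_ψ l)))

/-- The quadratic part of the second derivative of the inverse chart. -/
def accel (l : Fin n) : SmoothAlg (slit W) := (tan W).hor (c.pull ((tan V).y l))

lemma Y_jac (l A B : Fin n) : (tan W).Y B (c.jac l A) = 0 := by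
  rw [jac, X_base, Y_base]

lemma X_pull (A : Fin n) (f : SmoothAlg (slit V)) : (tan W).X A (c.pull f) =
    ∑ l, (c.pull ((tan V).X l f) * c.jac l A
      + c.pull ((tan V).Y l f) * (tan W).hor (c.jac l A)) := by
  refine (c.dir_pull _ f).trans (Finset.sum_congr rfl fun l _ => ?_)
  rw [pull_base_coord, jac, ← TanCalc.X_hor, ← pull_y]
  rfl

lemma Y_pull (A : Fin n) (f : SmoothAlg (slit V)) : (tan W).Y A (c.pull f) =
    ∑ l, c.pull ((tan V).Y l f) * c.jac l A := by
  refine (c.dir_pull _ f).trans (Finset.sum_congr rfl fun l _ => ?_)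
  have h1 := (tan W).Y_hor A (base W (SmoothAlg.mk (fun u => c.ψ u l) (contDiffOn_pi.1 c.smooth_ψ l)))
  rw [← pull_y, Y_base, map_zero, add_zero] at h1
  have h2 := Y_base A (SmoothAlg.mk (fun u => c.ψ u l) (contDiffOn_pi.1 c.smooth_ψ l))
  rw [← pull_base_coord] at h2
  change _ * (tan W).Y A _ + _ * (tan W).Y A _ = _
  rw [h1, h2, mul_zero, zero_add]
  rfl

lemma hor_pull (f : SmoothAlg (slit V)) : (tan W).hor (c.pull f) =
    c.pull ((tan V).hor f) + ∑ l, c.pull ((tan V).Y l f) * c.accel l := by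
  have h1 : ∀ l, c.pull ((tan V).y l) = ∑ A, (tan W).y A * c.jac l A := fun l => by
    rw [pull_y, TanCalc.hor_apply]; rfl
  have h2 : ∀ l, c.accel l = ∑ A, (tan W).y A * (tan W).hor (c.jac l A) := fun l => by
    rw [accel, h1, map_sum]
    exact Finset.sum_congr rfl fun A _ => by
      rw [Derivation.leibniz, TanCalc.hor_coord]; simp
  rw [TanCalc.hor_apply, TanCalc.hor_apply, map_sum]
  simp only [X_pull, map_mul, h1, h2, Finset.mul_sum, Finset.sum_mul, mul_add, Finset.sum_add_distrib]
  congr 1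
  · rw [Finset.sum_comm]
    exact Finset.sum_congr rfl fun l _ => Finset.sum_congr rfl fun A _ => by ring
  · rw [Finset.sum_comm]
    exact Finset.sum_congr rfl fun l _ => Finset.sum_congr rfl fun A _ => by ring

/-- The components of the chart, as functions on the slit tangent bundle. -/
def comp (i : Fin n) : SmoothAlg (slit V) :=
  base V (SmoothAlg.mk (fun x => c.φ x i) (contDiffOn_pi.1 c.smooth_φ i))

lemma pull_hor_comp (i : Fin n) : c.pull ((tan V).hor (c.comp i)) = (tan W).y i := by
  have h := c.hor_pull (c.comp i)
  have h1 : ∀ l, (tan V).Y l (c.comp i) = 0 := fun l => Y_base _ _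
  simp only [h1, map_zero, zero_mul, Finset.sum_const_zero, add_zero] at h
  rw [← h, comp, pull_base_φ]
  refine ext_ev fun p => ?_
  rw [ev_hor, ev_y]
  have : ∀ k, ev p ((tan W).X k (base W (baseCoord W i))) = (Pi.single k (1 : ℝ) : Vec n) i := by
    intro k
    rw [X_base, ev_base, ev_dir _ _ (g := fun x => x i) fun _ => rfl]
    exact congrArg (fun L : Vec n →L[ℝ] ℝ => L _)
      (ContinuousLinearMap.fderiv (ContinuousLinearMap.proj (R := ℝ) (φ := fun _ : Fin n => ℝ) i))
  simp [this, Pi.single_apply]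

/-- The Jacobian of the chart, pulled back. -/
def invJac (i l : Fin n) : SmoothAlg (slit W) := c.pull ((tan V).Y l ((tan V).hor (c.comp i)))

lemma invJac_mul_jac (i A : Fin n) : ∑ l, c.invJac i l * c.jac l A = if i = A then 1 else 0 := by
  rw [← (tan W).Yy A i, ← pull_hor_comp, Y_pull]
  rfl

lemma invJac_mul_accel (i : Fin n) :
    ∑ l, c.invJac i l * c.accel l = -c.pull ((tan V).hor ((tan V).hor (c.comp i))) := by
  have h := c.hor_pull ((tan V).hor (c.comp i))
  rw [pull_hor_comp, TanCalc.hor_coord] at h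
  exact (neg_eq_of_add_eq_zero_right h.symm).symm

lemma jac_mul_invJac (l m : Fin n) : ∑ i, c.jac l i * c.invJac i m = if l = m then 1 else 0 := by
  have h : Matrix.of c.invJac * Matrix.of c.jac = 1 := by
    ext1 i j; rw [Matrix.mul_apply, Matrix.one_apply]; exact c.invJac_mul_jac i j
  have h2 := congrFun (congrFun (show Matrix.of c.jac * Matrix.of c.invJac = 1 from mul_eq_one_comm.1 h) l) m
  rwa [Matrix.mul_apply, Matrix.one_apply] at h2

/-- The transported spray. -/
def spray (G : Fin n → SmoothAlg (slit V)) (i : Fin n) : SmoothAlg (slit W) :=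
  half _ * c.pull (2 * (tan V).vert G ((tan V).hor (c.comp i)) - (tan V).hor ((tan V).hor (c.comp i)))

lemma jac_mul_spray (G : Fin n → SmoothAlg (slit V)) (m : Fin n) :
    2 * ∑ i, c.jac m i * c.spray G i = 2 * c.pull (G m) + c.accel m := by
  have h : ∀ i, 2 * c.spray G i = ∑ l, c.invJac i l * (2 * c.pull (G l) + c.accel l) := by
    intro i
    rw [spray, ← mul_assoc, two_mul_half, one_mul, map_sub, sub_eq_add_neg, ← invJac_mul_accel, map_mul, map_ofNat,
      TanCalc.vert_apply, map_sum, Finset.mul_sum, ← Finset.sum_add_distrib]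
    exact Finset.sum_congr rfl fun l _ => by rw [map_mul, invJac]; ring
  have h2 : ∀ i, 2 * (c.jac m i * c.spray G i)
      = ∑ l, c.jac m i * c.invJac i l * (2 * c.pull (G l) + c.accel l) := fun i => by
    rw [mul_left_comm, h, Finset.mul_sum]
    exact Finset.sum_congr rfl fun l _ => by ring
  rw [Finset.mul_sum]
  simp only [h2]
  rw [Finset.sum_comm]
  simp only [← Finset.sum_mul, jac_mul_invJac]
  simp

lemma YY_pull (A B : Fin n) (f : SmoothAlg (slit V)) : (tan W).Y B ((tan W).Y A (c.pull f)) =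
    ∑ l, ∑ m, c.pull ((tan V).Y m ((tan V).Y l f)) * c.jac m B * c.jac l A := by
  rw [Y_pull, map_sum]
  refine Finset.sum_congr rfl fun l _ => ?_
  rw [Derivation.leibniz, Y_jac, smul_zero, zero_add, Y_pull, smul_eq_mul, Finset.mul_sum]
  exact Finset.sum_congr rfl fun m _ => by ring

lemma EL_pull {L : SmoothAlg (slit V)} {G : Fin n → SmoothAlg (slit V)}
    (h : ∀ l, (tan V).EL L G l = 0) (A : Fin n) : (tan W).EL (c.pull L) (c.spray G) A = 0 := by
  have h1 : (tan W).hor ((tan W).Y A (c.pull L)) - (tan W).X A (c.pull L)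
      = ∑ l, ∑ m, c.jac l A * (c.pull ((tan V).Y m ((tan V).Y l L)) * (2 * c.pull (G m) + c.accel m)) := by
    rw [Y_pull, X_pull, map_sum, ← Finset.sum_sub_distrib]
    refine Finset.sum_congr rfl fun l _ => ?_
    have e := congrArg c.pull (h l)
    rw [TanCalc.EL, map_sub, map_sub, map_mul, map_ofNat, map_zero, TanCalc.vert_apply, map_sum] at e
    simp only [map_mul] at e
    rw [Derivation.leibniz, hor_pull, smul_eq_mul, smul_eq_mul, ← Finset.mul_sum]
    simp only [mul_add (c.pull _), Finset.sum_add_distrib]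
    have e2 : ∑ m, c.pull ((tan V).Y m ((tan V).Y l L)) * (2 * c.pull (G m))
        = 2 * ∑ m, c.pull (G m) * c.pull ((tan V).Y m ((tan V).Y l L)) := by
      rw [Finset.mul_sum]; exact Finset.sum_congr rfl fun m _ => by ring
    rw [e2]
    linear_combination c.jac l A * e
  rw [TanCalc.EL, h1, sub_eq_zero]
  simp only [← jac_mul_spray]
  rw [TanCalc.vert_apply]
  simp only [YY_pull, Finset.mul_sum]
  rw [Finset.sum_comm (s := Finset.univ (α := Fin n)) (t := Finset.univ (α := Fin n))
    (f := fun i l => ∑ m, 2 * (c.spray G i * (c.pull ((tan V).Y m ((tan V).Y l L)) * c.jac m i * c.jac l A)))]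
  refine Finset.sum_congr rfl fun l _ => ?_
  rw [Finset.sum_comm]
  exact Finset.sum_congr rfl fun i _ => Finset.sum_congr rfl fun m _ => by ring

/-- Transport of the geodesic coefficients. -/
lemma geoCoeff_transport {F : Vec n → Vec n → ℝ} {L : SmoothAlg (slit V)}
    (hF : Represents (fun x y => F x y ^ 2) L) {G : Fin n → SmoothAlg (slit V)}
    (hG : ∀ l, (tan V).EL L G l = 0)
    (hdet : ∀ p : slit V, IsUnit (fundTensor F p.1.1 p.1.2).det) (i : Fin n) :
    Represents (geoCoeff (fun u v => F (c.ψ u) (fderiv ℝ c.ψ u v)) i) (c.spray G i) := by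
  intro p
  have hF' : Represents (fun u v => F (c.ψ u) (fderiv ℝ c.ψ u v) ^ 2) (c.pull L) := fun p => by
    rw [ev_pull, hF (c.pt p)]; rfl
  refine (geoCoeff_eq hF' p ?_ (fun j => ev p (c.spray G j)) (fun l => ?_) i).symm
  · have h1 : fundTensor (fun u v => F (c.ψ u) (fderiv ℝ c.ψ u v)) p.1.1 p.1.2
        = (Matrix.of fun l A => ev p (c.jac l A)).transpose * fundTensor F (c.pt p).1.1 (c.pt p).1.2
          * Matrix.of fun l A => ev p (c.jac l A) := by
      ext B A
      rw [fundTensor_eq hF', YY_pull, Matrix.mul_apply, map_sum, Finset.mul_sum]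
      refine Finset.sum_congr rfl fun l _ => ?_
      rw [Matrix.mul_apply, map_sum, Finset.mul_sum, Finset.sum_mul]
      refine Finset.sum_congr rfl fun m _ => ?_
      rw [fundTensor_eq hF, map_mul, map_mul, ev_pull, Matrix.transpose_apply, Matrix.of_apply,
        Matrix.of_apply]
      ring
    have h2 : (Matrix.of fun l A => ev p (c.invJac l A)) * (Matrix.of fun l A => ev p (c.jac l A)) = 1 := by
      ext i j
      have := congrArg (ev p) (c.invJac_mul_jac i j)
      rw [map_sum] at this
      rw [Matrix.mul_apply, Matrix.one_apply]
      simp only [map_mul] at this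
      rw [apply_ite (ev p), map_one, map_zero] at this
      exact this
    have h3 : IsUnit (Matrix.of fun l A => ev p (c.jac l A)).det :=
      (Matrix.isUnit_iff_isUnit_det _).1 (IsUnit.of_mul_eq_one _ (mul_eq_one_comm.1 h2))
    rw [h1, Matrix.det_mul, Matrix.det_mul, Matrix.det_transpose]
    exact (h3.mul (hdet (c.pt p))).mul h3
  · have := congrArg (ev p) (c.EL_pull hG l)
    rw [TanCalc.EL, map_sub, map_sub, map_mul, map_ofNat, map_zero, ev_vert] at this
    linarith

end Chart
end Transport

section ProjectivelyFlat

open TopologicalSpace SmoothAlg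

variable {n : ℕ}

/-- A spray whose geodesics are straight lines in the coordinates `Φ` has no curvature. -/
lemma TanCalc.curv_eq_zero_of_flat {A : Type*} [CommRing A] [Algebra ℝ A] (T : TanCalc n A)
    {H Φ : Fin n → A} {M : Fin n → Fin n → A} (hY : ∀ k a, T.Y k (Φ a) = 0)
    (hM : ∀ i j, ∑ a, M i a * T.X j (Φ a) = if i = j then 1 else 0)
    (hH : ∀ a, 2 * T.vert H (T.hor (Φ a)) = T.hor (T.hor (Φ a))) (i k : Fin n) :
    T.curv H i k = 0 := by
  have hYX : ∀ k j a, T.Y k (T.X j (Φ a)) = 0 := fun k j a => by rw [T.YX, hY, map_zero]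
  have hYh : ∀ k a, T.Y k (T.hor (Φ a)) = T.X k (Φ a) := fun k a => by
    rw [T.Y_hor, hY, map_zero, add_zero]
  have hV : ∀ V j a, T.vert V (T.X j (Φ a)) = 0 := fun V j a => by
    simp [T.vert_apply, hYX]
  have hVh : ∀ V a, T.vert V (T.hor (Φ a)) = ∑ j, V j * T.X j (Φ a) := fun V a => by
    simp [T.vert_apply, hYh]
  have two : ∀ D : Derivation ℝ A A, ∀ f, D (2 * f) = 2 * D f := fun D f => by
    rw [two_mul, map_add, two_mul]
  have e1 : ∀ k a, T.hor (T.X k (Φ a)) = ∑ j, T.Y k (H j) * T.X j (Φ a) := fun k a => by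
    have := congrArg (T.Y k) (hH a)
    rw [two, T.Y_vert, hYh, hV, hVh, add_zero, T.Y_hor, T.X_hor, hYh] at this
    refine two_cancel ?_
    rw [this]; ring
  have e2 : ∀ a, T.hor (T.hor (T.X k (Φ a))) = 2 * ∑ j, T.X k (H j) * T.X j (Φ a)
      + 2 * T.vert H (T.hor (T.X k (Φ a))) := fun a => by
    have := congrArg (T.X k) (hH a)
    rw [two, T.X_vert, T.X_hor, T.X_hor, hVh, T.X_hor] at this
    rw [← this]; ring
  have e3 : ∀ a, T.hor (T.hor (T.X k (Φ a))) = ∑ j, T.hor (T.Y k (H j)) * T.X j (Φ a)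
      + ∑ j, ∑ l, T.Y k (H l) * T.Y l (H j) * T.X j (Φ a) := fun a => by
    rw [e1, map_sum]
    simp only [Derivation.leibniz, smul_eq_mul, Finset.sum_add_distrib, e1, Finset.mul_sum]
    rw [add_comm]
    congr 1
    · exact Finset.sum_congr rfl fun j _ => by ring
    · rw [Finset.sum_comm]
      exact Finset.sum_congr rfl fun j _ => Finset.sum_congr rfl fun l _ => by ring
  have e4 : ∀ a, T.vert H (T.hor (T.X k (Φ a))) = ∑ j, T.vert H (T.Y k (H j)) * T.X j (Φ a) := by
    intro a
    rw [e1, map_sum]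
    simp only [Derivation.leibniz, smul_eq_mul, hV, mul_zero, zero_add]
    exact Finset.sum_congr rfl fun j _ => by ring
  have e5 : ∀ a, ∑ j, T.curv H j k * T.X j (Φ a) = 0 := fun a => by
    have h := (e3 a).symm.trans (e2 a)
    rw [e4] at h
    simp only [curv, sub_mul, add_mul, mul_assoc, Finset.sum_add_distrib, Finset.sum_sub_distrib,
      ← Finset.mul_sum, T.vert_apply (fun j => T.Y k (H j)), Finset.sum_mul] at h ⊢
    linear_combination -h
  have e6 : ∑ a, M i a * ∑ j, T.curv H j k * T.X j (Φ a) = T.curv H i k := by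
    simp only [Finset.mul_sum]
    rw [Finset.sum_comm]
    have : ∀ j, ∑ a, M i a * (T.curv H j k * T.X j (Φ a)) = T.curv H j k * if i = j then 1 else 0 := by
      intro j
      rw [← hM i j, Finset.mul_sum]
      exact Finset.sum_congr rfl fun a _ => by ring
    simp [this]
  rw [← e6]
  simp [e5]

namespace Chart

variable {V W : Opens (Vec n)} (c : Chart V W)

/-- The inverse chart. -/
def symm : Chart W V where
  φ := c.ψ
  ψ := c.φ
  smooth_φ := c.smooth_ψ
  smooth_ψ := c.smooth_φ
  maps_φ := c.maps_ψ
  maps_ψ := c.maps_φ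
  left_inv := c.right_inv
  right_inv := c.left_inv

lemma pt_symm_pt (p : slit V) : c.pt (c.symm.pt p) = p := by
  refine Subtype.ext (Prod.ext (c.left_inv _ p.2.1) ?_)
  exact c.symm.fderiv_comp p.2.1 p.1.2

/-- The spray of straight lines in the chart. -/
def flatSpray (i : Fin n) : SmoothAlg (slit V) :=
  half _ * ∑ a, c.symm.invJac i a * (tan V).hor ((tan V).hor (c.comp a))

lemma hor_comp (a : Fin n) : (tan V).hor (c.comp a) = c.symm.pull ((tan W).y a) :=
  (c.symm.pull_y a).symm

lemma Y_comp (k a : Fin n) : (tan V).Y k (c.comp a) = 0 := Y_base _ _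

lemma X_comp (j a : Fin n) : (tan V).X j (c.comp a) = c.symm.jac a j := rfl

lemma vert_hor_comp (H : Fin n → SmoothAlg (slit V)) (a : Fin n) :
    (tan V).vert H ((tan V).hor (c.comp a)) = ∑ j, H j * c.symm.jac a j := by
  simp [TanCalc.vert_apply, TanCalc.Y_hor, Y_comp, X_comp]

lemma vert_flatSpray (a : Fin n) :
    2 * (tan V).vert c.flatSpray ((tan V).hor (c.comp a)) = (tan V).hor ((tan V).hor (c.comp a)) := by
  rw [vert_hor_comp]
  have h : ∀ j, c.flatSpray j * c.symm.jac a j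
      = half _ * ∑ d, c.symm.jac a j * c.symm.invJac j d * (tan V).hor ((tan V).hor (c.comp d)) := by
    intro j
    rw [flatSpray, mul_assoc, Finset.sum_mul]
    congr 1
    exact Finset.sum_congr rfl fun d _ => by ring
  simp only [h, ← Finset.mul_sum]
  rw [Finset.sum_comm, ← mul_assoc, two_mul_half, one_mul]
  simp only [← Finset.sum_mul, jac_mul_invJac]
  simp

lemma curv_flatSpray (i k : Fin n) : (tan V).curv c.flatSpray i k = 0 :=
  (tan V).curv_eq_zero_of_flat c.Y_comp c.symm.invJac_mul_jac c.vert_flatSpray i k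

lemma euler_flatSpray (i : Fin n) : (tan V).euler (c.flatSpray i) = 2 * c.flatSpray i := by
  have h1 : ∀ a, (tan V).euler (c.comp a) = 0 := fun a => by
    simp [TanCalc.euler, TanCalc.vert_apply, Y_comp]
  have h2 : ∀ a, (tan V).euler ((tan V).hor ((tan V).hor (c.comp a)))
      = 2 * (tan V).hor ((tan V).hor (c.comp a)) := fun a => by
    rw [TanCalc.euler_hor, TanCalc.euler_hor, h1, map_zero, add_zero, two_mul]
  have h3 : ∀ a j, (tan V).euler (c.symm.jac a j) = 0 := fun a j => by
    simp [TanCalc.euler, TanCalc.vert_apply, Y_jac]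
  have h4 : ∀ d, ∑ j, c.flatSpray j * c.symm.jac d j
      = half _ * (tan V).hor ((tan V).hor (c.comp d)) := fun d => by
    rw [← vert_hor_comp, ← vert_flatSpray, ← mul_assoc, mul_comm (half _), two_mul_half, one_mul]
  have h5 : ∀ d, ∑ j, ((tan V).euler (c.flatSpray j) - 2 * c.flatSpray j) * c.symm.jac d j = 0 := by
    intro d
    have := congrArg (tan V).euler (h4 d)
    rw [map_sum] at this
    simp only [Derivation.leibniz, h3, h2, Derivation.map_half, smul_eq_mul, mul_zero, zero_add,
      add_zero] at this
    simp only [sub_mul, Finset.sum_sub_distrib, mul_assoc, ← Finset.mul_sum, h4]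
    rw [sub_eq_zero]
    linear_combination (exp := 1) this + Finset.sum_congr rfl
      (fun j (_ : j ∈ (Finset.univ : Finset (Fin n))) =>
        mul_comm ((tan V).euler (c.flatSpray j)) (c.symm.jac d j))
  have h6 : ∑ d, c.symm.invJac i d * ∑ j, ((tan V).euler (c.flatSpray j) - 2 * c.flatSpray j)
      * c.symm.jac d j = (tan V).euler (c.flatSpray i) - 2 * c.flatSpray i := by
    simp only [Finset.mul_sum]
    rw [Finset.sum_comm]
    have : ∀ j, ∑ d, c.symm.invJac i d * (((tan V).euler (c.flatSpray j) - 2 * c.flatSpray j)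
        * c.symm.jac d j) = ((tan V).euler (c.flatSpray j) - 2 * c.flatSpray j)
          * if i = j then 1 else 0 := fun j => by
      rw [← c.symm.invJac_mul_jac i j, Finset.mul_sum]
      exact Finset.sum_congr rfl fun a _ => by ring
    simp [this]
  rw [← sub_eq_zero, ← h6]
  simp [h5]

end Chart

namespace SqField

variable {V W : Opens (Vec n)} (Q : SqField V) (c : Chart V W)

lemma represents_transport (i : Fin n) : Represents
    (geoCoeff (fun u v => sqMetric Q.a Q.b (c.ψ u) (fderiv ℝ c.ψ u v)) i) (c.spray Q.sq.G i) :=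
  c.geoCoeff_transport Q.represents_F_sq Q.sq.EL_F_sq Q.fundTensor_det_isUnit i

lemma transport_of_projective {P : SmoothAlg (slit V)}
    (h : ∀ i, 2 * (tan V).vert Q.sq.G ((tan V).hor (c.comp i)) - (tan V).hor ((tan V).hor (c.comp i))
      = 2 * P * (tan V).hor (c.comp i)) (p : slit W) (i : Fin n) :
    geoCoeff (fun u v => sqMetric Q.a Q.b (c.ψ u) (fderiv ℝ c.ψ u v)) i p.1.1 p.1.2
      = ev p (c.pull P) * p.1.2 i := by
  rw [← Q.represents_transport c i p, Chart.spray, h, map_mul c.pull, map_mul c.pull, map_ofNat,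
    c.pull_hor_comp, mul_assoc, ← mul_assoc (half _), mul_comm (half _), two_mul_half, one_mul, map_mul,
    ev_y]

lemma isotropic_of_chart {P : Vec n → Vec n → ℝ} (h : ∀ (p : slit W) (i : Fin n),
    geoCoeff (fun u v => sqMetric Q.a Q.b (c.ψ u) (fderiv ℝ c.ψ u v)) i p.1.1 p.1.2
      = P p.1.1 p.1.2 * p.1.2 i) : (tan V).Isotropic Q.sq.G := by
  have h1 : ∀ p : slit V, ∃ r : ℝ, ∀ i, ev p (Q.sq.G i - c.flatSpray i) = r * p.1.2 i := by
    intro p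
    set q := c.symm.pt p with hq
    refine ⟨P q.1.1 q.1.2, fun i => ?_⟩
    have e1 : ∀ a, ev p ((tan V).vert (fun j => Q.sq.G j - c.flatSpray j) ((tan V).hor (c.comp a)))
        = P q.1.1 q.1.2 * ev p ((tan V).hor (c.comp a)) := by
      intro a
      have := (Q.represents_transport c a q).trans (h q a)
      rw [Chart.spray, ← c.vert_flatSpray, ← mul_sub, ← TanCalc.vert_sub, map_mul c.pull, map_ofNat, ← mul_assoc,
        mul_comm (half _), two_mul_half, one_mul, c.ev_pull, hq, c.pt_symm_pt, ← hq] at this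
      rw [this, c.hor_comp, c.symm.ev_pull, ev_y]
    have e2 : ∀ a, ∑ j, (ev p (Q.sq.G j - c.flatSpray j) - P q.1.1 q.1.2 * p.1.2 j)
        * ev p (c.symm.jac a j) = 0 := by
      intro a
      have e3 := e1 a
      rw [c.vert_hor_comp, TanCalc.hor_apply, map_sum, map_sum, Finset.mul_sum] at e3
      simp only [sub_mul, Finset.sum_sub_distrib]
      rw [sub_eq_zero]
      simp only [map_mul, ev_y, c.X_comp] at e3
      rw [e3]
      exact Finset.sum_congr rfl fun j _ => by ring
    have e4 : ∑ a, ev p (c.symm.invJac i a) * ∑ j, (ev p (Q.sq.G j - c.flatSpray j)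
        - P q.1.1 q.1.2 * p.1.2 j) * ev p (c.symm.jac a j)
        = ev p (Q.sq.G i - c.flatSpray i) - P q.1.1 q.1.2 * p.1.2 i := by
      simp only [Finset.mul_sum]
      rw [Finset.sum_comm]
      have : ∀ j, ∑ a, ev p (c.symm.invJac i a) * ((ev p (Q.sq.G j - c.flatSpray j)
          - P q.1.1 q.1.2 * p.1.2 j) * ev p (c.symm.jac a j))
          = (ev p (Q.sq.G j - c.flatSpray j) - P q.1.1 q.1.2 * p.1.2 j) * if i = j then 1 else 0 := by
        intro j
        have := congrArg (ev p) (c.symm.invJac_mul_jac i j)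
        rw [map_sum, apply_ite (ev p), map_one, map_zero] at this
        simp only [map_mul] at this
        rw [← this, Finset.mul_sum]
        exact Finset.sum_congr rfl fun a _ => by ring
      simp only [this, mul_ite, mul_one, mul_zero, Finset.sum_ite_eq, Finset.mem_univ, if_true]
    rw [← sub_eq_zero, ← e4]
    simp only [e2, mul_zero, Finset.sum_const_zero]
  have hyl : ∑ i, Q.sq.yl i * Q.sq.αi ^ 2 * (tan V).y i = 1 := by
    have : ∑ i, Q.sq.yl i * (tan V).y i = Q.sq.α ^ 2 := by
      rw [Q.sq.α_sq']; exact Finset.sum_congr rfl fun i _ => mul_comm _ _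
    have h2 : Q.sq.α ^ 2 * Q.sq.αi ^ 2 = 1 := by rw [← mul_pow, Q.sq.α_inv, one_pow]
    rw [← h2, ← this, Finset.sum_mul]
    exact Finset.sum_congr rfl fun i _ => by ring
  set R : SmoothAlg (slit V) := ∑ i, Q.sq.yl i * Q.sq.αi ^ 2 * (Q.sq.G i - c.flatSpray i) with hR
  have h2 : ∀ i, Q.sq.G i = c.flatSpray i + R * (tan V).y i := by
    intro i
    rw [← sub_eq_iff_eq_add']
    refine ext_ev fun p => ?_
    obtain ⟨r, hr⟩ := h1 p
    have : ev p R = r := by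
      have e := congrArg (ev p) hyl
      rw [map_sum, map_one] at e
      rw [hR, map_sum, ← mul_one r, ← e, Finset.mul_sum]
      exact Finset.sum_congr rfl fun i _ => by
        rw [map_mul, hr, map_mul, map_mul, map_mul, ev_y]; ring
    rw [hr, map_mul, this, ev_y]
  have h3 : (tan V).euler R = R := by
    have e : ∀ i, ((tan V).euler R - R) * (tan V).y i = 0 := fun i => by
      have := congrArg (tan V).euler (h2 i)
      rw [Q.sq.euler_G, map_add, c.euler_flatSpray, h2, Derivation.leibniz, TanCalc.euler_coord,
        smul_eq_mul, smul_eq_mul] at this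
      linear_combination -this
    have e2 : (tan V).euler R - R = ∑ i, Q.sq.yl i * Q.sq.αi ^ 2 * (((tan V).euler R - R) * (tan V).y i) := by
      conv_lhs => rw [← mul_one ((tan V).euler R - R), ← hyl, Finset.mul_sum]
      exact Finset.sum_congr rfl fun i _ => by ring
    rw [← sub_eq_zero, e2]
    simp [e]
  have h4 : (tan V).Isotropic c.flatSpray := ⟨0, 0, fun i k => by rw [c.curv_flatSpray]; simp⟩
  have h5 := h4.projective c.euler_flatSpray h3
  rwa [← funext h2] at h5

end SqField
end ProjectivelyFlat

section Poles

namespace TanCalc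

variable {n : ℕ} {A : Type*} [CommRing A] [Algebra ℝ A] (T : TanCalc n A)

/-- A subalgebra stable under differentiation. -/
structure Stable (C : Subalgebra ℝ A) : Prop where
  X_mem : ∀ k, ∀ f ∈ C, T.X k f ∈ C
  Y_mem : ∀ k, ∀ f ∈ C, T.Y k f ∈ C
  y_mem : ∀ i, T.y i ∈ C

variable {T}

lemma Stable.hor_mem {C : Subalgebra ℝ A} (hC : T.Stable C) {f : A} (hf : f ∈ C) : T.hor f ∈ C := by
  rw [T.hor_apply]
  exact C.sum_mem fun k _ => C.mul_mem (hC.y_mem k) (hC.X_mem k f hf)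

lemma Stable.vert_mem {C : Subalgebra ℝ A} (hC : T.Stable C) {V : Fin n → A} (hV : ∀ i, V i ∈ C)
    {f : A} (hf : f ∈ C) : T.vert V f ∈ C := by
  rw [T.vert_apply]
  exact C.sum_mem fun k _ => C.mul_mem (hV k) (hC.Y_mem k f hf)

variable (T)

/-- The first vertical derivatives of `h + N / D`, without denominator and modulo `D`. -/
def poleU (D : A) (h N : Fin n → A) (i k : Fin n) : A := D * T.Y k (h i) + T.Y k (N i)

/-- The first vertical derivatives of `h + N / D`, without denominator. -/
def poleP (D : A) (h N : Fin n → A) (i k : Fin n) : A := D * T.poleU D h N i k - N i * T.Y k D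

/-- The regular part of the curvature of `h + N / D`. -/
def poleRem (D : A) (h N : Fin n → A) (i k : Fin n) : A :=
  2 * D * (D * T.X k (D * h i + N i) - (D * h i + N i) * T.X k D)
    - D * T.hor (T.poleP D h N i k) + 2 * T.poleP D h N i k * T.hor D
    + 2 * T.vert (fun j => D * h j + N j) (T.poleP D h N i k)
    - 4 * T.poleP D h N i k * T.vert h D - 4 * T.poleU D h N i k * T.vert N D
    + N i * ∑ l, T.Y l D * T.poleU D h N l k - ∑ l, T.poleU D h N i l * T.poleP D h N l k

variable {T} {D δ : A} {h N H : Fin n → A}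

lemma mul_derivation_of_pow_two_mul (E : Derivation ℝ A A) {D f p : A} (hp : D ^ 2 * f = p) :
    D ^ 3 * E f = D * E p - 2 * p * E D := by
  rw [← hp]
  simp only [pow_two, Derivation.leibniz, smul_eq_mul]
  ring

lemma curv_pole (hδ : D * δ = 1) (hH : ∀ i, H i = h i + N i * δ) (i k : Fin n) :
    D ^ 4 * T.curv H i k = 3 * T.vert N D * N i * T.Y k D + D * T.poleRem D h N i k := by
  have hE : ∀ (E : Derivation ℝ A A) i, D ^ 2 * E (H i)
      = D * (D * E (h i) + E (N i)) - N i * E D := fun E i => by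
    rw [hH, map_add, Derivation.leibniz, E.map_inv_of_mul_eq_one hδ, smul_eq_mul, smul_eq_mul]
    linear_combination (D * E (N i) - N i * E D * (D * δ + 1)) * hδ
  have hp : ∀ i, D * H i = D * h i + N i := fun i => by
    rw [hH]; linear_combination N i * hδ
  have hYH : ∀ i k, D ^ 2 * T.Y k (H i) = T.poleP D h N i k := fun i k => hE _ i
  have hYY := fun E : Derivation ℝ A A => mul_derivation_of_pow_two_mul E (hYH i k)
  have hX : D ^ 2 * T.X k (H i) = D * T.X k (D * h i + N i) - (D * h i + N i) * T.X k D := by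
    rw [hE, map_add, Derivation.leibniz, smul_eq_mul, smul_eq_mul]; ring
  have e1 : D ^ 4 * T.vert H (T.Y k (H i)) = D * T.vert (fun j => D * h j + N j) (T.poleP D h N i k)
      - 2 * T.poleP D h N i k * T.vert (fun j => D * h j + N j) D := by
    simp only [T.vert_apply, Finset.mul_sum, ← Finset.sum_sub_distrib]
    refine Finset.sum_congr rfl fun l _ => ?_
    rw [← hp]
    linear_combination D * H l * hYY (T.Y l)
  have e2 : D ^ 4 * T.vert (fun j => T.Y k (H j)) (H i)
      = ∑ l, T.poleP D h N l k * T.poleP D h N i l := by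
    simp only [T.vert_apply, Finset.mul_sum]
    refine Finset.sum_congr rfl fun l _ => ?_
    rw [← hYH, ← hYH]; ring
  have e3 : ∑ l, T.poleP D h N l k * T.poleP D h N i l
      = D * ∑ l, T.poleU D h N i l * T.poleP D h N l k
        - N i * (D * ∑ l, T.Y l D * T.poleU D h N l k - T.vert N D * T.Y k D) := by
    simp only [T.vert_apply, Finset.mul_sum, Finset.sum_mul, ← Finset.sum_sub_distrib]
    refine Finset.sum_congr rfl fun l _ => ?_
    rw [poleP, poleP]; ring
  have e4 : T.vert (fun j => D * h j + N j) D = D * T.vert h D + T.vert N D := by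
    rw [T.vert_add, T.vert_smul]
  have e5 : T.poleP D h N i k = D * T.poleU D h N i k - N i * T.Y k D := rfl
  rw [curv, poleRem]
  linear_combination 2 * D ^ 2 * hX - D * hYY T.hor + 2 * e1 - e2 - e3
    - 4 * T.poleP D h N i k * e4 - 4 * T.vert N D * e5

lemma Stable.poleU_mem {C : Subalgebra ℝ A} (hC : T.Stable C) (hD : D ∈ C) (hh : ∀ i, h i ∈ C)
    (hN : ∀ i, N i ∈ C) (i k : Fin n) : T.poleU D h N i k ∈ C :=
  C.add_mem (C.mul_mem hD (hC.Y_mem _ _ (hh i))) (hC.Y_mem _ _ (hN i))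

lemma Stable.poleP_mem {C : Subalgebra ℝ A} (hC : T.Stable C) (hD : D ∈ C) (hh : ∀ i, h i ∈ C)
    (hN : ∀ i, N i ∈ C) (i k : Fin n) : T.poleP D h N i k ∈ C :=
  C.sub_mem (C.mul_mem hD (hC.poleU_mem hD hh hN i k)) (C.mul_mem (hN i) (hC.Y_mem _ _ hD))

lemma Stable.poleRem_mem {C : Subalgebra ℝ A} (hC : T.Stable C) (hD : D ∈ C) (hh : ∀ i, h i ∈ C)
    (hN : ∀ i, N i ∈ C) (i k : Fin n) : T.poleRem D h N i k ∈ C := by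
  have hU := hC.poleU_mem hD hh hN
  have hP := hC.poleP_mem hD hh hN
  have h2 : (2 : A) ∈ C := ofNat_mem C 2
  have h4 : (4 : A) ∈ C := ofNat_mem C 4
  have hp : ∀ i, D * h i + N i ∈ C := fun i => C.add_mem (C.mul_mem hD (hh i)) (hN i)
  refine C.sub_mem (C.add_mem (C.sub_mem (C.sub_mem (C.add_mem (C.add_mem (C.sub_mem ?_ ?_) ?_) ?_)
    ?_) ?_) ?_) ?_
  · exact C.mul_mem (C.mul_mem h2 hD) (C.sub_mem (C.mul_mem hD (hC.X_mem _ _ (hp i)))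
      (C.mul_mem (hp i) (hC.X_mem _ _ hD)))
  · exact C.mul_mem hD (hC.hor_mem (hP i k))
  · exact C.mul_mem (C.mul_mem h2 (hP i k)) (hC.hor_mem hD)
  · exact C.mul_mem h2 (hC.vert_mem hp (hP i k))
  · exact C.mul_mem (C.mul_mem h4 (hP i k)) (hC.vert_mem hh hD)
  · exact C.mul_mem (C.mul_mem h4 (hU i k)) (hC.vert_mem hN hD)
  · exact C.mul_mem (hN i) (C.sum_mem fun l _ => C.mul_mem (hC.Y_mem _ _ hD) (hU l k))
  · exact C.sum_mem fun l _ => C.mul_mem (hU i l) (hP l k)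

/-- Vanishing of the leading pole of a trace-like spray curvature. -/
lemma Stable.simple_pole {C : Subalgebra ℝ A} (hC : T.Stable C) (hD : D ∈ C) (hh : ∀ i, h i ∈ C)
    (hN : ∀ i, N i ∈ C) (hδ : D * δ = 1) (hH : ∀ i, H i = h i + N i * δ) {q v : Fin n → A}
    (hq : ∀ i, q i ∈ C) (hv : ∀ i, v i ∈ C)
    (htr : ((n : A) - 1) * ∑ i, ∑ k, q i * T.curv H i k * v k
      = (∑ i, T.curv H i i) * ∑ i, q i * v i) :
    ∃ c ∈ C, 3 * T.vert N D * (((n : A) - 1) * (∑ i, q i * N i) * T.vert v D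
      - T.vert N D * ∑ i, q i * v i) = D * c := by
  have hR := hC.poleRem_mem hD hh hN
  refine ⟨(∑ i, T.poleRem D h N i i) * ∑ i, q i * v i
    - ((n : A) - 1) * ∑ i, ∑ k, q i * T.poleRem D h N i k * v k, ?_, ?_⟩
  · refine C.sub_mem (C.mul_mem (C.sum_mem fun i _ => hR i i)
      (C.sum_mem fun i _ => C.mul_mem (hq i) (hv i))) (C.mul_mem
      (C.sub_mem (natCast_mem C n) C.one_mem) (C.sum_mem fun i _ => C.sum_mem fun k _ =>
        C.mul_mem (C.mul_mem (hq i) (hR i k)) (hv k)))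
  · have h1 : D ^ 4 * ∑ i, ∑ k, q i * T.curv H i k * v k
        = 3 * T.vert N D * (∑ i, q i * N i) * T.vert v D
          + D * ∑ i, ∑ k, q i * T.poleRem D h N i k * v k := by
      rw [T.vert_apply v, mul_assoc, Finset.sum_mul_sum]
      simp only [Finset.mul_sum, ← Finset.sum_add_distrib]
      refine Finset.sum_congr rfl fun i _ => Finset.sum_congr rfl fun k _ => ?_
      linear_combination q i * v k * curv_pole hδ hH i k
    have h2 : D ^ 4 * ∑ i, T.curv H i i
        = 3 * T.vert N D * T.vert N D + D * ∑ i, T.poleRem D h N i i := by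
      conv_rhs => rw [mul_comm (3 * _), T.vert_apply N]
      simp only [Finset.mul_sum, Finset.sum_mul, ← Finset.sum_add_distrib]
      refine Finset.sum_congr rfl fun i _ => ?_
      have := curv_pole (T := T) hδ hH i i
      rw [T.vert_apply N] at this
      rw [this]
      simp only [Finset.mul_sum, Finset.sum_mul]
      congr 1
      exact Finset.sum_congr rfl fun j _ => by ring
    linear_combination D ^ 4 * htr - ((n : A) - 1) * h1 + (∑ i, q i * v i) * h2

/-- The remainder modulo `D` when the polar part is tangent to `D`. -/
lemma Stable.tangent_pole {C : Subalgebra ℝ A} (hC : T.Stable C) (hD : D ∈ C) (hh : ∀ i, h i ∈ C)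
    (hN : ∀ i, N i ∈ C) (hND : T.vert N D = 0) (i k : Fin n) : ∃ c ∈ C, T.poleRem D h N i k
      = T.Y k D * (4 * N i * T.vert h D - 2 * N i * T.hor D - T.vert N (N i))
        - 3 * N i * T.vert N (T.Y k D) + D * c := by
  have hU := hC.poleU_mem hD hh hN
  have hP := hC.poleP_mem hD hh hN
  have h2 : (2 : A) ∈ C := ofNat_mem C 2
  have h4 : (4 : A) ∈ C := ofNat_mem C 4
  have hp : ∀ i, D * h i + N i ∈ C := fun i => C.add_mem (C.mul_mem hD (hh i)) (hN i)
  have e1 : ∑ l, T.Y l D * T.poleU D h N l k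
      = D * T.vert (fun j => T.Y k (h j)) D - T.vert N (T.Y k D) := by
    have := congrArg (T.Y k) hND
    rw [T.Y_vert, map_zero] at this
    have e : ∑ l, T.Y l D * T.poleU D h N l k
        = D * T.vert (fun j => T.Y k (h j)) D + T.vert (fun j => T.Y k (N j)) D := by
      simp only [T.vert_apply, Finset.mul_sum, ← Finset.sum_add_distrib]
      exact Finset.sum_congr rfl fun l _ => by rw [poleU]; ring
    rw [e]; linear_combination this
  have e2 : ∑ l, T.poleU D h N i l * T.poleP D h N l k
      = D * (∑ l, T.poleU D h N i l * T.poleU D h N l k - T.Y k D * T.vert N (h i))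
        - T.Y k D * T.vert N (N i) := by
    simp only [T.vert_apply, Finset.mul_sum, ← Finset.sum_sub_distrib]
    exact Finset.sum_congr rfl fun l _ => by rw [poleP, poleU]; ring
  have e3 : T.vert (fun j => D * h j + N j) (T.poleP D h N i k)
      = D * T.vert h (T.poleP D h N i k) + D * T.vert N (T.poleU D h N i k)
        - T.Y k D * T.vert N (N i) - N i * T.vert N (T.Y k D) := by
    rw [T.vert_add, T.vert_smul]
    conv_lhs => enter [2]; rw [poleP]
    rw [map_sub, Derivation.leibniz, Derivation.leibniz, hND]
    simp only [smul_eq_mul]; ring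
  refine ⟨2 * (D * T.X k (D * h i + N i) - (D * h i + N i) * T.X k D)
    - T.hor (T.poleP D h N i k) + 2 * T.poleU D h N i k * T.hor D
    + 2 * T.vert h (T.poleP D h N i k) + 2 * T.vert N (T.poleU D h N i k)
    - 4 * T.poleU D h N i k * T.vert h D + N i * T.vert (fun j => T.Y k (h j)) D
    - (∑ l, T.poleU D h N i l * T.poleU D h N l k - T.Y k D * T.vert N (h i)), ?_, ?_⟩
  · refine C.sub_mem (C.add_mem (C.sub_mem (C.add_mem (C.add_mem (C.add_mem (C.sub_mem ?_ ?_) ?_) ?_)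
      ?_) ?_) ?_) (C.sub_mem ?_ ?_)
    · exact C.mul_mem h2 (C.sub_mem (C.mul_mem hD (hC.X_mem _ _ (hp i)))
        (C.mul_mem (hp i) (hC.X_mem _ _ hD)))
    · exact hC.hor_mem (hP i k)
    · exact C.mul_mem (C.mul_mem h2 (hU i k)) (hC.hor_mem hD)
    · exact C.mul_mem h2 (hC.vert_mem hh (hP i k))
    · exact C.mul_mem h2 (hC.vert_mem hN (hU i k))
    · exact C.mul_mem (C.mul_mem h4 (hU i k)) (hC.vert_mem hh hD)
    · exact C.mul_mem (hN i) (hC.vert_mem (fun j => hC.Y_mem _ _ (hh j)) hD)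
    · exact C.sum_mem fun l _ => C.mul_mem (hU i l) (hU l k)
    · exact C.mul_mem (hC.Y_mem _ _ hD) (hC.vert_mem hN (hh i))
  · rw [poleRem, e1, e2, e3, hND]
    have e5 : T.poleP D h N i k = D * T.poleU D h N i k - N i * T.Y k D := rfl
    linear_combination (2 * T.hor D - 4 * T.vert h D) * e5

/-- Vanishing of the leading pole when the polar part is tangent to `D`. -/
lemma Stable.tangent_simple_pole {C : Subalgebra ℝ A} (hC : T.Stable C) (hD : D ∈ C)
    (hh : ∀ i, h i ∈ C) (hN : ∀ i, N i ∈ C) (hδ : D * δ = 1) (hH : ∀ i, H i = h i + N i * δ)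
    (hND : T.vert N D = 0) {q : Fin n → A} (hq : ∀ i, q i ∈ C)
    (htr : ((n : A) - 1) * ∑ i, ∑ k, q i * T.curv H i k * N k
      = (∑ i, T.curv H i i) * ∑ i, q i * N i) :
    ∃ c ∈ C, (3 * (n : A) - 5) * (∑ i, q i * N i) * ∑ k, N k * T.vert N (T.Y k D) = D * c := by
  choose r hrC hr using hC.tangent_pole hD hh hN hND
  have hcurv : ∀ i k, D ^ 3 * T.curv H i k = T.poleRem D h N i k := fun i k => by
    have := curv_pole (T := T) hδ hH i k
    rw [hND] at this
    linear_combination δ * this - (D ^ 3 * T.curv H i k - T.poleRem D h N i k) * hδ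
  have hN0 : ∑ i, N i * T.Y i D = 0 := by rw [← hND, T.vert_apply]
  have h1 : ∑ i, T.Y i D * T.vert N (N i) = - ∑ k, N k * T.vert N (T.Y k D) := by
    have := congrArg (T.vert N) hN0
    rw [map_sum, map_zero] at this
    simp only [Derivation.leibniz, smul_eq_mul, Finset.sum_add_distrib] at this
    linear_combination this
  have h2 : D ^ 3 * ∑ i, T.curv H i i = -2 * (∑ k, N k * T.vert N (T.Y k D)) + D * ∑ i, r i i := by
    have : D ^ 3 * ∑ i, T.curv H i i
        = (4 * T.vert h D - 2 * T.hor D) * ∑ i, N i * T.Y i D - ∑ i, T.Y i D * T.vert N (N i)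
          - 3 * ∑ i, N i * T.vert N (T.Y i D) + D * ∑ i, r i i := by
      simp only [Finset.mul_sum, ← Finset.sum_add_distrib, ← Finset.sum_sub_distrib]
      exact Finset.sum_congr rfl fun i _ => by rw [hcurv, hr]; ring
    rw [this, hN0, h1]; ring
  have h3 : D ^ 3 * ∑ i, ∑ k, q i * T.curv H i k * N k
      = -3 * (∑ i, q i * N i) * (∑ k, N k * T.vert N (T.Y k D))
        + D * ∑ i, ∑ k, q i * r i k * N k := by
    have : D ^ 3 * ∑ i, ∑ k, q i * T.curv H i k * N k
        = (∑ i, q i * (4 * N i * T.vert h D - 2 * N i * T.hor D - T.vert N (N i)))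
            * (∑ k, N k * T.Y k D)
          - 3 * ((∑ i, q i * N i) * (∑ k, N k * T.vert N (T.Y k D)))
          + D * ∑ i, ∑ k, q i * r i k * N k := by
      rw [Finset.sum_mul_sum, Finset.sum_mul_sum]
      simp only [Finset.mul_sum, ← Finset.sum_add_distrib, ← Finset.sum_sub_distrib]
      refine Finset.sum_congr rfl fun i _ => Finset.sum_congr rfl fun k _ => ?_
      linear_combination q i * N k * (hcurv i k + hr i k)
    rw [this, hN0]; ring
  refine ⟨((n : A) - 1) * (∑ i, ∑ k, q i * r i k * N k) - (∑ i, r i i) * ∑ i, q i * N i, ?_, ?_⟩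
  · exact C.sub_mem (C.mul_mem (C.sub_mem (natCast_mem C n) C.one_mem)
      (C.sum_mem fun i _ => C.sum_mem fun k _ => C.mul_mem (C.mul_mem (hq i) (hrC i k)) (hN k)))
      (C.mul_mem (C.sum_mem fun i _ => hrC i i) (C.sum_mem fun i _ => C.mul_mem (hq i) (hN i)))
  · linear_combination -D ^ 3 * htr + ((n : A) - 1) * h3 - (∑ i, q i * N i) * h2

end TanCalc
end Poles

section RationalSlice

open TopologicalSpace Polynomial SmoothAlg

lemma Derivation.mem_adjoin {A : Type*} [CommRing A] [Algebra ℝ A] (E : Derivation ℝ A A)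
    {S : Set A} (h : ∀ s ∈ S, E s ∈ Algebra.adjoin ℝ S) {f : A} (hf : f ∈ Algebra.adjoin ℝ S) :
    E f ∈ Algebra.adjoin ℝ S := by
  induction hf using Algebra.adjoin_induction with
  | mem s hs => exact h s hs
  | algebraMap r => rw [E.map_algebraMap]; exact zero_mem _
  | add f g _ _ hf hg => rw [map_add]; exact add_mem hf hg
  | mul f g hf hg hf' hg' =>
    rw [E.leibniz, smul_eq_mul, smul_eq_mul]
    exact add_mem (mul_mem hf hg') (mul_mem hg hf')

variable {n : ℕ} {U : Opens (Vec n)}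

namespace SqField

variable (Q : SqField U)

/-- Algebra generators: base functions, fibre coordinates, `α`, `1/α` and the set `E`. -/
def gens (E : Set (SmoothAlg (slit U))) : Set (SmoothAlg (slit U)) :=
  Set.range (base U) ∪ Set.range (tan U).y ∪ {Q.sq.α, Q.sq.αi} ∪ E

/-- The algebra generated by base functions, fibre coordinates, `α`, `1/α` and the set `E`. -/
def core (E : Set (SmoothAlg (slit U))) : Subalgebra ℝ (SmoothAlg (slit U)) :=
  Algebra.adjoin ℝ (Q.gens E)

variable {E : Set (SmoothAlg (slit U))}

lemma base_mem_core (f : SmoothAlg U) : base U f ∈ Q.core E :=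
  Algebra.subset_adjoin (Or.inl (Or.inl (Or.inl ⟨f, rfl⟩)))

lemma y_mem_core (i : Fin n) : (tan U).y i ∈ Q.core E :=
  Algebra.subset_adjoin (Or.inl (Or.inl (Or.inr ⟨i, rfl⟩)))

lemma α_mem_core : Q.sq.α ∈ Q.core E :=
  Algebra.subset_adjoin (Or.inl (Or.inr (Or.inl rfl)))

lemma αi_mem_core : Q.sq.αi ∈ Q.core E :=
  Algebra.subset_adjoin (Or.inl (Or.inr (Or.inr rfl)))

lemma half_mem_core : half _ ∈ Q.core E := (Q.core E).algebraMap_mem _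

lemma yl_mem_core (i : Fin n) : Q.sq.yl i ∈ Q.core E :=
  (Q.core E).sum_mem fun j _ => mul_mem (Q.base_mem_core _) (Q.y_mem_core j)

lemma β_mem_core : Q.sq.β ∈ Q.core E :=
  (Q.core E).sum_mem fun j _ => mul_mem (Q.base_mem_core _) (Q.y_mem_core j)

lemma bu_mem_core (i : Fin n) : Q.sq.bu i ∈ Q.core E :=
  (Q.core E).sum_mem fun _ _ => mul_mem (Q.base_mem_core _) (Q.base_mem_core _)

lemma b2_mem_core : Q.sq.b2 ∈ Q.core E :=
  (Q.core E).sum_mem fun i _ => mul_mem (Q.bu_mem_core i) (Q.base_mem_core _)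

lemma derivation_mem_core (hE : E ⊆ {Q.sq.Li}) (V : Derivation ℝ (SmoothAlg (slit U)) _)
    (hb : ∀ f, V (base U f) ∈ Q.core E) (hy : ∀ i, V ((tan U).y i) ∈ Q.core E)
    {f : SmoothAlg (slit U)} (hf : f ∈ Q.core E) : V f ∈ Q.core E := by
  have hα : V Q.sq.α ∈ Q.core E := by
    have h1 : V (Q.sq.α ^ 2) ∈ Q.core E := by
      rw [Q.sq.α_sq', map_sum]
      refine sum_mem fun i _ => ?_
      rw [V.leibniz, smul_eq_mul, smul_eq_mul]
      refine add_mem (mul_mem (Q.y_mem_core i) ?_) (mul_mem (Q.yl_mem_core i) (hy i))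
      rw [SqCalc.yl, map_sum]
      refine sum_mem fun j _ => ?_
      rw [V.leibniz, smul_eq_mul, smul_eq_mul]
      exact add_mem (mul_mem (Q.base_mem_core _) (hy j)) (mul_mem (Q.y_mem_core j) (hb _))
    have h2 : V Q.sq.α = Q.sq.αi * (half _ * V (Q.sq.α ^ 2)) := by
      rw [Q.sq.α_mul_derivation]
      linear_combination -(V Q.sq.α * two_mul_half (A := SmoothAlg (slit U))) -
        2 * half (SmoothAlg (slit U)) * V Q.sq.α * Q.sq.α_inv
    rw [h2]
    exact mul_mem Q.αi_mem_core (mul_mem Q.half_mem_core h1)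
  refine V.mem_adjoin ?_ hf
  rintro s (((⟨f, rfl⟩ | ⟨i, rfl⟩) | (rfl | rfl)) | hs)
  · exact hb f
  · exact hy i
  · exact hα
  · rw [V.map_inv_of_mul_eq_one Q.sq.α_inv]
    exact neg_mem (mul_mem (pow_mem Q.αi_mem_core 2) hα)
  · have hs' : s ∈ Q.core E := Algebra.subset_adjoin (Or.inr hs)
    rw [Set.mem_singleton_iff.1 (hE hs)] at hs' ⊢
    rw [V.map_inv_of_mul_eq_one Q.sq.L_mul_Li, SqCalc.L, map_sub]
    refine neg_mem (mul_mem (pow_mem hs' 2) (sub_mem hα ?_))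
    rw [SqCalc.β, map_sum]
    refine sum_mem fun j _ => ?_
    rw [V.leibniz, smul_eq_mul, smul_eq_mul]
    exact add_mem (mul_mem (Q.base_mem_core _) (hy j)) (mul_mem (Q.y_mem_core j) (hb _))

lemma stable_core (hE : E ⊆ {Q.sq.Li}) : (tan U).Stable (Q.core E) where
  X_mem k f hf := Q.derivation_mem_core hE _ (fun f => by rw [X_base]; exact Q.base_mem_core _)
    (fun i => by rw [(tan U).Xy]; exact zero_mem _) hf
  Y_mem k f hf := Q.derivation_mem_core hE _ (fun f => by rw [Y_base]; exact zero_mem _)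
    (fun i => by rw [(tan U).Yy]; split_ifs; exacts [one_mem _, zero_mem _]) hf
  y_mem := Q.y_mem_core

lemma Gα_mem_core (hE : E ⊆ {Q.sq.Li}) (i : Fin n) : Q.sq.Gα i ∈ Q.core E :=
  mul_mem Q.half_mem_core (sum_mem fun _ _ => mul_mem (Q.base_mem_core _)
    (sub_mem ((Q.stable_core hE).hor_mem (Q.yl_mem_core _)) (mul_mem Q.half_mem_core
      ((Q.stable_core hE).X_mem _ _ (pow_mem Q.α_mem_core 2)))))

lemma sl_mem_core (hE : E ⊆ {Q.sq.Li}) (i : Fin n) : Q.sq.sl i ∈ Q.core E :=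
  mul_mem Q.half_mem_core (sub_mem ((Q.stable_core hE).hor_mem (Q.base_mem_core _))
    ((Q.stable_core hE).X_mem _ _ Q.β_mem_core))

lemma S_mem_core (hE : E ⊆ {Q.sq.Li}) (i : Fin n) : Q.sq.S i ∈ Q.core E :=
  sum_mem fun _ _ => mul_mem (Q.base_mem_core _) (Q.sl_mem_core hE _)

lemma s0_mem_core (hE : E ⊆ {Q.sq.Li}) : Q.sq.s0 ∈ Q.core E :=
  sum_mem fun _ _ => mul_mem (Q.S_mem_core hE _) (Q.base_mem_core _)

lemma r00_mem_core (hE : E ⊆ {Q.sq.Li}) : Q.sq.r00 ∈ Q.core E :=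
  sub_mem ((Q.stable_core hE).hor_mem Q.β_mem_core) (mul_mem (ofNat_mem _ 2)
    ((Q.stable_core hE).vert_mem (Q.Gα_mem_core hE) Q.β_mem_core))

end SqField

/-- Along the curve `γ` the function `f` is rational, and regular with value `w` at `z`. -/
def RegVal (γ : ℝ → slit U) (z : ℂ) (f : SmoothAlg (slit U)) (w : ℂ) : Prop :=
  ∃ num den : ℝ[X], aeval z den ≠ 0 ∧ (∀ t, den.eval t * ev (γ t) f = num.eval t) ∧
    aeval z num = w * aeval z den

namespace RegVal

variable {γ : ℝ → slit U} {z : ℂ} {f g : SmoothAlg (slit U)} {w w' : ℂ}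

lemma of_polynomial (p : ℝ[X]) (h : ∀ t, ev (γ t) f = p.eval t) : RegVal γ z f (aeval z p) :=
  ⟨p, 1, by simp, by simpa using h, by simp⟩

lemma scalar (r : ℝ) : RegVal γ z (algebraMap ℝ _ r) r := by
  simpa using of_polynomial (γ := γ) (z := z) (f := algebraMap ℝ _ r) (C r) (by simp)

lemma natCast (m : ℕ) : RegVal γ z (m : SmoothAlg (slit U)) m := by
  simpa using scalar (γ := γ) (z := z) (m : ℝ)

lemma ofNat (m : ℕ) [m.AtLeastTwo] : RegVal γ z (OfNat.ofNat m : SmoothAlg (slit U)) (OfNat.ofNat m) := by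
  exact_mod_cast natCast (γ := γ) (z := z) (OfNat.ofNat m)

lemma one : RegVal γ z (1 : SmoothAlg (slit U)) 1 := by
  simpa using natCast (γ := γ) (z := z) 1

lemma add (hf : RegVal γ z f w) (hg : RegVal γ z g w') : RegVal γ z (f + g) (w + w') := by
  obtain ⟨p, d, hd, h, hw⟩ := hf
  obtain ⟨p', d', hd', h', hw'⟩ := hg
  refine ⟨p * d' + p' * d, d * d', by simp [hd, hd'], fun t => ?_, ?_⟩
  · simp only [eval_mul, eval_add, map_add, ← h, ← h']; ring
  · simp only [map_mul, map_add, hw, hw']; ring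

lemma mul (hf : RegVal γ z f w) (hg : RegVal γ z g w') : RegVal γ z (f * g) (w * w') := by
  obtain ⟨p, d, hd, h, hw⟩ := hf
  obtain ⟨p', d', hd', h', hw'⟩ := hg
  refine ⟨p * p', d * d', by simp [hd, hd'], fun t => ?_, ?_⟩
  · simp only [eval_mul, map_mul, ← h, ← h']; ring
  · simp only [map_mul, hw, hw']; ring

lemma neg (hf : RegVal γ z f w) : RegVal γ z (-f) (-w) := by
  have h : -f = algebraMap ℝ _ (-1) * f := ext_ev fun p => by simp
  rw [h]
  simpa using (scalar (γ := γ) (z := z) (-1)).mul hf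

lemma sub (hf : RegVal γ z f w) (hg : RegVal γ z g w') : RegVal γ z (f - g) (w - w') := by
  simpa [sub_eq_add_neg] using hf.add hg.neg

lemma pow (hf : RegVal γ z f w) : ∀ m : ℕ, RegVal γ z (f ^ m) (w ^ m)
  | 0 => by simpa using one
  | m + 1 => by simpa [pow_succ] using (hf.pow m).mul hf

lemma inv (hf : RegVal γ z f w) (h : f * g = 1) (hw : w ≠ 0) : RegVal γ z g w⁻¹ := by
  obtain ⟨p, d, hd, hp, e⟩ := hf
  refine ⟨d, p, by rw [e]; exact mul_ne_zero hw hd, fun t => ?_, by rw [e]; field_simp⟩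
  have := congrArg (ev (γ t)) h
  rw [map_mul, map_one] at this
  rw [← hp]; linear_combination d.eval t * this

lemma unique (hf : RegVal γ z f w) (hf' : RegVal γ z f w') : w = w' := by
  obtain ⟨p, d, hd, h, hw⟩ := hf
  obtain ⟨p', d', hd', h', hw'⟩ := hf'
  have : d' * p = d * p' := Polynomial.funext fun t => by
    simp only [eval_mul, ← h, ← h']; ring
  have := congrArg (aeval z) this
  rw [map_mul, map_mul, hw, hw'] at this
  have hne := mul_ne_zero hd hd'
  exact mul_right_cancel₀ hne (by linear_combination this)

lemma exists_of_adjoin {S : Set (SmoothAlg (slit U))} (hS : ∀ s ∈ S, ∃ w, RegVal γ z s w)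
    (hf : f ∈ Algebra.adjoin ℝ S) : ∃ w, RegVal γ z f w := by
  induction hf using Algebra.adjoin_induction with
  | mem s hs => exact hS s hs
  | algebraMap r => exact ⟨_, scalar r⟩
  | add f g _ _ hf hg => exact ⟨_, hf.choose_spec.add hg.choose_spec⟩
  | mul f g _ _ hf hg => exact ⟨_, hf.choose_spec.mul hg.choose_spec⟩

end RegVal
end RationalSlice

section FirstPole

open TopologicalSpace Polynomial SmoothAlg

variable {n : ℕ} {U : Opens (Vec n)}

lemma eq_sum_of_linear {f : SmoothAlg (slit U)} (he : (tan U).euler f = f)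
    (h : ∀ k, (tan U).Y k f ∈ (base U).range) :
    ∃ c : Fin n → SmoothAlg U, f = ∑ k, base U (c k) * (tan U).y k := by
  choose c hc using h
  refine ⟨c, ?_⟩
  conv_lhs => rw [← he, TanCalc.euler, TanCalc.vert_apply]
  exact Finset.sum_congr rfl fun k _ => by rw [← hc k, mul_comm]; rfl

lemma eq_sum_of_quadratic {f : SmoothAlg (slit U)} (he : (tan U).euler f = 2 * f)
    (h : ∀ j k, (tan U).Y j ((tan U).Y k f) ∈ (base U).range) :
    ∃ c : Fin n → Fin n → SmoothAlg U, (∀ j k, c j k = c k j) ∧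
      f = ∑ j, ∑ k, base U (c j k) * ((tan U).y j * (tan U).y k) := by
  choose c hc using h
  have hc : ∀ j k, base U (c j k) = (tan U).Y j ((tan U).Y k f) := hc
  have hf : 2 * f = ∑ j, ∑ k, base U (c j k) * ((tan U).y j * (tan U).y k) := by
    rw [← he, TanCalc.euler, TanCalc.vert_apply, Finset.sum_comm]
    refine Finset.sum_congr rfl fun k _ => ?_
    rw [← (tan U).euler_Y_two he k, TanCalc.euler, TanCalc.vert_apply, Finset.mul_sum]
    exact Finset.sum_congr rfl fun j _ => by rw [hc]; ring
  have hf' : 2 * f = ∑ j, ∑ k, base U (c k j) * ((tan U).y j * (tan U).y k) := by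
    rw [hf, Finset.sum_comm]
    exact Finset.sum_congr rfl fun k _ => Finset.sum_congr rfl fun j _ => by ring
  refine ⟨fun j k => half _ * half _ * (c j k + c k j), fun j k => by ring, ?_⟩
  have hb : base U (half _) = half _ := (base U).commutes _
  have : ∑ j, ∑ k, base U (half _ * half _ * (c j k + c k j)) * ((tan U).y j * (tan U).y k)
      = half _ * half _ * (2 * f + 2 * f) := by
    conv_rhs => enter [2]; rw [hf]; arg 2; rw [← hf, hf']
    simp only [Finset.mul_sum, ← Finset.sum_add_distrib, map_mul, map_add, hb]
    exact Finset.sum_congr rfl fun k _ => Finset.sum_congr rfl fun j _ => by ring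
  rw [this]
  linear_combination -(f * (2 * half (SmoothAlg (slit U)) + 1)) * two_mul_half (A := SmoothAlg (slit U))

lemma X_mem_range {f : SmoothAlg (slit U)} (hf : f ∈ (base U).range) (k : Fin n) :
    (tan U).X k f ∈ (base U).range := by
  obtain ⟨g, rfl⟩ := hf
  exact ⟨_, (X_base k g).symm⟩

lemma half_mem_range : half _ ∈ (base U).range := (base U).range.algebraMap_mem _

namespace SqField

variable (Q : SqField U)

lemma a_mem_range (i j : Fin n) : Q.sq.a i j ∈ (base U).range := ⟨_, rfl⟩
lemma ainv_mem_range (i j : Fin n) : Q.sq.ainv i j ∈ (base U).range := ⟨_, rfl⟩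
lemma b_mem_range (i : Fin n) : Q.sq.b i ∈ (base U).range := ⟨_, rfl⟩

lemma Y_sl (k l : Fin n) : (tan U).Y k (Q.sq.sl l)
    = half _ * ((tan U).X k (Q.sq.b l) - (tan U).X l (Q.sq.b k)) := by
  rw [SqCalc.sl, Derivation.leibniz, map_sub, (tan U).Y_hor, Derivation.map_half, Q.sq.Y_b,
    (tan U).YX, Q.sq.Y_β]
  simp

lemma Y_sl_mem (k l : Fin n) : (tan U).Y k (Q.sq.sl l) ∈ (base U).range := by
  rw [Y_sl]
  exact mul_mem half_mem_range (sub_mem (X_mem_range (Q.b_mem_range _) _)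
    (X_mem_range (Q.b_mem_range _) _))

lemma Y_S_mem (k i : Fin n) : (tan U).Y k (Q.sq.S i) ∈ (base U).range := by
  rw [SqCalc.S, map_sum]
  refine sum_mem fun l _ => ?_
  rw [Derivation.leibniz, Q.sq.Y_ainv, smul_zero, add_zero]
  exact mul_mem (Q.ainv_mem_range _ _) (Q.Y_sl_mem _ _)

lemma Y_s0_mem (k : Fin n) : (tan U).Y k Q.sq.s0 ∈ (base U).range := by
  rw [SqCalc.s0, map_sum]
  refine sum_mem fun l _ => ?_
  rw [Derivation.leibniz, Q.sq.Y_b, smul_zero, zero_add]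
  exact mul_mem (Q.b_mem_range _) (Q.Y_S_mem _ _)

lemma YY_Gα_mem (j k i : Fin n) : (tan U).Y j ((tan U).Y k (Q.sq.Gα i)) ∈ (base U).range := by
  have h2 : (2 : SmoothAlg (slit U)) ∈ (base U).range := ofNat_mem _ 2
  have key : ∀ l, (tan U).Y j ((tan U).Y k ((tan U).hor (Q.sq.yl l)
      - half _ * (tan U).X l (Q.sq.α ^ 2))) ∈ (base U).range := fun l => by
    have : (tan U).Y j ((tan U).Y k ((tan U).hor (Q.sq.yl l) - half _ * (tan U).X l (Q.sq.α ^ 2)))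
        = (tan U).X k (Q.sq.a l j) + (tan U).X j (Q.sq.a l k)
          - half _ * (2 * (tan U).X l (Q.sq.a k j)) := by
      simp only [map_sub, map_add, Derivation.leibniz, (tan U).Y_hor, (tan U).YX, Q.sq.Y_yl,
        Q.sq.Y_α_sq, Q.sq.Y_a, Derivation.map_half, Derivation.map_two_eq_zero, smul_eq_mul,
        mul_zero, add_zero, map_zero]
    rw [this]
    exact sub_mem (add_mem (X_mem_range (Q.a_mem_range _ _) _) (X_mem_range (Q.a_mem_range _ _) _))
      (mul_mem half_mem_range (mul_mem h2 (X_mem_range (Q.a_mem_range _ _) _)))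
  have : (tan U).Y j ((tan U).Y k (Q.sq.Gα i)) = half _ * ∑ l, Q.sq.ainv i l *
      (tan U).Y j ((tan U).Y k ((tan U).hor (Q.sq.yl l) - half _ * (tan U).X l (Q.sq.α ^ 2))) := by
    rw [SqCalc.Gα]
    generalize (fun l => (tan U).hor (Q.sq.yl l) - half _ * (tan U).X l (Q.sq.α ^ 2)) = f
    simp only [Derivation.leibniz, map_sum, Derivation.map_half, smul_eq_mul, mul_zero, add_zero,
      Q.sq.Y_ainv]
  rw [this]
  exact mul_mem half_mem_range (sum_mem fun l _ => mul_mem (Q.ainv_mem_range _ _) (key l))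

lemma YY_r00_mem (j k : Fin n) : (tan U).Y j ((tan U).Y k Q.sq.r00) ∈ (base U).range := by
  have : (tan U).Y j ((tan U).Y k Q.sq.r00) = (tan U).X k (Q.sq.b j) + (tan U).X j (Q.sq.b k)
      - 2 * ∑ i, Q.sq.b i * (tan U).Y j ((tan U).Y k (Q.sq.Gα i)) := by
    simp only [SqCalc.r00, Q.sq.vert_β, map_sub, map_add, Derivation.leibniz, (tan U).Y_hor,
      (tan U).YX, Q.sq.Y_β, Q.sq.Y_b, Derivation.map_two_eq_zero, smul_eq_mul, mul_zero, add_zero,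
      map_zero, map_sum, zero_add]
  rw [this]
  exact sub_mem (add_mem (X_mem_range (Q.b_mem_range _) _) (X_mem_range (Q.b_mem_range _) _))
    (mul_mem (ofNat_mem _ 2) (sum_mem fun i _ => mul_mem (Q.b_mem_range _) (Q.YY_Gα_mem _ _ _)))

lemma vert_bu_D : (tan U).vert Q.sq.bu Q.sq.D = 2 * Q.sq.β * (1 - Q.sq.b2) := by
  have h1 := Q.sq.vert_α Q.sq.bu
  have h2 := Q.sq.vert_β Q.sq.bu
  rw [Q.sq.bu_dot_y] at h1
  have h3 : (tan U).vert Q.sq.bu Q.sq.b2 = 0 := by simp [TanCalc.vert_apply, Q.sq.Y_b2]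
  have h4 : ∑ i, Q.sq.bu i * Q.sq.b i = Q.sq.b2 := rfl
  rw [h4] at h2
  simp only [SqCalc.D, map_sub, map_add, Derivation.leibniz, Derivation.leibniz_pow, h1, h2, h3,
    Derivation.map_two_eq_zero, smul_eq_mul, nsmul_eq_mul, Nat.cast_ofNat, Nat.add_one_sub_one,
    pow_one, Derivation.map_one_eq_zero]
  have h5 : (tan U).vert Q.sq.bu 3 = 0 := by exact_mod_cast Derivation.map_natCast _ 3
  rw [h5]
  linear_combination 2 * (1 + 2 * Q.sq.b2) * Q.sq.β * Q.sq.α_inv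

lemma euler_D : (tan U).euler Q.sq.D = 2 * Q.sq.D := by
  have h3 : (tan U).euler Q.sq.b2 = 0 := by simp [TanCalc.euler, TanCalc.vert_apply, Q.sq.Y_b2]
  simp only [SqCalc.D, map_sub, map_add, Derivation.leibniz, Derivation.leibniz_pow, Q.sq.euler_α,
    Q.sq.euler_β, h3, Derivation.map_two_eq_zero, smul_eq_mul, nsmul_eq_mul, Nat.cast_ofNat,
    Nat.add_one_sub_one, pow_one, Derivation.map_one_eq_zero]
  have h5 : (tan U).euler 3 = 0 := by exact_mod_cast Derivation.map_natCast _ 3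
  rw [h5]
  ring

lemma D_mem_core {E : Set (SmoothAlg (slit U))} : Q.sq.D ∈ Q.core E :=
  sub_mem (mul_mem (add_mem (one_mem _) (mul_mem (ofNat_mem _ 2) Q.b2_mem_core))
    (pow_mem Q.α_mem_core 2)) (mul_mem (ofNat_mem _ 3) (pow_mem Q.β_mem_core 2))

lemma Li_mem_core : Q.sq.Li ∈ Q.core {Q.sq.Li} := Algebra.subset_adjoin (Or.inr rfl)

/-- The leading coefficient of the pole of the curvature along `D = 0`. -/
lemma pole_D (h : (tan U).Isotropic Q.sq.H) : ∃ c ∈ Q.core {Q.sq.Li},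
    12 * (1 - Q.sq.b2) * (Q.sq.α ^ 2 * (Q.sq.r00 - 2 * Q.sq.A1 * Q.sq.s0)) ^ 2 * Q.sq.β ^ 2
      * (Q.sq.α ^ 2 * Q.sq.b2 - Q.sq.β ^ 2)
      * (3 * ((n : SmoothAlg (slit U)) - 1) * (Q.sq.α ^ 2 * Q.sq.b2 - Q.sq.β ^ 2)
        + (1 - Q.sq.b2) * Q.sq.α ^ 2) = Q.sq.D * c := by
  set N := Q.sq.α ^ 2 * (Q.sq.r00 - 2 * Q.sq.A1 * Q.sq.s0) with hNdef
  have hE : {Q.sq.Li} ⊆ ({Q.sq.Li} : Set (SmoothAlg (slit U))) := subset_rfl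
  have hA1 : Q.sq.A1 ∈ Q.core {Q.sq.Li} :=
    mul_mem (mul_mem (ofNat_mem _ 2) (pow_mem Q.α_mem_core 2)) Q.Li_mem_core
  have hN : N ∈ Q.core {Q.sq.Li} := mul_mem (pow_mem Q.α_mem_core 2) (sub_mem (Q.r00_mem_core hE)
    (mul_mem (mul_mem (ofNat_mem _ 2) hA1) (Q.s0_mem_core hE)))
  have e1 : ∑ i, Q.sq.b i * (tan U).y i = Q.sq.β := rfl
  have e2 : ∑ i, Q.sq.yl i * (tan U).y i = Q.sq.α ^ 2 := by
    rw [Q.sq.α_sq']; exact Finset.sum_congr rfl fun _ _ => mul_comm _ _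
  have e3 : ∑ i, Q.sq.b i * Q.sq.bu i = Q.sq.b2 := by
    rw [SqCalc.b2]; exact Finset.sum_congr rfl fun _ _ => mul_comm _ _
  have e4 : ∑ i, Q.sq.yl i * Q.sq.bu i = Q.sq.β := by
    rw [← Q.sq.bu_dot_y]; exact Finset.sum_congr rfl fun _ _ => mul_comm _ _
  let q : Fin n → SmoothAlg (slit U) := fun i => Q.sq.α ^ 2 * Q.sq.b i - Q.sq.β * Q.sq.yl i
  have hq : ∀ w : Fin n → SmoothAlg (slit U), ∑ i, q i * w i
      = Q.sq.α ^ 2 * (∑ i, Q.sq.b i * w i) - Q.sq.β * ∑ i, Q.sq.yl i * w i := fun w => by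
    simp only [Finset.mul_sum, ← Finset.sum_sub_distrib]
    exact Finset.sum_congr rfl fun _ _ => by simp only [q]; ring
  let v : Fin n → SmoothAlg (slit U) := fun i => Q.sq.α ^ 2 * Q.sq.bu i - Q.sq.β * (tan U).y i
  have hqy : ∑ i, q i * (tan U).y i = 0 := by rw [hq, e1, e2]; ring
  have hqb : ∑ i, q i * Q.sq.bu i = Q.sq.α ^ 2 * Q.sq.b2 - Q.sq.β ^ 2 := by
    rw [hq, e3, e4]; ring
  have hqN : ∑ i, q i * (N * Q.sq.bu i) = N * (Q.sq.α ^ 2 * Q.sq.b2 - Q.sq.β ^ 2) := by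
    rw [← hqb, Finset.mul_sum]; exact Finset.sum_congr rfl fun _ _ => by ring
  have hqv : ∑ i, q i * v i = Q.sq.α ^ 2 * (Q.sq.α ^ 2 * Q.sq.b2 - Q.sq.β ^ 2) := by
    have : ∑ i, q i * v i = Q.sq.α ^ 2 * ∑ i, q i * Q.sq.bu i - Q.sq.β * ∑ i, q i * (tan U).y i := by
      simp only [Finset.mul_sum, ← Finset.sum_sub_distrib]
      exact Finset.sum_congr rfl fun _ _ => by simp only [v]; ring
    rw [this, hqb, hqy]; ring
  have hvD : (tan U).vert v Q.sq.D = -6 * Q.sq.β * (Q.sq.α ^ 2 * Q.sq.b2 - Q.sq.β ^ 2) := by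
    have := Q.euler_D
    rw [TanCalc.euler] at this
    rw [TanCalc.vert_sub, TanCalc.vert_smul, TanCalc.vert_smul, vert_bu_D, this, SqCalc.D]
    ring
  have hND : (tan U).vert (fun i => N * Q.sq.bu i) Q.sq.D = N * (2 * Q.sq.β * (1 - Q.sq.b2)) := by
    rw [TanCalc.vert_smul, vert_bu_D]
  have hH : ∀ i, Q.sq.H i = (Q.sq.Gα i + Q.sq.A1 * Q.sq.S i) + N * Q.sq.bu i * Q.sq.Di := fun i => by
    rw [SqCalc.H, SqCalc.B]; ring
  have hh : ∀ i, Q.sq.Gα i + Q.sq.A1 * Q.sq.S i ∈ Q.core {Q.sq.Li} := fun i =>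
    add_mem (Q.Gα_mem_core hE i) (mul_mem hA1 (Q.S_mem_core hE i))
  have hNi : ∀ i, N * Q.sq.bu i ∈ Q.core {Q.sq.Li} := fun i => mul_mem hN (Q.bu_mem_core i)
  have hqi : ∀ i, q i ∈ Q.core {Q.sq.Li} := fun i => sub_mem
    (mul_mem (pow_mem Q.α_mem_core 2) (Q.base_mem_core _)) (mul_mem Q.β_mem_core (Q.yl_mem_core i))
  have hvi : ∀ i, v i ∈ Q.core {Q.sq.Li} := fun i => sub_mem
    (mul_mem (pow_mem Q.α_mem_core 2) (Q.bu_mem_core i)) (mul_mem Q.β_mem_core (Q.y_mem_core i))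
  have htr := TanCalc.Isotropic.trace h Q.sq.euler_H q v hqy
  clear_value N q v
  obtain ⟨c, hc, h⟩ := (Q.stable_core hE).simple_pole Q.D_mem_core hh hNi Q.sq.D_mul_Di hH hqi hvi htr
  rw [hqN, hqv, hvD, hND] at h
  exact ⟨-c, neg_mem hc, by linear_combination -h⟩

end SqField
end FirstPole

section SliceValues

open TopologicalSpace Polynomial SmoothAlg

variable {n : ℕ} {U : Opens (Vec n)}

/-- A base point with a vector orthogonal to the one-form and of the same length. -/
structure Slice (Q : SqField U) where
  x : Vec n
  hx : x ∈ U
  e : Vec n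
  orth : Q.bf x e = 0
  norm : Q.ip x e e = bsq Q.a Q.b x

namespace Slice

variable {Q : SqField U} (s : Slice Q)

def b2 : ℝ := bsq Q.a Q.b s.x
def len : ℝ := Real.sqrt s.b2

lemma b2_pos : 0 < s.b2 := (Q.hb2 _ s.hx).1
lemma b2_lt : s.b2 < 1 := (Q.hb2 _ s.hx).2
lemma len_pos : 0 < s.len := Real.sqrt_pos.2 s.b2_pos
lemma len_sq : s.len ^ 2 = s.b2 := Real.sq_sqrt s.b2_pos.le

/-- The curve of tangent vectors with rational `α`. -/
def vec (t : ℝ) : Vec n := (1 - t ^ 2) • Q.bv s.x + (2 * t) • s.e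

lemma bf_vec (t : ℝ) : Q.bf s.x (s.vec t) = s.b2 * (1 - t ^ 2) := by
  rw [vec, Q.bf_add, Q.bf_smul, Q.bf_smul, s.orth, Q.bf_bv, b2]; ring

lemma ip_vec (t : ℝ) : Q.ip s.x (s.vec t) (s.vec t) = s.b2 * (1 + t ^ 2) ^ 2 := by
  have h := s.norm
  have h0 := s.orth
  rw [vec]
  simp only [Q.ip_add_left, Q.ip_add_right, Q.ip_smul_left, Q.ip_smul_right, Q.ip_bv_left s.hx,
    Q.ip_bv_right s.hx, Q.bf_bv, h, h0, b2]
  ring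

lemma vec_ne_zero (t : ℝ) : s.vec t ≠ 0 := fun h => by
  have := s.ip_vec t
  rw [h] at this
  have h2 : 0 < s.b2 * (1 + t ^ 2) ^ 2 := by have := s.b2_pos; positivity
  simp [SqField.ip] at this
  rcases this with h | h
  · exact s.b2_pos.ne' h
  · nlinarith

def γ (t : ℝ) : slit U := slitPt s.x s.hx (s.vec t) (s.vec_ne_zero t)

variable {z : ℂ}

lemma reg_base (f : SmoothAlg U) : RegVal s.γ z (base U f) (toFn f s.x : ℝ) := by
  simpa using RegVal.of_polynomial (γ := s.γ) (z := z) (f := base U f) (C (toFn f s.x))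
    (fun t => by rw [ev_base_fn]; simp [γ, slitPt])

lemma reg_linear {f : SmoothAlg (slit U)} (φ : Vec n →ₗ[ℝ] ℝ)
    (h : ∀ t, ev (s.γ t) f = φ (s.vec t)) :
    RegVal s.γ z f ((1 - z ^ 2) * φ (Q.bv s.x) + 2 * z * φ s.e) := by
  have := RegVal.of_polynomial (γ := s.γ) (z := z) (f := f)
    ((1 - X ^ 2) * C (φ (Q.bv s.x)) + 2 * X * C (φ s.e))
    (fun t => by rw [h, vec]; simp)
  simpa only [map_add, map_mul, map_sub, map_pow, aeval_X, aeval_C, map_one, map_ofNat,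
    Complex.coe_algebraMap] using this

lemma reg_quadratic {f : SmoothAlg (slit U)} (φ : Vec n →ₗ[ℝ] Vec n →ₗ[ℝ] ℝ)
    (hφ : ∀ u v, φ u v = φ v u) (h : ∀ t, ev (s.γ t) f = φ (s.vec t) (s.vec t)) :
    RegVal s.γ z f ((1 - z ^ 2) ^ 2 * φ (Q.bv s.x) (Q.bv s.x)
      + 4 * z * (1 - z ^ 2) * φ (Q.bv s.x) s.e + 4 * z ^ 2 * φ s.e s.e) := by
  have := RegVal.of_polynomial (γ := s.γ) (z := z) (f := f)
    ((1 - X ^ 2) ^ 2 * C (φ (Q.bv s.x) (Q.bv s.x)) + 4 * X * (1 - X ^ 2) * C (φ (Q.bv s.x) s.e)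
      + 4 * X ^ 2 * C (φ s.e s.e))
    (fun t => by
      rw [h, vec]
      simp only [map_add, map_smul, LinearMap.add_apply, LinearMap.smul_apply, smul_eq_mul,
        hφ s.e (Q.bv s.x)]
      simp
      ring)
  simpa only [map_add, map_mul, map_sub, map_pow, aeval_X, aeval_C, map_one, map_ofNat,
    Complex.coe_algebraMap] using this

lemma reg_y (i : Fin n) : RegVal s.γ z ((tan U).y i) ((1 - z ^ 2) * Q.bv s.x i + 2 * z * s.e i) :=
  s.reg_linear (LinearMap.proj i) fun _ => rfl

lemma reg_α : RegVal s.γ z Q.sq.α (s.len * (1 + z ^ 2)) := by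
  have := RegVal.of_polynomial (γ := s.γ) (z := z) (f := Q.sq.α) (C s.len * (1 + X ^ 2))
    (fun t => by
      rw [Q.ev_α, γ, slitPt, Q.alphaOf_eq, s.ip_vec, ← s.len_sq, ← mul_pow, Real.sqrt_sq]
      · simp
      · have := s.len_pos; positivity)
  simpa using this

lemma reg_β : RegVal s.γ z Q.sq.β (s.b2 * (1 - z ^ 2)) := by
  have := RegVal.of_polynomial (γ := s.γ) (z := z) (f := Q.sq.β) (C s.b2 * (1 - X ^ 2))
    (fun t => by rw [Q.ev_β, γ, slitPt, s.bf_vec]; simp)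
  simpa using this

lemma reg_b2 : RegVal s.γ z Q.sq.b2 s.b2 := by
  have := RegVal.of_polynomial (γ := s.γ) (z := z) (f := Q.sq.b2) (C s.b2)
    (fun t => by rw [Q.ev_b2, γ, slitPt, b2]; simp)
  simpa using this

lemma reg_L : RegVal s.γ z Q.sq.L (s.len * (1 + z ^ 2) - s.b2 * (1 - z ^ 2)) := s.reg_α.sub s.reg_β

lemma reg_D : RegVal s.γ z Q.sq.D ((1 + 2 * s.b2) * (s.len * (1 + z ^ 2)) ^ 2
    - 3 * (s.b2 * (1 - z ^ 2)) ^ 2) :=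
  ((RegVal.one.add ((RegVal.ofNat 2).mul s.reg_b2)).mul (s.reg_α.pow 2)).sub
    ((RegVal.ofNat 3).mul (s.reg_β.pow 2))

lemma exists_reg {E : Set (SmoothAlg (slit U))} (hz : 1 + z ^ 2 ≠ 0)
    (hE : ∀ f ∈ E, ∃ w, RegVal s.γ z f w) {f : SmoothAlg (slit U)} (hf : f ∈ Q.core E) :
    ∃ w, RegVal s.γ z f w := by
  refine RegVal.exists_of_adjoin ?_ hf
  rintro f (((⟨f, rfl⟩ | ⟨i, rfl⟩) | (rfl | rfl)) | hs)
  · exact ⟨_, s.reg_base f⟩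
  · exact ⟨_, s.reg_y i⟩
  · exact ⟨_, s.reg_α⟩
  · exact ⟨_, s.reg_α.inv Q.sq.α_inv
      (mul_ne_zero (Complex.ofReal_ne_zero.2 s.len_pos.ne') hz)⟩
  · exact hE f hs

/-- The relation at a zero of `D`. -/
lemma relation_D (hn : 3 ≤ n) (h : (tan U).Isotropic Q.sq.H) (hz : 1 + z ^ 2 ≠ 0)
    (hL : s.len * (1 + z ^ 2) - s.b2 * (1 - z ^ 2) ≠ 0)
    (hD : (1 + 2 * s.b2) * (s.len * (1 + z ^ 2)) ^ 2 - 3 * (s.b2 * (1 - z ^ 2)) ^ 2 = 0)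
    {r σ : ℂ} (hr : RegVal s.γ z Q.sq.r00 r) (hσ : RegVal s.γ z Q.sq.s0 σ) :
    (s.len * (1 + z ^ 2) - s.b2 * (1 - z ^ 2)) * r = 4 * (s.len * (1 + z ^ 2)) ^ 2 * σ := by
  obtain ⟨c, hc, e⟩ := Q.pole_D h
  have hLi := s.reg_L.inv Q.sq.L_mul_Li hL
  obtain ⟨w, hw⟩ := s.exists_reg (z := z) hz (by rintro f rfl; exact ⟨_, hLi⟩) hc
  have hM := ((s.reg_α (z := z).pow 2).mul s.reg_b2).sub (s.reg_β.pow 2)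
  have hA1 := ((RegVal.ofNat 2).mul (s.reg_α.pow 2)).mul hLi
  have h1b := (RegVal.one (γ := s.γ) (z := z)).sub s.reg_b2
  have hN := (s.reg_α.pow 2).mul (hr.sub (((RegVal.ofNat 2).mul hA1).mul hσ))
  have key := RegVal.unique (f := Q.sq.D * c) (e ▸ (((((RegVal.ofNat 12).mul h1b).mul (hN.pow 2)).mul
    (s.reg_β.pow 2)).mul hM).mul ((((RegVal.ofNat 3).mul ((RegVal.natCast n).sub RegVal.one)).mul
      hM).add (h1b.mul (s.reg_α.pow 2)))) (s.reg_D.mul hw)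
  rw [hD, zero_mul] at key
  have hB : (s.len : ℂ) ≠ 0 := Complex.ofReal_ne_zero.2 s.len_pos.ne'
  have hα : (s.len : ℂ) * (1 + z ^ 2) ≠ 0 := mul_ne_zero hB hz
  have h1 : (1 : ℂ) - s.b2 ≠ 0 := by
    have := s.b2_lt
    exact_mod_cast (sub_pos.2 this).ne'
  have h2 : (1 : ℂ) + 2 * s.b2 ≠ 0 := by
    have := s.b2_pos
    exact_mod_cast (by positivity : (0 : ℝ) < 1 + 2 * s.b2).ne'
  have hn2 : (n : ℂ) - 2 ≠ 0 := by
    rw [sub_ne_zero]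
    exact_mod_cast (by omega : n ≠ 2)
  generalize (s.len : ℂ) * (1 + z ^ 2) = α at *
  generalize (s.b2 : ℂ) * (1 - z ^ 2) = β at *
  generalize (s.b2 : ℂ) = t at *
  have hβ : β ^ 2 = (1 + 2 * t) * α ^ 2 / 3 := by linear_combination -hD / 3
  have hβ0 : β ^ 2 ≠ 0 := by
    rw [hβ]; exact div_ne_zero (mul_ne_zero h2 (pow_ne_zero 2 hα)) (by norm_num)
  have hMv : α ^ 2 * t - β ^ 2 = -(1 - t) * α ^ 2 / 3 := by rw [hβ]; ring
  have hM0 : α ^ 2 * t - β ^ 2 ≠ 0 := by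
    rw [hMv]; exact div_ne_zero (mul_ne_zero (neg_ne_zero.2 h1) (pow_ne_zero 2 hα)) (by norm_num)
  have hb : 3 * ((n : ℂ) - 1) * (α ^ 2 * t - β ^ 2) + (1 - t) * α ^ 2 ≠ 0 := by
    rw [hMv, show 3 * ((n : ℂ) - 1) * (-(1 - t) * α ^ 2 / 3) + (1 - t) * α ^ 2
      = -((n : ℂ) - 2) * (1 - t) * α ^ 2 by ring]
    exact mul_ne_zero (mul_ne_zero (neg_ne_zero.2 hn2) h1) (pow_ne_zero 2 hα)
  have h12 : (12 : ℂ) * (1 - t) ≠ 0 := mul_ne_zero (by norm_num) h1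
  have h3 : α ^ 2 * (r - 2 * (2 * α ^ 2 * (α - β)⁻¹) * σ) = 0 := by
    have h4 : (12 * (1 - t)) * ((α ^ 2 * (r - 2 * (2 * α ^ 2 * (α - β)⁻¹) * σ)) ^ 2) = 0 := by
      rcases mul_eq_zero.1 key with h | h
      · rcases mul_eq_zero.1 h with h | h
        · rcases mul_eq_zero.1 h with h | h
          · exact h
          · exact absurd h hβ0
        · exact absurd h hM0
      · exact absurd h hb
    exact pow_eq_zero_iff two_ne_zero |>.1 ((mul_eq_zero.1 h4).resolve_left h12)
  have h4 := (mul_eq_zero.1 h3).resolve_left (pow_ne_zero 2 hα)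
  have h5 := mul_inv_cancel₀ hL
  linear_combination (α - β) * h4 + 4 * α ^ 2 * σ * h5

/-- The consequence of the relation at zeros of `D` for the values of `r₀₀` and `s₀`. -/
lemma values_of_relation {b2 B k r11 r12 r22 σ : ℝ} (hb : 0 < b2) (hb1 : b2 < 1) (hB : 0 < B)
    (hB2 : B ^ 2 = b2) (hk : k ^ 2 * (1 + 2 * b2) = 3 * b2)
    (h : ∀ z : ℂ, 1 + z ^ 2 ≠ 0 → B * (1 + z ^ 2) - b2 * (1 - z ^ 2) ≠ 0 →
      (1 + 2 * b2) * (B * (1 + z ^ 2)) ^ 2 - 3 * (b2 * (1 - z ^ 2)) ^ 2 = 0 →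
      (B * (1 + z ^ 2) - b2 * (1 - z ^ 2)) * ((1 - z ^ 2) ^ 2 * r11 + 4 * z * (1 - z ^ 2) * r12
        + 4 * z ^ 2 * r22) = 4 * (B * (1 + z ^ 2)) ^ 2 * (2 * z * σ)) :
    r11 = (1 - k ^ 2) * r22 ∧ (k - B) * r12 = 2 * B * k ^ 2 * σ := by
  have hk1 : k ^ 2 < 1 := by nlinarith
  have hk0 : k ≠ 0 := by rintro rfl; nlinarith
  have habs := abs_lt.1 ((sq_lt_one_iff_abs_lt_one k).1 hk1)
  have hkB : k - B ≠ 0 := by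
    intro h0
    have : k = B := by linarith
    rw [this, hB2] at hk; nlinarith
  have hp : 0 < 1 + k := by linarith
  have hs : 0 < (1 - k) / (1 + k) := div_pos (by linarith) hp
  set ρ := Real.sqrt ((1 - k) / (1 + k)) with hρ
  have hρ2 : ρ ^ 2 = (1 - k) / (1 + k) := Real.sq_sqrt hs.le
  have hρ0 : 0 < ρ := Real.sqrt_pos.2 hs
  have hpc : (1 + k : ℂ) ≠ 0 := by exact_mod_cast hp.ne'
  have hz2 : (Complex.I * ρ) ^ 2 = -((1 - k) / (1 + k) : ℂ) := by
    rw [mul_pow, Complex.I_sq]; rw [show (ρ : ℂ) ^ 2 = ((ρ ^ 2 : ℝ) : ℂ) by push_cast; ring, hρ2]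
    push_cast; ring
  have e1 : 1 + (Complex.I * ρ) ^ 2 = 2 * k / (1 + k) := by rw [hz2]; field_simp; ring
  have e2 : 1 - (Complex.I * ρ) ^ 2 = 2 / (1 + k) := by rw [hz2]; field_simp; ring
  have hkc : (k : ℂ) ≠ 0 := by exact_mod_cast hk0
  have hb2c : (b2 : ℂ) = B ^ 2 := by exact_mod_cast hB2.symm
  have hBc : (B : ℂ) ≠ 0 := by exact_mod_cast hB.ne'
  have hkBc : (k - B : ℂ) ≠ 0 := by exact_mod_cast hkB
  have hkc2 : (k : ℂ) ^ 2 * (1 + 2 * B ^ 2) = 3 * B ^ 2 := by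
    rw [← hb2c]; exact_mod_cast hk
  have H := h (Complex.I * ρ) (by rw [e1]; exact div_ne_zero (mul_ne_zero two_ne_zero hkc) hpc)
    (by
      rw [e1, e2, hb2c, show (B : ℂ) * (2 * k / (1 + k)) - B ^ 2 * (2 / (1 + k))
        = 2 * B * (k - B) / (1 + k) by ring]
      exact div_ne_zero (mul_ne_zero (mul_ne_zero two_ne_zero hBc) hkBc) hpc)
    (by
      rw [e1, e2, hb2c]
      field_simp
      linear_combination 4 * B ^ 2 * hkc2)
  rw [e1, e2, hb2c] at H
  have H2 : (k - B : ℂ) * ((2 / (1 + k)) ^ 2 * r11 + 4 * (Complex.I * ρ) * (2 / (1 + k)) * r12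
      + 4 * (Complex.I * ρ) ^ 2 * r22) = 4 * B * k ^ 2 * (2 / (1 + k)) * (2 * (Complex.I * ρ) * σ) := by
    have h0 : (B * (2 / (1 + k)) : ℂ) ≠ 0 := mul_ne_zero hBc (div_ne_zero two_ne_zero hpc)
    refine mul_left_cancel₀ h0 ?_
    linear_combination H
  rw [hz2] at H2
  have H3 : (((k - B) * ((2 / (1 + k)) ^ 2 * r11 - 4 * ((1 - k) / (1 + k)) * r22) : ℝ) : ℂ)
      + (((k - B) * (4 * ρ * (2 / (1 + k)) * r12)
        - 4 * B * k ^ 2 * (2 / (1 + k)) * (2 * ρ * σ) : ℝ) : ℂ) * Complex.I = 0 := by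
    push_cast
    linear_combination H2
  have hre := congrArg Complex.re H3
  have him := congrArg Complex.im H3
  simp only [Complex.add_re, Complex.ofReal_re, Complex.re_ofReal_mul, Complex.I_re, mul_zero,
    add_zero, Complex.zero_re] at hre
  simp only [Complex.add_im, Complex.ofReal_im, Complex.im_ofReal_mul, Complex.I_im, mul_one,
    zero_add, Complex.zero_im] at him
  constructor
  · have h5 := (mul_eq_zero.1 hre).resolve_left hkB
    field_simp at h5
    linear_combination h5 / 4
  · have h6 : (8 * ρ / (1 + k)) * ((k - B) * r12 - 2 * B * k ^ 2 * σ) = 0 := by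
      linear_combination him
    have h7 := (mul_eq_zero.1 h6).resolve_left (by positivity)
    linarith

end Slice
end SliceValues

section FirstReduction

open TopologicalSpace Polynomial SmoothAlg

variable {n : ℕ} {U : Opens (Vec n)}

/-- The linear form on a fibre with the given coefficients. -/
def fibreForm (c : Fin n → SmoothAlg U) (x : Vec n) : Vec n →ₗ[ℝ] ℝ :=
  ∑ k, toFn (c k) x • LinearMap.proj k

lemma fibreForm_apply (c : Fin n → SmoothAlg U) (x y : Vec n) :
    fibreForm c x y = ∑ k, toFn (c k) x * y k := by
  simp [fibreForm]

/-- The bilinear form on a fibre with the given coefficients. -/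
def fibreForm₂ (c : Fin n → Fin n → SmoothAlg U) (x : Vec n) : Vec n →ₗ[ℝ] Vec n →ₗ[ℝ] ℝ :=
  Matrix.toLinearMap₂' ℝ (Matrix.of fun j k => toFn (c j k) x)

lemma fibreForm₂_apply (c : Fin n → Fin n → SmoothAlg U) (x u v : Vec n) :
    fibreForm₂ c x u v = ∑ j, ∑ k, toFn (c j k) x * (u j * v k) := by
  simp only [fibreForm₂, Matrix.toLinearMap₂'_apply, Matrix.of_apply, smul_eq_mul]
  exact Finset.sum_congr rfl fun _ _ => Finset.sum_congr rfl fun _ _ => by ring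

lemma fibreForm₂_symm {c : Fin n → Fin n → SmoothAlg U} (hc : ∀ j k, c j k = c k j) (x u v : Vec n) :
    fibreForm₂ c x u v = fibreForm₂ c x v u := by
  rw [fibreForm₂_apply, fibreForm₂_apply, Finset.sum_comm]
  exact Finset.sum_congr rfl fun j _ => Finset.sum_congr rfl fun k _ => by rw [hc]; ring

lemma ev_linear (c : Fin n → SmoothAlg U) (p : slit U) :
    ev p (∑ k, base U (c k) * (tan U).y k) = fibreForm c p.1.1 p.1.2 := by
  simp [fibreForm_apply, ev_base_fn]

lemma ev_quadratic (c : Fin n → Fin n → SmoothAlg U) (p : slit U) :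
    ev p (∑ j, ∑ k, base U (c j k) * ((tan U).y j * (tan U).y k))
      = fibreForm₂ c p.1.1 p.1.2 p.1.2 := by
  simp [fibreForm₂_apply, ev_base_fn]

namespace SqField

variable (Q : SqField U)

lemma ev_bu (p : slit U) (i : Fin n) : ev p (Q.sq.bu i) = Q.bv p.1.1 i := by
  rw [SqCalc.bu, map_sum]
  exact Finset.sum_congr rfl fun j _ => by
    rw [map_mul, show Q.sq.ainv i j = base U (Q.am⁻¹ i j) from rfl, Q.ev_am_inv,
      show Q.sq.b j = base U (Q.bm j) from rfl, Q.ev_bm]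

lemma s0_eq : Q.sq.s0 = ∑ i, Q.sq.sl i * Q.sq.bu i := by
  simp only [SqCalc.s0, SqCalc.S, SqCalc.bu, Finset.sum_mul, Finset.mul_sum]
  rw [Finset.sum_comm]
  exact Finset.sum_congr rfl fun i _ => Finset.sum_congr rfl fun j _ => by
    rw [Q.sq.ainv_symm]; ring

lemma bv_ne_zero {x : Vec n} (hx : x ∈ U) : Q.bv x ≠ 0 := fun h => by
  have := Q.bf_bv x
  rw [h] at this
  exact (Q.hb2 x hx).1.ne' (by simpa [bf] using this.symm)

lemma exists_slice {x : Vec n} (hx : x ∈ U) {e : Vec n} (he : Q.bf x e = 0) (h0 : e ≠ 0) :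
    ∃ (r : ℝ) (s : Slice Q), r ≠ 0 ∧ r ^ 2 * Q.ip x e e = bsq Q.a Q.b x ∧ s.x = x ∧ s.e = r • e := by
  have hp := Q.ip_pos hx h0
  have hb := (Q.hb2 x hx).1
  have hr : Real.sqrt (bsq Q.a Q.b x / Q.ip x e e) ^ 2 = bsq Q.a Q.b x / Q.ip x e e :=
    Real.sq_sqrt (div_pos hb hp).le
  refine ⟨Real.sqrt (bsq Q.a Q.b x / Q.ip x e e), ⟨x, hx, _ • e, ?_, ?_⟩,
    (Real.sqrt_pos.2 (div_pos hb hp)).ne', ?_, rfl, rfl⟩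
  · rw [Q.bf_smul, he, mul_zero]
  · rw [Q.ip_smul_left, Q.ip_smul_right, ← mul_assoc, ← pow_two, hr]; field_simp
  · rw [hr]; field_simp

lemma fibre_relations (hn : 3 ≤ n) (h : (tan U).Isotropic Q.sq.H) {c : Fin n → SmoothAlg U}
    {d : Fin n → Fin n → SmoothAlg U} (hc : Q.sq.s0 = ∑ k, base U (c k) * (tan U).y k)
    (hd : ∀ j k, d j k = d k j)
    (hr : Q.sq.r00 = ∑ j, ∑ k, base U (d j k) * ((tan U).y j * (tan U).y k))
    {x : Vec n} (hx : x ∈ U) :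
    fibreForm c x (Q.bv x) = 0 ∧ ∀ e, Q.bf x e = 0 → fibreForm c x e = 0 ∧
      fibreForm₂ d x (Q.bv x) e = 0 ∧ (1 + 2 * bsq Q.a Q.b x) * Q.ip x e e *
        fibreForm₂ d x (Q.bv x) (Q.bv x)
        = bsq Q.a Q.b x * (1 - bsq Q.a Q.b x) * fibreForm₂ d x e e := by
  have hbv : fibreForm c x (Q.bv x) = 0 := by
    have h1 := ev_linear c (slitPt x hx (Q.bv x) (Q.bv_ne_zero hx))
    rw [← hc, s0_eq] at h1
    have h2 := congrArg (ev (slitPt x hx (Q.bv x) (Q.bv_ne_zero hx))) Q.sq.sl_dot_y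
    simp only [map_sum, map_mul, ev_y, map_zero, ev_bu] at h1 h2
    refine h1.symm.trans (Eq.trans ?_ h2)
    exact Finset.sum_congr rfl fun _ _ => mul_comm _ _
  refine ⟨hbv, fun e he => ?_⟩
  by_cases h0 : e = 0
  · simp [h0, SqField.ip]
  obtain ⟨r, s, hr0, hr2, rfl, hse⟩ := Q.exists_slice hx he h0
  have hb := s.b2_pos
  have hb1 := s.b2_lt
  have rel : ∀ k : ℝ, k ^ 2 * (1 + 2 * s.b2) = 3 * s.b2 →
      fibreForm₂ d s.x (Q.bv s.x) (Q.bv s.x) = (1 - k ^ 2) * fibreForm₂ d s.x s.e s.e ∧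
      (k - s.len) * fibreForm₂ d s.x (Q.bv s.x) s.e = 2 * s.len * k ^ 2 * fibreForm c s.x s.e :=
    fun k hk => Slice.values_of_relation hb hb1 s.len_pos s.len_sq hk fun z hz hL hD => by
      have h1 := s.reg_linear (z := z) (f := Q.sq.s0) (fibreForm c s.x)
        (fun t => by rw [hc, ev_linear]; rfl)
      have h2 := s.reg_quadratic (z := z) (f := Q.sq.r00) (fibreForm₂ d s.x)
        (fibreForm₂_symm hd s.x) (fun t => by rw [hr, ev_quadratic]; rfl)
      have h3 := s.relation_D hn h hz hL hD h2 h1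
      rw [hbv] at h3
      simpa using h3
  have hk : Real.sqrt (3 * s.b2 / (1 + 2 * s.b2)) ^ 2 = 3 * s.b2 / (1 + 2 * s.b2) :=
    Real.sq_sqrt (by positivity)
  have hk0 : 0 < Real.sqrt (3 * s.b2 / (1 + 2 * s.b2)) := Real.sqrt_pos.2 (by positivity)
  set k := Real.sqrt (3 * s.b2 / (1 + 2 * s.b2))
  have hk' : k ^ 2 * (1 + 2 * s.b2) = 3 * s.b2 := by rw [hk]; field_simp
  obtain ⟨e1, e2⟩ := rel k hk'
  obtain ⟨-, e3⟩ := rel (-k) (by rw [neg_sq, hk'])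
  rw [neg_sq] at e3
  have hr12 : fibreForm₂ d s.x (Q.bv s.x) s.e = 0 := by
    have : (2 * k) * fibreForm₂ d s.x (Q.bv s.x) s.e = 0 := by linear_combination e2 - e3
    exact (mul_eq_zero.1 this).resolve_left (by positivity)
  have hσ : fibreForm c s.x s.e = 0 := by
    rw [hr12, mul_zero] at e2
    exact (mul_eq_zero.1 e2.symm).resolve_left (by have := s.len_pos; positivity)
  have e4 : (1 + 2 * s.b2) * fibreForm₂ d s.x (Q.bv s.x) (Q.bv s.x)
      = (1 - s.b2) * fibreForm₂ d s.x s.e s.e := by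
    rw [e1]; linear_combination -(fibreForm₂ d s.x s.e s.e) * hk'
  rw [hse] at hr12 hσ e4
  simp only [map_smul, LinearMap.smul_apply, smul_eq_mul] at hr12 hσ e4
  refine ⟨(mul_eq_zero.1 hσ).resolve_left hr0, (mul_eq_zero.1 hr12).resolve_left hr0, ?_⟩
  refine mul_left_cancel₀ (pow_ne_zero 2 hr0) ?_
  change r ^ 2 * Q.ip s.x e e = s.b2 at hr2
  change r ^ 2 * ((1 + 2 * s.b2) * Q.ip s.x e e * _) = r ^ 2 * (s.b2 * (1 - s.b2) * _)
  linear_combination s.b2 * e4 + (1 + 2 * s.b2) * fibreForm₂ d s.x (Q.bv s.x) (Q.bv s.x) * hr2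

/-- Vanishing of the polar part along `D = 0`. -/
theorem exists_tau (hn : 3 ≤ n) (h : (tan U).Isotropic Q.sq.H) :
    Q.sq.s0 = 0 ∧ ∃ τ : SmoothAlg U, Q.sq.r00 = base U τ * Q.sq.D := by
  obtain ⟨c, hc⟩ := eq_sum_of_linear Q.sq.euler_s0 Q.Y_s0_mem
  obtain ⟨d, hd, hr⟩ := eq_sum_of_quadratic Q.sq.euler_r00 Q.YY_r00_mem
  have H := fun {x : Vec n} (hx : x ∈ U) => Q.fibre_relations hn h hc hd hr hx
  have hdec : ∀ {x : Vec n} (hx : x ∈ U) (y : Vec n), ∃ e, Q.bf x e = 0 ∧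
      y = (Q.bf x y / bsq Q.a Q.b x) • Q.bv x + e := fun {x} hx y => by
    refine ⟨y - (Q.bf x y / bsq Q.a Q.b x) • Q.bv x, ?_, by simp⟩
    have := (Q.hb2 x hx).1
    rw [sub_eq_add_neg, ← neg_smul, Q.bf_add, Q.bf_smul, Q.bf_bv]
    field_simp; ring
  constructor
  · refine ext_ev fun p => ?_
    obtain ⟨h1, h2⟩ := H p.2.1
    obtain ⟨e, he, hy⟩ := hdec p.2.1 p.1.2
    rw [hc, ev_linear, hy, map_add, map_smul, h1, (h2 e he).1]
    simp
  · let bb : Fin n → SmoothAlg U := fun i => ∑ j, Q.am⁻¹ i j * Q.bm j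
    let q : SmoothAlg U := ∑ i, bb i * Q.bm i
    have hbb : ∀ (x : U) i, ev x (bb i) = Q.bv x i := fun x i => by
      simp only [bb, map_sum, map_mul, Q.ev_inv_am]; rfl
    have hq : ∀ x : U, ev x q = bsq Q.a Q.b x := fun x => by
      rw [← Q.bf_bv]
      simp only [q, map_sum, map_mul, hbb, bf, dotProduct]
      exact Finset.sum_congr rfl fun _ _ => mul_comm _ _
    obtain ⟨g, hg⟩ := exists_inv (q * (1 - q)) fun x => by
      have := Q.hb2 x x.2
      rw [map_mul, map_sub, map_one, hq]
      exact mul_ne_zero this.1.ne' (sub_pos.2 this.2).ne'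
    refine ⟨g * ∑ i, ∑ j, d i j * (bb i * bb j), ext_ev fun p => ?_⟩
    let x : U := ⟨p.1.1, p.2.1⟩
    obtain ⟨h1, h2⟩ := H p.2.1
    obtain ⟨e, he, hy⟩ := hdec p.2.1 p.1.2
    have hb := Q.hb2 p.1.1 p.2.1
    have hgx := congrArg (ev x) hg
    rw [map_mul, map_mul, map_sub, map_one, hq] at hgx
    have hτ : ev p (base U (g * ∑ i, ∑ j, d i j * (bb i * bb j)))
        = ev x g * fibreForm₂ d p.1.1 (Q.bv p.1.1) (Q.bv p.1.1) := by
      rw [ev_base, map_mul, fibreForm₂_apply, map_sum]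
      congr 1
      refine Finset.sum_congr rfl fun i _ => ?_
      rw [map_sum]
      refine Finset.sum_congr rfl fun j _ => ?_
      rw [map_mul, map_mul, hbb, hbb, toFn_coe (d i j) x]
    have hD : ev p Q.sq.D = (1 + 2 * bsq Q.a Q.b p.1.1) * Q.ip p.1.1 p.1.2 p.1.2
        - 3 * Q.bf p.1.1 p.1.2 ^ 2 := by
      simp only [SqCalc.D, map_sub, map_add, map_mul, map_pow, map_one, map_ofNat, Q.ev_α, Q.ev_β,
        Q.ev_b2, Q.alphaOf_sq p.2.1 p.2.2]
    have hip : Q.ip p.1.1 p.1.2 p.1.2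
        = Q.bf p.1.1 p.1.2 ^ 2 / bsq Q.a Q.b p.1.1 + Q.ip p.1.1 e e := by
      conv_lhs => rw [hy]
      simp only [Q.ip_add_left, Q.ip_add_right, Q.ip_smul_left, Q.ip_smul_right,
        Q.ip_bv_left p.2.1, Q.ip_bv_right p.2.1, Q.bf_bv, he]
      have := hb.1
      field_simp
      ring
    rw [map_mul, hτ, hD, hip, hr, ev_quadratic]
    obtain ⟨-, h3, h4⟩ := h2 e he
    have h3' := fibreForm₂_symm hd p.1.1 e (Q.bv p.1.1)
    rw [h3] at h3'
    have h5 : fibreForm₂ d p.1.1 p.1.2 p.1.2 = (Q.bf p.1.1 p.1.2 / bsq Q.a Q.b p.1.1) ^ 2 *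
        fibreForm₂ d p.1.1 (Q.bv p.1.1) (Q.bv p.1.1) + fibreForm₂ d p.1.1 e e := by
      conv_lhs => rw [hy]
      simp only [map_add, map_smul, LinearMap.add_apply, LinearMap.smul_apply, smul_eq_mul, h3, h3']
      ring
    rw [h5]
    change bsq Q.a Q.b p.1.1 * (1 - bsq Q.a Q.b p.1.1) * ev x g = 1 at hgx
    generalize fibreForm₂ d p.1.1 e e = r22 at *
    generalize fibreForm₂ d p.1.1 (Q.bv p.1.1) (Q.bv p.1.1) = r11 at *
    generalize bsq Q.a Q.b p.1.1 = t at *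
    generalize Q.bf p.1.1 p.1.2 = β at *
    generalize Q.ip p.1.1 e e = m at *
    generalize ev x g = w at *
    have ht : t ≠ 0 := hb.1.ne'
    have ht1 : 1 - t ≠ 0 := (sub_pos.2 hb.2).ne'
    have hw : w = 1 / (t * (1 - t)) := by field_simp; linear_combination hgx
    have hr22 : r22 = (1 + 2 * t) * m * r11 / (t * (1 - t)) := by field_simp; linear_combination -h4
    rw [hw, hr22]
    field_simp
    ring

end SqField
end FirstReduction

section SecondReduction

open TopologicalSpace Polynomial SmoothAlg

variable {n : ℕ} {U : Opens (Vec n)}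

namespace SqField

variable (Q : SqField U)

/-- The squared length of the vector `S`. -/
def normS : SmoothAlg (slit U) := ∑ i, Q.sq.sl i * Q.sq.S i

variable {Q}

lemma H_of_tau (hs : Q.sq.s0 = 0) {τ : SmoothAlg U} (hr : Q.sq.r00 = base U τ * Q.sq.D) (i : Fin n) :
    Q.sq.H i = (Q.sq.Gα i + base U τ * Q.sq.α ^ 2 * Q.sq.bu i)
      + 2 * Q.sq.α ^ 2 * Q.sq.S i * Q.sq.Li := by
  rw [SqCalc.H, SqCalc.B, SqCalc.A1, hs, hr]
  linear_combination base U τ * Q.sq.α ^ 2 * Q.sq.bu i * Q.sq.D_mul_Di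

/-- The leading coefficient of the pole of the curvature along `α = β`. -/
lemma pole_L (h : (tan U).Isotropic Q.sq.H) (hs : Q.sq.s0 = 0) {τ : SmoothAlg U}
    (hr : Q.sq.r00 = base U τ * Q.sq.D) : ∃ c ∈ Q.core ∅,
    (3 * (n : SmoothAlg (slit U)) - 5) * (2 * Q.sq.α ^ 2 * Q.normS) * (4 * Q.sq.α ^ 3 * Q.normS)
      = Q.sq.L * c := by
  have hE : (∅ : Set (SmoothAlg (slit U))) ⊆ {Q.sq.Li} := Set.empty_subset _
  have hSα : (tan U).vert Q.sq.S Q.sq.α = 0 := by rw [SqCalc.vert_α, Q.sq.S_dot_y, mul_zero]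
  have hSL : (tan U).vert Q.sq.S Q.sq.L = 0 := by
    rw [SqCalc.L, map_sub, hSα, SqCalc.vert_β]; exact (sub_eq_zero.2 hs.symm)
  have hqN : ∑ i, Q.sq.sl i * (2 * Q.sq.α ^ 2 * Q.sq.S i) = 2 * Q.sq.α ^ 2 * Q.normS := by
    rw [normS, Finset.mul_sum]; exact Finset.sum_congr rfl fun _ _ => by ring
  have hYL : ∀ k, (tan U).vert Q.sq.S ((tan U).Y k Q.sq.L) = Q.sq.αi * Q.sq.sl k := fun k => by
    have hαi : (tan U).vert Q.sq.S Q.sq.αi = 0 := by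
      rw [Derivation.map_inv_of_mul_eq_one _ Q.sq.α_inv, hSα]; simp
    rw [SqCalc.L, map_sub, map_sub, Q.sq.Y_α, Q.sq.Y_β, Q.sq.vert_b, Derivation.leibniz, hαi,
      SqCalc.vert_yl, Q.sq.lower_S]
    simp
  have hκ : ∑ k, 2 * Q.sq.α ^ 2 * Q.sq.S k *
      (tan U).vert (fun i => 2 * Q.sq.α ^ 2 * Q.sq.S i) ((tan U).Y k Q.sq.L)
      = 4 * Q.sq.α ^ 3 * Q.normS := by
    rw [normS, Finset.mul_sum]
    refine Finset.sum_congr rfl fun k _ => ?_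
    rw [TanCalc.vert_smul, hYL]
    linear_combination 4 * Q.sq.α ^ 3 * Q.sq.S k * Q.sq.sl k * Q.sq.α_inv
  have hq : ∑ i, Q.sq.sl i * (tan U).y i = 0 := by
    rw [← Q.sq.sl_dot_y]; exact Finset.sum_congr rfl fun _ _ => mul_comm _ _
  have hLc : Q.sq.L ∈ Q.core ∅ := sub_mem Q.α_mem_core Q.β_mem_core
  have h2 : (2 : SmoothAlg (slit U)) * Q.sq.α ^ 2 ∈ Q.core ∅ :=
    mul_mem (ofNat_mem _ 2) (pow_mem Q.α_mem_core 2)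
  obtain ⟨c, hc, e⟩ := (Q.stable_core hE).tangent_simple_pole hLc
    (h := fun i => Q.sq.Gα i + base U τ * Q.sq.α ^ 2 * Q.sq.bu i)
    (N := fun i => 2 * Q.sq.α ^ 2 * Q.sq.S i)
    (fun i => add_mem (Q.Gα_mem_core hE i)
      (mul_mem (mul_mem (Q.base_mem_core τ) (pow_mem Q.α_mem_core 2)) (Q.bu_mem_core i)))
    (fun i => mul_mem h2 (Q.S_mem_core hE i)) Q.sq.L_mul_Li (H_of_tau hs hr)
    (by rw [TanCalc.vert_smul, hSL, mul_zero]) (fun i => Q.sl_mem_core hE i)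
    (TanCalc.Isotropic.trace h Q.sq.euler_H _ _ hq)
  rw [hqN, hκ] at e
  exact ⟨c, hc, e⟩

lemma normS_eq (p : slit U) : ev p Q.normS
    = Q.ip p.1.1 (fun i => ev p (Q.sq.S i)) (fun i => ev p (Q.sq.S i)) := by
  simp only [normS, map_sum, map_mul, ip, dotProduct, Matrix.mulVec]
  refine Finset.sum_congr rfl fun i _ => ?_
  rw [← Q.sq.lower_S, map_sum, mul_comm]
  congr 1
  exact Finset.sum_congr rfl fun j _ => by rw [map_mul, Q.ev_a]

lemma vert_bu_sl (hs : Q.sq.s0 = 0) (l : Fin n) : (tan U).vert Q.sq.bu (Q.sq.sl l) = 0 := by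
  have h := congrArg ((tan U).Y l) hs
  rw [s0_eq, map_sum, map_zero] at h
  rw [TanCalc.vert_apply, ← neg_zero, ← h, ← Finset.sum_neg_distrib]
  refine Finset.sum_congr rfl fun i _ => ?_
  rw [Derivation.leibniz, Q.sq.Y_bu, Y_sl, Y_sl, smul_eq_mul, smul_eq_mul]
  ring

lemma vert_bu_normS (hs : Q.sq.s0 = 0) : (tan U).vert Q.sq.bu Q.normS = 0 := by
  have hS : ∀ i, (tan U).vert Q.sq.bu (Q.sq.S i) = 0 := fun i => by
    rw [SqCalc.S, map_sum]
    refine Finset.sum_eq_zero fun l _ => ?_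
    have : (tan U).vert Q.sq.bu (Q.sq.ainv i l) = 0 := by
      rw [TanCalc.vert_apply]; simp [Q.sq.Y_ainv]
    rw [Derivation.leibniz, vert_bu_sl hs, this]; simp
  rw [normS, map_sum]
  refine Finset.sum_eq_zero fun l _ => ?_
  rw [Derivation.leibniz, vert_bu_sl hs, hS]; simp

lemma YY_normS_mem (j k : Fin n) : (tan U).Y j ((tan U).Y k Q.normS) ∈ (base U).range := by
  have hz : ∀ {f : SmoothAlg (slit U)}, f ∈ (base U).range → ∀ j, (tan U).Y j f = 0 := by
    rintro _ ⟨g, rfl⟩ j; exact Y_base j g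
  rw [normS, map_sum, map_sum]
  refine sum_mem fun l _ => ?_
  simp only [Derivation.leibniz, map_add, smul_eq_mul, hz (Q.Y_sl_mem _ _), hz (Q.Y_S_mem _ _),
    mul_zero, zero_add]
  exact add_mem (mul_mem (Q.Y_S_mem _ _) (Q.Y_sl_mem _ _)) (mul_mem (Q.Y_sl_mem _ _) (Q.Y_S_mem _ _))

lemma euler_normS : (tan U).euler Q.normS = 2 * Q.normS := by
  simp only [normS, map_sum, Derivation.leibniz, smul_eq_mul, Q.sq.euler_sl, Q.sq.euler_S,
    Finset.mul_sum]
  exact Finset.sum_congr rfl fun _ _ => by ring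

/-- Vanishing of the polar part along `α = β`. -/
theorem S_eq_zero (hn : 3 ≤ n) (h : (tan U).Isotropic Q.sq.H) (hs : Q.sq.s0 = 0) {τ : SmoothAlg U}
    (hr : Q.sq.r00 = base U τ * Q.sq.D) (i : Fin n) : Q.sq.S i = 0 := by
  obtain ⟨d, hd, hS⟩ := eq_sum_of_quadratic (Q.euler_normS) Q.YY_normS_mem
  obtain ⟨c, hc, hL⟩ := pole_L h hs hr
  have hbv : ∀ p : slit U, fibreForm₂ d p.1.1 (Q.bv p.1.1) p.1.2 = 0 := fun p => by
    have h0 := congrArg (ev p) (Q.vert_bu_normS hs)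
    rw [hS] at h0
    have hz : ∀ j k, (tan U).vert Q.sq.bu (base U (d j k)) = 0 := fun j k => by
      rw [TanCalc.vert_apply]; simp [Y_base]
    simp only [map_sum, Derivation.leibniz, hz, smul_eq_mul, TanCalc.vert_coord, mul_zero, add_zero,
      map_mul, map_add, map_zero, ev_y, Q.ev_bu, ev_base_fn, mul_add, Finset.sum_add_distrib] at h0
    have e1 := fibreForm₂_apply d p.1.1 (Q.bv p.1.1) p.1.2
    have e2 := fibreForm₂_apply d p.1.1 p.1.2 (Q.bv p.1.1)
    have e3 := fibreForm₂_symm hd p.1.1 p.1.2 (Q.bv p.1.1)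
    have e4 : ∑ j, ∑ k, toFn (d j k) p.1.1 * (p.1.2 k * Q.bv p.1.1 j)
        = fibreForm₂ d p.1.1 (Q.bv p.1.1) p.1.2 := by
      rw [e1]
      exact Finset.sum_congr rfl fun _ _ => Finset.sum_congr rfl fun _ _ => by ring
    rw [← e2, e4, e3] at h0
    linarith
  have hvan : ∀ {x : Vec n} (hx : x ∈ U) (e : Vec n), Q.bf x e = 0 → fibreForm₂ d x e e = 0 := by
    intro x hx e he
    by_cases h0 : e = 0
    · simp [h0]
    obtain ⟨r, s, hr0, -, rfl, hse⟩ := Q.exists_slice hx he h0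
    have hlen := s.len_pos
    have hlen1 : s.len < 1 := by nlinarith [s.len_sq, s.b2_lt]
    set ρ := Real.sqrt ((1 - s.len) / (1 + s.len)) with hρ
    have hpos : 0 < (1 - s.len) / (1 + s.len) := div_pos (by linarith) (by linarith)
    have hρ0 : 0 < ρ := Real.sqrt_pos.2 hpos
    have hρ2 : ρ ^ 2 = (1 - s.len) / (1 + s.len) := Real.sq_sqrt hpos.le
    have hpc : (1 + s.len : ℂ) ≠ 0 := by exact_mod_cast (by linarith : (1 + s.len) ≠ 0)
    have hlc : (s.len : ℂ) ≠ 0 := by exact_mod_cast hlen.ne'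
    have hz2 : (Complex.I * ρ) ^ 2 = -((1 - s.len) / (1 + s.len) : ℂ) := by
      rw [mul_pow, Complex.I_sq, show (ρ : ℂ) ^ 2 = ((ρ ^ 2 : ℝ) : ℂ) by push_cast; ring, hρ2]
      push_cast; ring
    have e1 : 1 + (Complex.I * ρ) ^ 2 = 2 * s.len / (1 + s.len) := by rw [hz2]; field_simp; ring
    have e2 : 1 - (Complex.I * ρ) ^ 2 = 2 / (1 + s.len) := by rw [hz2]; field_simp; ring
    have hz : 1 + (Complex.I * ρ) ^ 2 ≠ 0 := by
      rw [e1]; exact div_ne_zero (mul_ne_zero two_ne_zero hlc) hpc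
    have hb2 : (s.b2 : ℂ) = s.len ^ 2 := by exact_mod_cast s.len_sq.symm
    obtain ⟨w, hw⟩ := s.exists_reg (E := ∅) hz (by simp) hc
    have hσ := s.reg_quadratic (z := Complex.I * ρ) (f := Q.normS) (fibreForm₂ d s.x)
      (fibreForm₂_symm hd s.x) (fun t => by rw [hS, ev_quadratic]; rfl)
    have hb1 := hbv (slitPt s.x s.hx (Q.bv s.x) (Q.bv_ne_zero s.hx))
    have hb2' : fibreForm₂ d s.x (Q.bv s.x) s.e = 0 := by
      by_cases h0 : s.e = 0
      · rw [h0, map_zero]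
      · exact hbv (slitPt s.x s.hx s.e h0)
    change fibreForm₂ d s.x (Q.bv s.x) (Q.bv s.x) = 0 at hb1
    rw [hb1, hb2'] at hσ
    have key := RegVal.unique (f := Q.sq.L * c) (hL ▸ ((((RegVal.ofNat 3).mul (RegVal.natCast n)).sub
      (RegVal.ofNat 5)).mul (((RegVal.ofNat 2).mul (s.reg_α.pow 2)).mul hσ)).mul
      (((RegVal.ofNat 4).mul (s.reg_α.pow 3)).mul hσ)) (s.reg_L.mul hw)
    have hL0 : (s.len : ℂ) * (1 + (Complex.I * ρ) ^ 2) - s.b2 * (1 - (Complex.I * ρ) ^ 2) = 0 := by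
      rw [e1, e2, hb2]; ring
    have hn5 : (3 : ℂ) * n - 5 ≠ 0 := by
      have : (5 : ℂ) ≠ 3 * n := by exact_mod_cast (by omega : 5 ≠ 3 * n)
      exact sub_ne_zero.2 this.symm
    have hα : (s.len : ℂ) * (1 + (Complex.I * ρ) ^ 2) ≠ 0 := mul_ne_zero hlc hz
    rw [hL0, zero_mul] at key
    have hzz : (Complex.I * ρ) ^ 2 ≠ 0 := by
      refine pow_ne_zero _ (mul_ne_zero Complex.I_ne_zero ?_)
      exact_mod_cast hρ0.ne'
    have hv : fibreForm₂ d s.x s.e s.e = 0 := by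
      by_contra hne
      have hne' : (4 : ℂ) * (Complex.I * ρ) ^ 2 * (fibreForm₂ d s.x s.e s.e : ℝ) ≠ 0 :=
        mul_ne_zero (mul_ne_zero (by norm_num) hzz) (Complex.ofReal_ne_zero.2 hne)
      simp only [Complex.ofReal_zero, mul_zero, zero_add] at key
      exact mul_ne_zero (mul_ne_zero hn5 (mul_ne_zero (mul_ne_zero two_ne_zero (pow_ne_zero 2 hα))
        hne')) (mul_ne_zero (mul_ne_zero (by norm_num) (pow_ne_zero 3 hα)) hne') key
    rw [hse] at hv
    simp only [map_smul, LinearMap.smul_apply, smul_eq_mul] at hv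
    exact (mul_eq_zero.1 ((mul_eq_zero.1 hv).resolve_left hr0)).resolve_left hr0
  refine ext_ev fun p => ?_
  have h0 : ev p Q.normS = 0 := by
    have hb := (Q.hb2 p.1.1 p.2.1).1
    set t := Q.bf p.1.1 p.1.2 / bsq Q.a Q.b p.1.1
    have he : Q.bf p.1.1 (p.1.2 + (-t) • Q.bv p.1.1) = 0 := by
      rw [Q.bf_add, Q.bf_smul, Q.bf_bv]; simp only [t]; field_simp; ring
    have h1 := hvan p.2.1 _ he
    have hbb := hbv (slitPt p.1.1 p.2.1 (Q.bv p.1.1) (Q.bv_ne_zero p.2.1))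
    have hby := hbv p
    have hyb := fibreForm₂_symm hd p.1.1 p.1.2 (Q.bv p.1.1)
    change fibreForm₂ d p.1.1 (Q.bv p.1.1) (Q.bv p.1.1) = 0 at hbb
    rw [hby] at hyb
    rw [hS, ev_quadratic]
    simpa [hbb, hby, hyb] using h1
  rw [normS_eq] at h0
  simpa using congrFun (Q.ip_self_eq_zero p.2.1 h0) i

/-- The spray is quadratic up to projective change. -/
theorem H_quadratic (hn : 3 ≤ n) (h : (tan U).Isotropic Q.sq.H) (i : Fin n) :
    ∃ c : Fin n → Fin n → SmoothAlg U, (∀ j k, c j k = c k j) ∧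
      Q.sq.H i = ∑ j, ∑ k, base U (c j k) * ((tan U).y j * (tan U).y k) := by
  obtain ⟨hs, τ, hr⟩ := Q.exists_tau hn h
  refine eq_sum_of_quadratic (Q.sq.euler_H i) fun j k => ?_
  rw [H_of_tau hs hr, S_eq_zero hn h hs hr, mul_zero, zero_mul, add_zero, map_add, map_add]
  refine add_mem (Q.YY_Gα_mem j k i) ?_
  simp only [Derivation.leibniz, Q.sq.Y_bu, Y_base, Q.sq.Y_α_sq, smul_eq_mul, mul_zero, zero_add,
    add_zero, Derivation.map_two_eq_zero, Q.sq.Y_yl]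
  have hbu : Q.sq.bu i ∈ (base U).range :=
    sum_mem fun l _ => mul_mem (Q.ainv_mem_range _ _) (Q.b_mem_range _)
  exact mul_mem hbu (mul_mem ⟨τ, rfl⟩ (mul_mem (ofNat_mem _ 2) (Q.a_mem_range _ _)))

end SqField
end SecondReduction

section ConnectionCurvature

variable {n : ℕ} {B : Type*} [CommRing B] [Algebra ℝ B]

lemma Matrix.map_derivation_mul {ι : Type*} [Fintype ι] (D : Derivation ℝ B B)
    (M N : Matrix ι ι B) : (M * N).map D = M.map D * N + M * N.map D := by
  ext i j
  simp only [Matrix.map_apply, Matrix.mul_apply, Matrix.add_apply, map_sum, Derivation.leibniz,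
    smul_eq_mul, ← Finset.sum_add_distrib]
  exact Finset.sum_congr rfl fun k _ => by ring

variable (n B) in
lemma exists_natCast_add_one_inv : ∃ r : B, ((n : B) + 1) * r = 1 := by
  have : ((n : ℝ) + 1) ≠ 0 := by positivity
  refine ⟨algebraMap ℝ _ ((n : ℝ) + 1)⁻¹, ?_⟩
  rw [← map_natCast (algebraMap ℝ B) n, ← map_one (algebraMap ℝ B), ← map_add, ← map_mul,
    mul_inv_cancel₀ this]

variable (B) in
lemma exists_natCast_sub_one_inv (hn : 2 ≤ n) : ∃ r : B, ((n : B) - 1) * r = 1 := by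
  have : ((n : ℝ) - 1) ≠ 0 := by
    have : (2 : ℝ) ≤ n := by exact_mod_cast hn
    linarith
  refine ⟨algebraMap ℝ _ ((n : ℝ) - 1)⁻¹, ?_⟩
  rw [← map_natCast (algebraMap ℝ B) n, ← map_one (algebraMap ℝ B), ← map_sub, ← map_mul,
    mul_inv_cancel₀ this]

/-- A divergence free quadratic vector field proportional to the position field vanishes. -/
lemma TanCalc.eq_zero_of_radial (T : TanCalc n B) {w : Fin n → B} {f : B}
    (hw : ∀ i, w i = f * T.y i) (h2 : ∀ i, T.euler (w i) = 2 * w i)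
    (hdiv : ∑ m, T.Y m (w m) = 0) (i : Fin n) : w i = 0 := by
  have e1 : ∀ m, T.Y m (T.y m * w i) = T.Y m (T.y i * w m) := fun m => by
    rw [hw, hw]; congr 1; ring
  have e2 := Finset.sum_congr rfl fun m (_ : m ∈ Finset.univ) => e1 m
  simp only [Derivation.leibniz, T.Yy, smul_eq_mul, Finset.sum_add_distrib, if_true,
    ← Finset.mul_sum, hdiv, mul_ite, mul_one, mul_zero, Finset.sum_ite_eq, Finset.mem_univ,
    Finset.sum_const, Finset.card_univ, Fintype.card_fin, nsmul_eq_mul] at e2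
  have e3 := h2 i
  rw [TanCalc.euler, TanCalc.vert_apply] at e3
  rw [e3] at e2
  obtain ⟨r, hr⟩ := exists_natCast_add_one_inv n B
  linear_combination r * e2 - w i * hr

variable (n B) in
/-- Families of derivations of `B` indexed by coordinates. -/
abbrev CoordDerivation := Fin n → Derivation ℝ B B

/-- The curvature of the connection with matrices `P k`. -/
def connCurv (D : Fin n → Derivation ℝ B B) (P : Fin n → Matrix (Fin n) (Fin n) B)
    (k j : Fin n) : Matrix (Fin n) (Fin n) B :=
  (P j).map (D k) - (P k).map (D j) + P k * P j - P j * P k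

/-- The Ricci tensor of the connection with matrices `P k`. -/
def connRic (D : Fin n → Derivation ℝ B B) (P : Fin n → Matrix (Fin n) (Fin n) B)
    (j l : Fin n) : B := ∑ i, connCurv D P i j i l

variable {D : Fin n → Derivation ℝ B B} {P : Fin n → Matrix (Fin n) (Fin n) B}

lemma connCurv_swap (k j : Fin n) : connCurv D P j k = -connCurv D P k j := by
  simp only [connCurv]; abel

lemma connCurv_apply (k j i l : Fin n) : connCurv D P k j i l = D k (P j i l) - D j (P k i l)
    + ∑ m, P k i m * P j m l - ∑ m, P j i m * P k m l := rfl

lemma connCurv_bianchi_first (hP : ∀ k i l, P k i l = P l i k) (k j i l : Fin n) :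
    connCurv D P k j i l + connCurv D P j l i k + connCurv D P l k i j = 0 := by
  simp only [connCurv_apply, hP k i l, hP j i k, hP l i j]
  have e : ∀ a b c, ∑ m, P a i m * P b m c = ∑ m, P a i m * P c m b := fun a b c =>
    Finset.sum_congr rfl fun m _ => by rw [hP b m c]
  rw [e k j l, e j l k, e l k j]
  ring

lemma connCurv_bianchi_second (hD : ∀ i j f, D i (D j f) = D j (D i f)) (m k j : Fin n) :
    ((connCurv D P k j).map (D m) + P m * connCurv D P k j - connCurv D P k j * P m)
    + ((connCurv D P j m).map (D k) + P k * connCurv D P j m - connCurv D P j m * P k)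
    + ((connCurv D P m k).map (D j) + P j * connCurv D P m k - connCurv D P m k * P j) = 0 := by
  have hs : ∀ (E : Derivation ℝ B B) (M N : Matrix (Fin n) (Fin n) B),
      (M - N).map E = M.map E - N.map E := fun E M N => by ext; simp
  have ha : ∀ (E : Derivation ℝ B B) (M N : Matrix (Fin n) (Fin n) B),
      (M + N).map E = M.map E + N.map E := fun E M N => by ext; simp
  have hc : ∀ i j (M : Matrix (Fin n) (Fin n) B), (M.map (D j)).map (D i)
      = (M.map (D i)).map (D j) := fun i j M => by ext; simp [hD i j]
  simp only [connCurv, hs, ha, Matrix.map_derivation_mul]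
  rw [hc m k (P j), hc k j (P m), hc j m (P k)]
  noncomm_ring

lemma connCurv_trace (hT : ∀ k, (P k).trace = 0) (k j : Fin n) : (connCurv D P k j).trace = 0 := by
  have h : ∀ E : Derivation ℝ B B, ∀ k, ((P k).map E).trace = 0 := fun E k => by
    have := congrArg E (hT k)
    simpa [Matrix.trace, map_sum] using this
  simp only [connCurv, Matrix.trace_sub, Matrix.trace_add, h, Matrix.trace_mul_comm (P k)]
  ring

lemma connRic_symm (hP : ∀ k i l, P k i l = P l i k) (hT : ∀ k, (P k).trace = 0) (j l : Fin n) :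
    connRic D P j l = connRic D P l j := by
  have h : ∑ i, (connCurv D P i j i l + connCurv D P j l i i + connCurv D P l i i j) = 0 :=
    Finset.sum_eq_zero fun i _ => connCurv_bianchi_first hP i j i l
  rw [Finset.sum_add_distrib, Finset.sum_add_distrib] at h
  have ht : ∑ i, connCurv D P j l i i = 0 := connCurv_trace hT j l
  simp only [connCurv_swap _ l, Matrix.neg_apply, Finset.sum_neg_distrib] at h
  rw [ht] at h
  simp only [connRic]
  linear_combination h

/-- A curvature tensor whose symmetrization is that of constant curvature type is of constant
curvature type. -/
lemma connCurv_eq_of_symmetrized (hP : ∀ k i l, P k i l = P l i k) {S : Fin n → Fin n → B}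
    (hS : ∀ j l, S j l = S l j)
    (h : ∀ k j i l, connCurv D P k j i l + connCurv D P k l i j
      = 2 * (if i = k then S j l else 0) - (if i = j then S k l else 0)
        - (if i = l then S k j else 0)) (k j i l : Fin n) :
    connCurv D P k j i l = (if i = k then S j l else 0) - (if i = j then S k l else 0) := by
  have b := connCurv_bianchi_first (D := D) hP k j i l
  have h1 := h k j i l
  have h2 := h j l i k
  have h3 := h l k i j
  have s : ∀ a b c, connCurv D P a b i c = -connCurv D P b a i c := fun a b c => by
    rw [connCurv_swap b a]; rfl
  rw [s k l j] at h1
  rw [s j k l] at h2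
  rw [s l j k] at h3
  rw [hS l k, hS j k] at *
  have key : (3 : B) * (connCurv D P k j i l - ((if i = k then S j l else 0)
      - (if i = j then S k l else 0))) = 0 := by
    rw [hS l j] at h3
    linear_combination b + h1 - h2
  have h3' : (algebraMap ℝ B 3⁻¹) * 3 = 1 := by
    rw [← map_ofNat (algebraMap ℝ B) 3, ← map_mul]; norm_num
  rw [← sub_eq_zero, ← one_mul (connCurv D P k j i l - _), ← h3', mul_assoc, key, mul_zero]

/-- The Codazzi equation for the Schouten tensor of a connection of constant curvature type. -/
lemma codazzi (hn : 3 ≤ n) (hD : ∀ i j f, D i (D j f) = D j (D i f))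
    (hP : ∀ k i l, P k i l = P l i k) {S : Fin n → Fin n → B}
    (h : ∀ k j i l, connCurv D P k j i l
      = (if i = k then S j l else 0) - (if i = j then S k l else 0)) (m j l : Fin n) :
    D m (S j l) - ∑ p, S j p * P m p l = D j (S m l) - ∑ p, S m p * P j p l := by
  obtain ⟨k, hk⟩ : ∃ k : Fin n, k ∉ ({m, j} : Finset (Fin n)) := by
    by_contra! hc
    have h1 := Finset.card_le_card (fun x _ => hc x : (Finset.univ : Finset (Fin n)) ⊆ {m, j})
    have h2 := Finset.card_le_two (a := m) (b := j)
    simp at h1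
    omega
  simp only [Finset.mem_insert, Finset.mem_singleton, not_or] at hk
  have b := congrFun (congrFun (connCurv_bianchi_second (P := P) hD m k j) k) l
  simp only [Matrix.add_apply, Matrix.sub_apply, Matrix.map_apply, Matrix.mul_apply, h, hk.1, hk.2,
    if_true, if_false, mul_sub, mul_ite, mul_zero, zero_mul, map_neg, map_zero, neg_mul,
    Finset.sum_sub_distrib, Finset.sum_ite_eq', Finset.mem_univ, Finset.sum_neg_distrib,
    Finset.sum_const_zero, sub_zero, zero_sub, Matrix.zero_apply] at b
  rw [hP m k j, hP k k j, hP k k m] at b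
  linear_combination b

end ConnectionCurvature

section QuadraticSpray

open TopologicalSpace SmoothAlg

variable {n : ℕ} {U : Opens (Vec n)}

/-- The fibrewise linear function with coefficients `q`. -/
def linFn (q : Fin n → SmoothAlg U) : SmoothAlg (slit U) := ∑ l, base U (q l) * (tan U).y l

/-- The fibrewise quadratic function with coefficients `q`. -/
def quadFn (q : Fin n → Fin n → SmoothAlg U) : SmoothAlg (slit U) :=
  ∑ j, ∑ l, base U (q j l) * ((tan U).y j * (tan U).y l)

/-- The derivations of `SmoothAlg U` along the coordinates. -/
def pder : CoordDerivation n (SmoothAlg U) := fun k => dir (Pi.single k 1)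

lemma pder_comm (i j : Fin n) (f : SmoothAlg U) : pder i (pder j f) = pder j (pder i f) :=
  dir_comm _ _ _

lemma X_base' (k : Fin n) (f : SmoothAlg U) : (tan U).X k (base U f) = base U (pder k f) :=
  X_base k f

lemma quadFn_eq (q : Fin n → Fin n → SmoothAlg U) :
    quadFn q = ∑ j, (tan U).y j * linFn (q j) := by
  simp only [quadFn, linFn, Finset.mul_sum]
  exact Finset.sum_congr rfl fun j _ => Finset.sum_congr rfl fun l _ => by ring

lemma linFn_mul (p q : Fin n → SmoothAlg U) :
    linFn p * linFn q = quadFn fun j l => p j * q l := by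
  simp only [quadFn, linFn, Finset.sum_mul_sum, map_mul]
  exact Finset.sum_congr rfl fun j _ => Finset.sum_congr rfl fun l _ => by ring

lemma quadFn_add (p q : Fin n → Fin n → SmoothAlg U) :
    quadFn (fun j l => p j l + q j l) = quadFn p + quadFn q := by
  simp only [quadFn, map_add, add_mul, Finset.sum_add_distrib]

lemma quadFn_sub (p q : Fin n → Fin n → SmoothAlg U) :
    quadFn (fun j l => p j l - q j l) = quadFn p - quadFn q := by
  simp only [quadFn, map_sub, sub_mul, Finset.sum_sub_distrib]

lemma quadFn_smul (r : SmoothAlg U) (q : Fin n → Fin n → SmoothAlg U) :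
    quadFn (fun j l => r * q j l) = base U r * quadFn q := by
  simp only [quadFn, map_mul, Finset.mul_sum, mul_assoc]

lemma quadFn_sum {ι : Type*} (s : Finset ι) (q : ι → Fin n → Fin n → SmoothAlg U) :
    quadFn (fun j l => ∑ m ∈ s, q m j l) = ∑ m ∈ s, quadFn (q m) := by
  simp only [quadFn, map_sum, Finset.sum_mul]
  rw [Finset.sum_comm]
  conv_rhs => rw [Finset.sum_comm]
  rw [Finset.sum_comm]
  exact Finset.sum_congr rfl fun j _ => Finset.sum_comm

lemma quadFn_swap (q : Fin n → Fin n → SmoothAlg U) : quadFn (fun j l => q l j) = quadFn q := by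
  rw [quadFn, Finset.sum_comm]
  exact Finset.sum_congr rfl fun j _ => Finset.sum_congr rfl fun l _ => by ring

lemma linFn_smul (r : SmoothAlg U) (q : Fin n → SmoothAlg U) :
    linFn (fun l => r * q l) = base U r * linFn q := by
  simp only [linFn, map_mul, Finset.mul_sum, mul_assoc]

lemma linFn_add (p q : Fin n → SmoothAlg U) :
    linFn (fun l => p l + q l) = linFn p + linFn q := by
  simp only [linFn, map_add, add_mul, Finset.sum_add_distrib]

lemma Y_linFn (m : Fin n) (q : Fin n → SmoothAlg U) : (tan U).Y m (linFn q) = base U (q m) := by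
  simp [linFn, Y_base, (tan U).Yy]

lemma X_linFn (k : Fin n) (q : Fin n → SmoothAlg U) :
    (tan U).X k (linFn q) = linFn fun l => pder k (q l) := by
  simp only [linFn, map_sum, Derivation.leibniz, X_base', (tan U).Xy, smul_eq_mul, mul_zero,
    zero_add]
  exact Finset.sum_congr rfl fun l _ => mul_comm _ _

lemma Y_quadFn (m : Fin n) (q : Fin n → Fin n → SmoothAlg U) :
    (tan U).Y m (quadFn q) = linFn fun l => q m l + q l m := by
  rw [quadFn_eq, linFn_add]
  simp only [map_sum, Derivation.leibniz, Y_linFn, smul_eq_mul, (tan U).Yy,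
    Finset.sum_add_distrib, mul_ite, mul_one, mul_zero, Finset.sum_ite_eq', Finset.mem_univ,
    if_true]
  rw [add_comm]
  congr 1
  exact Finset.sum_congr rfl fun l _ => mul_comm _ _

lemma X_quadFn (k : Fin n) (q : Fin n → Fin n → SmoothAlg U) :
    (tan U).X k (quadFn q) = quadFn fun j l => pder k (q j l) := by
  simp [quadFn_eq, X_linFn, (tan U).Xy]

lemma hor_linFn (q : Fin n → SmoothAlg U) :
    (tan U).hor (linFn q) = quadFn fun j l => pder j (q l) := by
  simp only [TanCalc.hor_apply, X_linFn, quadFn_eq]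

lemma euler_linFn (q : Fin n → SmoothAlg U) : (tan U).euler (linFn q) = linFn q := by
  rw [TanCalc.euler, TanCalc.vert_apply]
  simp only [Y_linFn]
  exact Finset.sum_congr rfl fun l _ => mul_comm _ _

lemma euler_quadFn (q : Fin n → Fin n → SmoothAlg U) :
    (tan U).euler (quadFn q) = 2 * quadFn q := by
  rw [quadFn_eq, map_sum, Finset.mul_sum]
  refine Finset.sum_congr rfl fun j _ => ?_
  rw [Derivation.leibniz, euler_linFn, (tan U).euler_coord, smul_eq_mul, smul_eq_mul]
  ring

lemma base_half_mul (q : SmoothAlg U) : half (SmoothAlg (slit U)) * base U (q + q) = base U q := by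
  rw [← two_mul, map_mul, map_ofNat]
  linear_combination base U q * two_mul_half (A := SmoothAlg (slit U))

/-- The geodesic spray of the connection with matrices `P k`. -/
def connSpray (P : Fin n → Matrix (Fin n) (Fin n) (SmoothAlg U)) (i : Fin n) :
    SmoothAlg (slit U) := half _ * quadFn fun j k => P j i k

variable {P : Fin n → Matrix (Fin n) (Fin n) (SmoothAlg U)}

lemma Y_connSpray (hP : ∀ k i l, P k i l = P l i k) (k i : Fin n) :
    (tan U).Y k (connSpray P i) = linFn (P k i) := by
  rw [connSpray, Derivation.leibniz, Derivation.map_half, Y_quadFn, smul_zero, add_zero,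
    smul_eq_mul, linFn, linFn, Finset.mul_sum]
  refine Finset.sum_congr rfl fun l _ => ?_
  rw [hP l i k, ← mul_assoc, base_half_mul]

lemma euler_connSpray (i : Fin n) : (tan U).euler (connSpray P i) = 2 * connSpray P i := by
  rw [connSpray, Derivation.leibniz, Derivation.map_half, euler_quadFn, smul_zero, add_zero,
    smul_eq_mul]
  ring

lemma curv_connSpray (hP : ∀ k i l, P k i l = P l i k) (i k : Fin n) :
    (tan U).curv (connSpray P) i k = quadFn fun j l => connCurv pder P k j i l := by
  have h2 := two_mul_half (A := SmoothAlg (slit U))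
  have e1 : 2 * (tan U).X k (connSpray P i) = quadFn fun j l => pder k (P j i l) := by
    rw [connSpray, Derivation.leibniz, Derivation.map_half, X_quadFn, smul_zero, add_zero,
      smul_eq_mul]
    linear_combination (quadFn fun j l => pder k (P j i l)) * h2
  have e2 : 2 * (tan U).vert (connSpray P) (linFn (P k i))
      = quadFn fun j l => ∑ m, P k i m * P j m l := by
    rw [TanCalc.vert_apply, quadFn_sum, Finset.mul_sum]
    refine Finset.sum_congr rfl fun m _ => ?_
    rw [Y_linFn, connSpray, quadFn_smul]
    linear_combination (base U (P k i m) * quadFn fun j l => P j m l) * h2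
  have e3 : (tan U).vert (fun m => linFn (P k m)) (connSpray P i)
      = quadFn fun j l => ∑ m, P j i m * P k m l := by
    rw [TanCalc.vert_apply, quadFn_sum]
    refine Finset.sum_congr rfl fun m _ => ?_
    rw [Y_connSpray hP, mul_comm, linFn_mul]
    simp only [hP m i]
  simp only [TanCalc.curv, Y_connSpray hP, e1, e2, e3, hor_linFn, connCurv_apply, quadFn_add,
    quadFn_sub]

lemma exists_connSpray {H : Fin n → SmoothAlg (slit U)} (hH : ∀ i, ∃ c : Fin n → Fin n → SmoothAlg U,
    (∀ j k, c j k = c k j) ∧ H i = ∑ j, ∑ k, base U (c j k) * ((tan U).y j * (tan U).y k)) :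
    ∃ (P : Fin n → Matrix (Fin n) (Fin n) (SmoothAlg U)) (q : Fin n → SmoothAlg U),
      (∀ k i l, P k i l = P l i k) ∧ (∀ k, (P k).trace = 0) ∧
      ∀ i, H i = connSpray P i + linFn q * (tan U).y i := by
  choose c hc hHc using hH
  obtain ⟨r, hr⟩ := exists_natCast_add_one_inv n (SmoothAlg U)
  set t : Fin n → SmoothAlg U := fun k => ∑ i, 2 * c i k i
  refine ⟨fun k => Matrix.of fun i l => 2 * c i k l - r * ((if i = l then t k else 0)
    + (if i = k then t l else 0)), fun k => r * t k, fun k i l => ?_, fun k => ?_, fun i => ?_⟩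
  · simp only [Matrix.of_apply, hc i k l]; ring
  · simp only [Matrix.trace, Matrix.diag_apply, Matrix.of_apply, Finset.sum_sub_distrib,
      ← Finset.mul_sum, Finset.sum_add_distrib, if_true, Finset.sum_const, Finset.card_univ,
      Fintype.card_fin, nsmul_eq_mul, Finset.sum_ite_eq', Finset.mem_univ]
    have ht : 2 * ∑ i, c i k i = t k := Finset.mul_sum _ _ _
    rw [ht]
    linear_combination -t k * hr
  · have e1 : quadFn (fun j l => if i = l then t j else 0) = linFn t * (tan U).y i := by
      simp [quadFn, linFn, Finset.sum_mul, apply_ite (base U), mul_assoc]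
    have e2 : quadFn (fun j l => if i = j then t l else 0) = linFn t * (tan U).y i := by
      rw [← e1, ← quadFn_swap]
    have h2 := two_mul_half (A := SmoothAlg (slit U))
    simp only [connSpray, Matrix.of_apply, quadFn_sub, quadFn_add, quadFn_smul, e1, e2, map_ofNat,
      linFn_smul]
    rw [show H i = quadFn (c i) from hHc i]
    linear_combination (-quadFn (c i) + base U r * linFn t * (tan U).y i) * h2

end QuadraticSpray

section ProjectiveCurvature

open TopologicalSpace SmoothAlg

variable {n : ℕ} {U : Opens (Vec n)} {P : Fin n → Matrix (Fin n) (Fin n) (SmoothAlg U)}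

lemma base_injective (hn : 1 ≤ n) : Function.Injective (base U) := fun f g h => ext_ev fun x => by
  have h0 : (Pi.single ⟨0, hn⟩ 1 : Vec n) ≠ 0 := by simp
  have := congrArg (ev (slitPt x.1 x.2 _ h0)) h
  rw [ev_base, ev_base] at this
  exact this

lemma linFn_sum {ι : Type*} (s : Finset ι) (q : ι → Fin n → SmoothAlg U) :
    linFn (fun l => ∑ m ∈ s, q m l) = ∑ m ∈ s, linFn (q m) := by
  simp only [linFn, map_sum, Finset.sum_mul]
  exact Finset.sum_comm

lemma symmetrize_eq_zero (hn : 1 ≤ n) {q : Fin n → Fin n → SmoothAlg U} (h : quadFn q = 0)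
    (j l : Fin n) : q j l + q l j = 0 := by
  apply base_injective hn
  rw [map_zero, ← Y_linFn l fun l => q j l + q l j, ← Y_quadFn, h, map_zero, map_zero]

/-- The projective curvature tensor of an isotropic quadratic spray vanishes. -/
lemma connCurv_eq_of_isotropic (hn : 2 ≤ n) (hP : ∀ k i l, P k i l = P l i k)
    (hT : ∀ k, (P k).trace = 0) (h : (tan U).Isotropic (connSpray P)) :
    ∃ S : Fin n → Fin n → SmoothAlg U, (∀ j l, S j l = S l j) ∧ ∀ k j i l,
      connCurv pder P k j i l = (if i = k then S j l else 0) - (if i = j then S k l else 0) := by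
  obtain ⟨r, hr⟩ := exists_natCast_sub_one_inv (SmoothAlg U) hn
  obtain ⟨S, hS, hRic⟩ : ∃ S : Fin n → Fin n → SmoothAlg U, (∀ j l, S j l = S l j) ∧
      ∀ j l, connRic pder P j l = (n - 1) * S j l :=
    ⟨fun j l => r * connRic pder P j l, fun j l => congrArg _ (connRic_symm hP hT j l),
      fun j l => by rw [← mul_assoc, hr, one_mul]⟩
  refine ⟨S, hS, connCurv_eq_of_symmetrized hP hS fun k j i l => ?_⟩
  obtain ⟨a, θ, h⟩ := h
  set C : Fin n → Fin n → Fin n → Fin n → SmoothAlg U := fun i k j l =>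
    connCurv pder P k j i l - ((if i = k then S j l else 0) - (if i = j then S k l else 0)) with hC
  have hCq : ∀ i k, quadFn (C i k) = (tan U).curv (connSpray P) i k
      - (if i = k then quadFn S else 0) + linFn (S k) * (tan U).y i := fun i k => by
    have e1 : quadFn (fun j l => if i = k then S j l else 0) = if i = k then quadFn S else 0 := by
      split_ifs with hik
      · rfl
      · simp [quadFn]
    have e2 : quadFn (fun j l => if i = j then S k l else 0) = linFn (S k) * (tan U).y i := by
      rw [quadFn_eq]
      have : ∀ j, linFn (fun l => if i = j then S k l else 0) = if i = j then linFn (S k) else 0 := by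
        intro j
        split_ifs with hik
        · rfl
        · simp [linFn]
      simp only [this, mul_ite, mul_zero, Finset.sum_ite_eq, Finset.mem_univ, if_true]
      exact mul_comm _ _
    rw [curv_connSpray hP, quadFn_sub, quadFn_sub, e1, e2]
    ring
  have htr : a = quadFn S := by
    have e1 := isotropic_trace (euler_connSpray (P := P)) h
    have e2 : ∑ i, (tan U).curv (connSpray P) i i = base U (n - 1) * quadFn S := by
      simp only [curv_connSpray hP]
      rw [← quadFn_sum, ← quadFn_smul]
      congr 1
      ext1 j; ext1 l
      exact hRic j l
    rw [e1, map_sub, map_natCast, map_one] at e2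
    have hr' := congrArg (base U) hr
    rw [map_mul, map_sub, map_natCast, map_one] at hr'
    linear_combination base U r * e2 - (a - quadFn S) * hr'
  have hw : ∀ i k, quadFn (C i k) = (θ k + linFn (S k)) * (tan U).y i := fun i k => by
    rw [hCq, h, htr]
    split_ifs <;> ring
  have hdiv : ∀ k, ∑ m, (tan U).Y m (quadFn (C m k)) = 0 := fun k => by
    simp only [Y_quadFn]
    rw [← linFn_sum]
    suffices hz : ∀ l, ∑ m, (C m k m l + C m k l m) = 0 by simp [hz, linFn]
    intro l
    have t1 : ∑ m, connCurv pder P k l m m = 0 := connCurv_trace hT k l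
    have t2 : ∑ m, connCurv pder P k m m l = -connRic pder P k l := by
      rw [connRic, ← Finset.sum_neg_distrib]
      exact Finset.sum_congr rfl fun m _ => by rw [connCurv_swap]; rfl
    simp only [hC, Finset.sum_add_distrib, Finset.sum_sub_distrib, t1, t2, hRic, if_true,
      Finset.sum_ite_eq', Finset.mem_univ, Finset.sum_const, Finset.card_univ, Fintype.card_fin,
      nsmul_eq_mul]
    rw [hS l k]
    ring
  have hzero : ∀ i k, quadFn (C i k) = 0 := fun i k =>
    (tan U).eq_zero_of_radial (fun i => hw i k) (fun i => euler_quadFn _) (hdiv k) i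
  have := symmetrize_eq_zero (by omega) (hzero i k) j l
  simp only [hC] at this
  rw [hS l j] at this
  linear_combination this

/-- The geodesics of an isotropic quadratic spray are those of a projectively flat connection. -/
theorem exists_flat_system (hn : 3 ≤ n) {H : Fin n → SmoothAlg (slit U)}
    (hH : ∀ i, ∃ c : Fin n → Fin n → SmoothAlg U, (∀ j k, c j k = c k j) ∧
      H i = ∑ j, ∑ k, base U (c j k) * ((tan U).y j * (tan U).y k))
    (h : (tan U).Isotropic H) :
    ∃ (P : Fin n → Matrix (Fin n) (Fin n) (SmoothAlg U)) (S : Fin n → Fin n → SmoothAlg U)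
      (q : Fin n → SmoothAlg U), (∀ k i l, P k i l = P l i k) ∧ (∀ j l, S j l = S l j) ∧
      (∀ k j i l, connCurv pder P k j i l
        = (if i = k then S j l else 0) - (if i = j then S k l else 0)) ∧
      (∀ m j l, pder m (S j l) - ∑ p, S j p * P m p l = pder j (S m l) - ∑ p, S m p * P j p l) ∧
      ∀ i, H i = connSpray P i + linFn q * (tan U).y i := by
  obtain ⟨P, q, hP, hT, hq⟩ := exists_connSpray hH
  have hH2 : ∀ i, (tan U).euler (H i) = 2 * H i := fun i => by
    rw [hq, map_add, Derivation.leibniz, euler_connSpray, euler_linFn, (tan U).euler_coord,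
      smul_eq_mul, smul_eq_mul]
    ring
  obtain ⟨S, hS, hc⟩ := connCurv_eq_of_isotropic (by omega) hP hT
    (h.projective' hH2 (euler_linFn q) hq)
  exact ⟨P, S, q, hP, hS, hc, codazzi hn pder_comm hP hc, hq⟩

end ProjectiveCurvature

section FlatConnection

set_option maxSynthPendingDepth 3

open Set Metric

variable {E F : Type*} [NormedAddCommGroup E] [NormedSpace ℝ E]

theorem ray_mem_ball {x₀ x : E} {r : ℝ} (hx : x ∈ ball x₀ r) {t : ℝ} (ht : t ∈ Icc (0 : ℝ) 1) :
    x₀ + t • (x - x₀) ∈ ball x₀ r := by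
  rw [mem_ball_iff_norm] at hx ⊢
  rw [add_sub_cancel_left, norm_smul, Real.norm_of_nonneg ht.1]
  nlinarith [norm_nonneg (x - x₀), ht.2]

variable [NormedAddCommGroup F] [NormedSpace ℝ F]

/-- Solutions on `[0, 1]` of a linear equation whose coefficients are bounded by `1 / 2`. -/
theorem exists_linear_ode_solution [CompleteSpace F] (A : ℝ → F →L[ℝ] F)
    (hA : ContinuousOn A (Icc 0 1)) (hb : ∀ t ∈ Icc (0 : ℝ) 1, ‖A t‖ ≤ 1 / 2) (f₀ : F) :
    ∃ α : ℝ → F, α 0 = f₀ ∧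
      ∀ t ∈ Icc (0 : ℝ) 1, HasDerivWithinAt α (A t (α t)) (Icc 0 1) t := by
  have hpl : IsPicardLindelof (fun t x => A t x) (tmin := 0) (tmax := 1)
      ⟨0, by simp⟩ f₀ (‖f₀‖₊ + 1) 0 (1 / 2 * (2 * ‖f₀‖₊ + 1)) (1 / 2) := by
    refine ⟨fun t ht => ?_, fun x _ => hA.clm_apply continuousOn_const, fun t ht x hx => ?_, ?_⟩
    · have h := (A t).lipschitz.weaken (K' := 1 / 2) (by simpa [← NNReal.coe_le_coe] using hb t ht)
      exact h.lipschitzOnWith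
    · have h1 : ‖x‖ ≤ 2 * ‖f₀‖ + 1 := by
        have := norm_le_of_mem_closedBall hx
        push_cast at this
        linarith
      have h2 := (A t).le_of_opNorm_le_of_le (hb t ht) h1
      simpa using h2
    · have h : (0 : ℝ) ≤ ‖f₀‖ := norm_nonneg _
      simp
      linarith
  exact hpl.exists_eq_forall_mem_Icc_hasDerivWithinAt₀

theorem norm_comparison_le {T T' : E →L[ℝ] F →L[ℝ] F} {D : E →L[ℝ] E →L[ℝ] F →L[ℝ] F}
    {u w : E} {a : F} {t M N : ℝ} (hflat : D u w + T w ∘L T u = D w u + T u ∘L T w)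
    (hT : ‖T‖ ≤ M) (hT' : ‖T'‖ ≤ M) (hD : ‖D‖ ≤ M) (h₁ : ‖T' - T‖ ≤ M * ‖w‖)
    (h₂ : ‖T' - T - t • D w‖ ≤ M * ‖w‖ * ‖w‖) (hu : ‖u‖ ≤ 1) (huw : ‖u + w‖ ≤ 1)
    (ht : t ∈ Icc (0 : ℝ) 1) (ha : ‖a‖ ≤ N) :
    ‖T u a + (T w a + t • (D u w a + T w (T u a))) - T' (u + w) (a + t • T w a)‖ ≤
      (2 * M + 2 * M * M) * N * (‖w‖ * ‖w‖) := by
  have hf : D u w a + T w (T u a) = D w u a + T u (T w a) := by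
    simpa using congrArg (fun L : F →L[ℝ] F => L a) hflat
  have hM : 0 ≤ M := (norm_nonneg _).trans hT
  have hN : 0 ≤ N := (norm_nonneg _).trans ha
  have key : T u a + (T w a + t • (D u w a + T w (T u a))) - T' (u + w) (a + t • T w a) =
      -(t • D w w a) - t • (T' - T) u (T w a) - t • T' w (T w a)
        - (T' - T - t • D w) (u + w) a := by
    rw [hf]
    simp only [map_add, map_smul, add_apply, sub_apply, smul_apply]
    module
  have e0 : ‖T w a‖ ≤ M * ‖w‖ * N := (T w).le_of_opNorm_le_of_le (T.le_of_opNorm_le hT w) ha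
  have b1 : ‖D w w a‖ ≤ M * ‖w‖ * ‖w‖ * N :=
    (D w w).le_of_opNorm_le_of_le ((D w).le_of_opNorm_le (D.le_of_opNorm_le hD w) w) ha
  have b2 : ‖(T' - T) u (T w a)‖ ≤ M * ‖w‖ * 1 * (M * ‖w‖ * N) :=
    ((T' - T) u).le_of_opNorm_le_of_le ((T' - T).le_of_opNorm_le_of_le h₁ hu) e0
  have b3 : ‖T' w (T w a)‖ ≤ M * ‖w‖ * (M * ‖w‖ * N) :=
    (T' w).le_of_opNorm_le_of_le (T'.le_of_opNorm_le hT' w) e0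
  have b4 : ‖(T' - T - t • D w) (u + w) a‖ ≤ M * ‖w‖ * ‖w‖ * 1 * N :=
    ((T' - T - t • D w) (u + w)).le_of_opNorm_le_of_le
      ((T' - T - t • D w).le_of_opNorm_le_of_le h₂ huw) ha
  have ht' : ∀ x : F, ‖t • x‖ ≤ ‖x‖ := fun x => by
    rw [norm_smul, Real.norm_of_nonneg ht.1]
    exact mul_le_of_le_one_left (norm_nonneg x) ht.2
  rw [key]
  calc _ ≤ ‖t • D w w a‖ + ‖t • (T' - T) u (T w a)‖ + ‖t • T' w (T w a)‖
        + ‖(T' - T - t • D w) (u + w) a‖ := by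
        refine (norm_sub_le _ _).trans (add_le_add_left ((norm_sub_le _ _).trans
          (add_le_add_left ((norm_sub_le _ _).trans ?_) _)) _)
        rw [norm_neg]
    _ ≤ M * ‖w‖ * ‖w‖ * N + M * ‖w‖ * 1 * (M * ‖w‖ * N) + M * ‖w‖ * (M * ‖w‖ * N)
        + M * ‖w‖ * ‖w‖ * 1 * N :=
        add_le_add (add_le_add (add_le_add ((ht' _).trans b1) ((ht' _).trans b2))
          ((ht' _).trans b3)) b4
    _ = _ := by ring

/-- A connection form on a ball that is small in `C^{1,1}` and flat. -/
structure FlatForm (Ω : E → E →L[ℝ] F →L[ℝ] F) (x₀ : E) (r M : ℝ) where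
  DΩ : E → E →L[ℝ] E →L[ℝ] F →L[ℝ] F
  hasFDerivAt : ∀ x ∈ ball x₀ r, HasFDerivAt Ω (DΩ x) x
  norm_le : ∀ x ∈ ball x₀ r, ‖Ω x‖ ≤ M
  norm_deriv_le : ∀ x ∈ ball x₀ r, ‖DΩ x‖ ≤ M
  lipschitz : ∀ x ∈ ball x₀ r, ∀ y ∈ ball x₀ r, ‖DΩ x - DΩ y‖ ≤ M * ‖x - y‖
  radius_le : r ≤ 1
  mul_radius_le : M * r ≤ 1 / 2
  flat : ∀ x ∈ ball x₀ r, ∀ v w : E, DΩ x v w + Ω x w ∘L Ω x v = DΩ x w v + Ω x v ∘L Ω x w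

namespace FlatForm

variable {Ω : E → E →L[ℝ] F →L[ℝ] F} {x₀ : E} {r M : ℝ}

theorem exists_radial_solution [CompleteSpace F] (S : FlatForm Ω x₀ r M) {x : E} (hx : x ∈ ball x₀ r) (f₀ : F) :
    ∃ α : ℝ → F, α 0 = f₀ ∧ ∀ t ∈ Icc (0 : ℝ) 1,
      HasDerivWithinAt α (Ω (x₀ + t • (x - x₀)) (x - x₀) (α t)) (Icc 0 1) t := by
  refine exists_linear_ode_solution (fun t => Ω (x₀ + t • (x - x₀)) (x - x₀)) ?_ ?_ f₀
  · refine ContinuousOn.clm_apply ?_ continuousOn_const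
    intro t ht
    refine ContinuousAt.continuousWithinAt ?_
    refine ContinuousAt.comp (f := fun t : ℝ => x₀ + t • (x - x₀))
      (S.hasFDerivAt _ (ray_mem_ball hx ht)).continuousAt (by fun_prop)
  · intro t ht
    have h1 := S.norm_le _ (ray_mem_ball hx ht)
    rw [mem_ball_iff_norm] at hx
    have h2 := (Ω (x₀ + t • (x - x₀))).le_of_opNorm_le_of_le h1 hx.le
    exact h2.trans S.mul_radius_le

theorem norm_sub_le (S : FlatForm Ω x₀ r M) {x y : E} (hx : x ∈ ball x₀ r) (hy : y ∈ ball x₀ r) :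
    ‖Ω y - Ω x‖ ≤ M * ‖y - x‖ :=
  (convex_ball x₀ r).norm_image_sub_le_of_norm_hasFDerivWithin_le
    (fun z hz => (S.hasFDerivAt z hz).hasFDerivWithinAt) S.norm_deriv_le hx hy

theorem norm_sub_sub_le (S : FlatForm Ω x₀ r M) {x y : E} (hM : 0 ≤ M) (hx : x ∈ ball x₀ r)
    (hy : y ∈ ball x₀ r) :
    ‖Ω y - Ω x - S.DΩ x (y - x)‖ ≤ M * ‖y - x‖ * ‖y - x‖ := by
  have hseg : segment ℝ x y ⊆ ball x₀ r := (convex_ball x₀ r).segment_subset hx hy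
  refine (convex_segment x y).norm_image_sub_le_of_norm_hasFDerivWithin_le'
    (fun z hz => (S.hasFDerivAt z (hseg hz)).hasFDerivWithinAt) (fun z hz => ?_)
    (left_mem_segment ℝ x y) (right_mem_segment ℝ x y)
  refine (S.lipschitz z (hseg hz) x hx).trans (mul_le_mul_of_nonneg_left ?_ hM)
  obtain ⟨θ, ⟨h0, h1⟩, rfl⟩ := (segment_eq_image' ℝ x y ▸ hz :)
  rw [add_sub_cancel_left, norm_smul, Real.norm_of_nonneg h0]
  exact mul_le_of_le_one_left (norm_nonneg _) h1

/-- Radial solutions at `x` and `x + w` differ by `Ω x w` up to an error quadratic in `w`. -/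
theorem norm_radial_sub_le (S : FlatForm Ω x₀ r M) (hM : 1 ≤ M) {x y : E} (hx : x ∈ ball x₀ r)
    (hy : y ∈ ball x₀ r) {α β : ℝ → F} {N : ℝ} (hαβ : α 0 = β 0)
    (hα : ∀ t ∈ Icc (0 : ℝ) 1,
      HasDerivWithinAt α (Ω (x₀ + t • (x - x₀)) (x - x₀) (α t)) (Icc 0 1) t)
    (hβ : ∀ t ∈ Icc (0 : ℝ) 1,
      HasDerivWithinAt β (Ω (x₀ + t • (y - x₀)) (y - x₀) (β t)) (Icc 0 1) t)
    (hN : ∀ t ∈ Icc (0 : ℝ) 1, ‖α t‖ ≤ N) :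
    ‖β 1 - α 1 - Ω x (y - x) (α 1)‖ ≤
      (2 * M + 2 * M * M) * N / M * (Real.exp M - 1) * (‖y - x‖ * ‖y - x‖) := by
  have hM0 : 0 ≤ M := zero_le_one.trans hM
  set u := x - x₀ with hu
  set w := y - x with hw
  have huw : y - x₀ = u + w := by rw [hu, hw]; abel
  have hu1 : ‖u‖ ≤ 1 := (mem_ball_iff_norm.1 hx).le.trans S.radius_le
  have huw1 : ‖u + w‖ ≤ 1 := huw ▸ (mem_ball_iff_norm.1 hy).le.trans S.radius_le
  have hγ : ∀ t ∈ Icc (0 : ℝ) 1, HasDerivWithinAt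
      (fun t => α t + t • Ω (x₀ + t • u) w (α t))
      (Ω (x₀ + t • u) u (α t) + (Ω (x₀ + t • u) w (α t)
        + t • (S.DΩ (x₀ + t • u) u w (α t) + Ω (x₀ + t • u) w (Ω (x₀ + t • u) u (α t)))))
      (Icc 0 1) t := by
    intro t ht
    have hray : HasDerivWithinAt (fun t : ℝ => x₀ + t • u) u (Icc 0 1) t := by
      simpa using (((hasDerivAt_id t).smul_const u).const_add x₀).hasDerivWithinAt
    have h1 : HasDerivWithinAt (fun t : ℝ => Ω (x₀ + t • u)) (S.DΩ (x₀ + t • u) u) (Icc 0 1) t :=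
      (S.hasFDerivAt _ (ray_mem_ball hx ht)).comp_hasDerivWithinAt t hray
    have h2 : HasDerivWithinAt (fun t : ℝ => Ω (x₀ + t • u) w) (S.DΩ (x₀ + t • u) u w)
        (Icc 0 1) t := by
      simpa using h1.clm_apply (hasDerivWithinAt_const t _ w)
    have h3 := (hα t ht).add ((hasDerivWithinAt_id t _).smul (h2.clm_apply (hα t ht)))
    refine h3.congr_deriv ?_
    simp only [id, one_smul]
    abel
  have hmono : ∀ {δ : ℝ → F} {δ' : F} {t : ℝ}, t ∈ Ico (0 : ℝ) 1 →
      HasDerivWithinAt δ δ' (Icc 0 1) t → HasDerivWithinAt δ δ' (Ici t) t := fun ht h =>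
    h.mono_of_mem_nhdsWithin (Icc_mem_nhdsGE_of_mem ht)
  have hv : ∀ t ∈ Ico (0 : ℝ) 1,
      LipschitzOnWith M.toNNReal (fun z => Ω (x₀ + t • (u + w)) (u + w) z) univ := by
    intro t ht
    refine LipschitzWith.lipschitzOnWith
      ((Ω (x₀ + t • (u + w)) (u + w)).lipschitz.weaken ?_)
    rw [← NNReal.coe_le_coe, Real.coe_toNNReal _ hM0, coe_nnnorm]
    have := (Ω (x₀ + t • (u + w))).le_of_opNorm_le_of_le
      (S.norm_le _ (huw ▸ ray_mem_ball hy (Ico_subset_Icc_self ht))) huw1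
    simpa using this
  have main := dist_le_of_approx_trajectories_ODE_of_mem (s := fun _ => univ) (δ := 0) (εf := 0)
    (εg := (2 * M + 2 * M * M) * N * (‖w‖ * ‖w‖)) hv
    (fun t ht => (hβ t ht).continuousWithinAt)
    (fun t ht => hmono ht (hβ t (Ico_subset_Icc_self ht))) (fun t _ => by rw [huw, dist_self])
    (fun _ _ => mem_univ _) (fun t ht => (hγ t ht).continuousWithinAt)
    (fun t ht => hmono ht (hγ t (Ico_subset_Icc_self ht))) (fun t ht => ?_)
    (fun _ _ => mem_univ _) (by simp [hαβ]) 1 (by simp)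
  · rw [Real.coe_toNNReal _ hM0, gronwallBound_of_K_ne_0 (by linarith)] at main
    have hx1 : x₀ + u = x := by rw [hu]; abel
    simp only [one_smul, hx1, dist_eq_norm, ← sub_sub] at main
    refine main.trans (le_of_eq ?_)
    simp only [zero_mul, zero_add, sub_zero, mul_one]
    ring
  · have ht' := Ico_subset_Icc_self ht
    have m₀ := ray_mem_ball hx ht'
    have m₁ : x₀ + t • (u + w) ∈ ball x₀ r := huw ▸ ray_mem_ball hy ht'
    have hd : x₀ + t • (u + w) - (x₀ + t • u) = t • w := by module
    have hle : ‖t • w‖ ≤ ‖w‖ := by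
      rw [norm_smul, Real.norm_of_nonneg ht.1]
      exact mul_le_of_le_one_left (norm_nonneg _) ht'.2
    have h₁ := S.norm_sub_le m₀ m₁
    have h₂ := S.norm_sub_sub_le hM0 m₀ m₁
    rw [hd] at h₁ h₂
    rw [map_smul] at h₂
    rw [dist_eq_norm]
    refine norm_comparison_le (S.flat _ m₀ u w) (S.norm_le _ m₀) (S.norm_le _ m₁)
      (S.norm_deriv_le _ m₀) (h₁.trans ?_) (h₂.trans ?_) hu1 huw1 ht' (hN t ht') <;> gcongr

/-- Frobenius: a small flat connection form on a ball has parallel sections with any prescribed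
value at the centre. -/
theorem exists_parallel [CompleteSpace F] (S : FlatForm Ω x₀ r M) (hM : 1 ≤ M) (hr : 0 < r)
    (f₀ : F) :
    ∃ f : E → F, f x₀ = f₀ ∧ ∀ x ∈ ball x₀ r, HasFDerivAt f ((Ω x).flip (f x)) x := by
  have hex := fun x (hx : x ∈ ball x₀ r) => S.exists_radial_solution hx f₀
  choose! α h0 hα using hex
  refine ⟨fun x => α x 1, ?_, fun x hx => ?_⟩
  · have hx₀ := mem_ball_self (x := x₀) hr
    rw [← h0 x₀ hx₀]
    refine constant_of_derivWithin_zero (fun t ht => (hα x₀ hx₀ t ht).differentiableWithinAt)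
      (fun t ht => ?_) 1 (by simp)
    rw [(hα x₀ hx₀ t (Ico_subset_Icc_self ht)).derivWithin
      (uniqueDiffOn_Icc zero_lt_one t (Ico_subset_Icc_self ht))]
    simp
  · obtain ⟨N, hN⟩ := isCompact_Icc.exists_bound_of_continuousOn
      (fun t ht => (hα x hx t ht).continuousWithinAt)
    have hle : ∀ᶠ y in nhds x, ‖α y 1 - α x 1 - (Ω x).flip (α x 1) (y - x)‖ ≤
        ((2 * M + 2 * M * M) * N / M * (Real.exp M - 1)) * ‖‖y - x‖ ^ 2‖ := by
      filter_upwards [isOpen_ball.mem_nhds hx] with y hy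
      rw [ContinuousLinearMap.flip_apply, Real.norm_of_nonneg (sq_nonneg _), sq]
      exact S.norm_radial_sub_le hM hx hy ((h0 x hx).trans (h0 y hy).symm) (hα x hx) (hα y hy) hN
    refine HasFDerivAt.of_isLittleO ((Asymptotics.IsBigO.of_bound _ hle).trans_isLittleO ?_)
    exact Asymptotics.isLittleO_pow_sub_sub x one_lt_two

theorem contDiffOn_parallel (hΩ : ContDiffOn ℝ (⊤ : ℕ∞) Ω (ball x₀ r)) {f : E → F}
    (hf : ∀ x ∈ ball x₀ r, HasFDerivAt f ((Ω x).flip (f x)) x) :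
    ContDiffOn ℝ (⊤ : ℕ∞) f (ball x₀ r) := by
  refine contDiffOn_infty.2 fun n => ?_
  induction n with
  | zero =>
    exact contDiffOn_zero.2 fun x hx => (hf x hx).continuousAt.continuousWithinAt
  | succ n ih =>
    push_cast
    refine (contDiffOn_succ_iff_fderiv_of_isOpen isOpen_ball).2
      ⟨fun x hx => (hf x hx).differentiableAt.differentiableWithinAt, fun h => ?_, ?_⟩
    · simp at h
    refine ContDiffOn.congr (f := fun x => (Ω x).flip (f x)) ?_ fun x hx => (hf x hx).fderiv
    refine ContDiffOn.clm_apply (f := fun x => (Ω x).flip) ?_ ih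
    exact (ContinuousLinearMap.flipₗᵢ ℝ E F F).contDiff.comp_contDiffOn
      (hΩ.of_le (by exact_mod_cast le_top))

end FlatForm

open FlatForm in
theorem exists_flatForm {Ω : E → E →L[ℝ] F →L[ℝ] F} {U : Set E} (hU : IsOpen U)
    (hΩ : ContDiffOn ℝ (⊤ : ℕ∞) Ω U)
    (hflat : ∀ x ∈ U, ∀ v w : E, fderiv ℝ Ω x v w + Ω x w ∘L Ω x v
      = fderiv ℝ Ω x w v + Ω x v ∘L Ω x w) {x₀ : E} (hx₀ : x₀ ∈ U) :
    ∃ r M : ℝ, 0 < r ∧ 1 ≤ M ∧ ball x₀ r ⊆ U ∧ Nonempty (FlatForm Ω x₀ r M) := by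
  have hat : ContDiffAt ℝ (⊤ : ℕ∞) Ω x₀ := hΩ.contDiffAt (hU.mem_nhds hx₀)
  have hat' : ContDiffAt ℝ 1 (fderiv ℝ Ω) x₀ := hat.fderiv_right (by norm_cast)
  obtain ⟨K, t, ht, hK⟩ := hat'.exists_lipschitzOnWith
  set M : ℝ := max 1 (max (‖Ω x₀‖ + 1) (max (‖fderiv ℝ Ω x₀‖ + 1) K)) with hM
  have hM1 : 1 ≤ M := le_max_left _ _
  have e1 : ∀ᶠ x in nhds x₀, ‖Ω x‖ < ‖Ω x₀‖ + 1 :=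
    hat.continuousAt.norm.eventually_lt continuousAt_const (lt_add_one _)
  have e2 : ∀ᶠ x in nhds x₀, ‖fderiv ℝ Ω x‖ < ‖fderiv ℝ Ω x₀‖ + 1 :=
    hat'.continuousAt.norm.eventually_lt continuousAt_const (lt_add_one _)
  obtain ⟨ε, hε, hball⟩ := Metric.eventually_nhds_iff_ball.1
    (((e1.and e2).and (hU.eventually_mem hx₀)).and ht)
  have hr : 0 < min ε (1 / (2 * M)) := by positivity
  have hsub : ball x₀ (min ε (1 / (2 * M))) ⊆ ball x₀ ε := ball_subset_ball (min_le_left _ _)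
  have hle : M * min ε (1 / (2 * M)) ≤ 1 / 2 := by
    calc _ ≤ M * (1 / (2 * M)) := by gcongr; exact min_le_right _ _
      _ = 1 / 2 := by field_simp
  refine ⟨min ε (1 / (2 * M)), M, hr, hM1, fun x hx => (hball x (hsub hx)).1.2, ⟨?_⟩⟩
  refine ⟨fderiv ℝ Ω, fun x hx => ?_, fun x hx => ?_, fun x hx => ?_, fun x hx y hy => ?_, ?_, hle,
    fun x hx => hflat x (hball x (hsub hx)).1.2⟩
  · exact ((hΩ.contDiffAt (hU.mem_nhds (hball x (hsub hx)).1.2)).differentiableAt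
      (by simp)).hasFDerivAt
  · exact (hball x (hsub hx)).1.1.1.le.trans (by simp [hM])
  · exact (hball x (hsub hx)).1.1.2.le.trans (by simp [hM])
  · exact (hK.norm_sub_le (hball x (hsub hx)).2 (hball y (hsub hy)).2).trans
      (by gcongr; simp [hM])
  · nlinarith

/-- Local parallel sections of a smooth flat connection on a trivial bundle. -/
theorem exists_parallel_of_flat [CompleteSpace F] {Ω : E → E →L[ℝ] F →L[ℝ] F} {U : Set E}
    (hU : IsOpen U) (hΩ : ContDiffOn ℝ (⊤ : ℕ∞) Ω U)
    (hflat : ∀ x ∈ U, ∀ v w : E, fderiv ℝ Ω x v w + Ω x w ∘L Ω x v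
      = fderiv ℝ Ω x w v + Ω x v ∘L Ω x w) {x₀ : E} (hx₀ : x₀ ∈ U) :
    ∃ r : ℝ, 0 < r ∧ ball x₀ r ⊆ U ∧ ∀ f₀ : F, ∃ f : E → F, f x₀ = f₀ ∧
      ContDiffOn ℝ (⊤ : ℕ∞) f (ball x₀ r) ∧
      ∀ x ∈ ball x₀ r, HasFDerivAt f ((Ω x).flip (f x)) x := by
  obtain ⟨r, M, hr, hM, hsub, ⟨S⟩⟩ := exists_flatForm hU hΩ hflat hx₀
  refine ⟨r, hr, hsub, fun f₀ => ?_⟩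
  obtain ⟨f, h0, hf⟩ := S.exists_parallel hM hr f₀
  exact ⟨f, h0, FlatForm.contDiffOn_parallel (hΩ.mono hsub) hf, hf⟩

end FlatConnection

section LinearSystem

set_option maxSynthPendingDepth 3

open TopologicalSpace SmoothAlg

variable {n : ℕ} {ι : Type*} [DecidableEq ι] {U : Opens (Vec n)}

/-- The elementary connection form with a single coefficient. -/
def elemForm (k : Fin n) (a b : ι) : Vec n →L[ℝ] (ι → ℝ) →L[ℝ] (ι → ℝ) :=
  (ContinuousLinearMap.proj (R := ℝ) (φ := fun _ : Fin n => ℝ) k).smulRight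
    ((ContinuousLinearMap.proj (R := ℝ) (φ := fun _ : ι => ℝ) a).smulRight
      (Pi.single b (1 : ℝ) : ι → ℝ))

lemma elemForm_apply (k : Fin n) (a b : ι) (v : Vec n) (f : ι → ℝ) (i : ι) :
    elemForm k a b v f i = v k * f a * if i = b then 1 else 0 := by
  simp [elemForm, Pi.single_apply]

variable [Fintype ι]

/-- The connection form with coefficient matrices `B k`. -/
def matrixForm (B : Fin n → Matrix ι ι (SmoothAlg U)) (x : Vec n) :
    Vec n →L[ℝ] (ι → ℝ) →L[ℝ] (ι → ℝ) :=
  ∑ k, ∑ a, ∑ b, toFn (B k a b) x • elemForm k a b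

lemma matrixForm_apply (B : Fin n → Matrix ι ι (SmoothAlg U)) (x v : Vec n) (f : ι → ℝ) (i : ι) :
    matrixForm B x v f i = ∑ k, v k * ∑ a, toFn (B k a i) x * f a := by
  simp only [matrixForm, sum_apply, Finset.sum_apply, smul_apply,
    Pi.smul_apply, elemForm_apply, smul_eq_mul]
  simp [Finset.mul_sum, mul_left_comm]

lemma contDiffOn_matrixForm (B : Fin n → Matrix ι ι (SmoothAlg U)) :
    ContDiffOn ℝ (⊤ : ℕ∞) (matrixForm B) U := by
  unfold matrixForm
  exact ContDiffOn.sum fun k _ => ContDiffOn.sum fun a _ => ContDiffOn.sum fun b _ =>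
    (contDiffOn_toFn (B k a b)).smul contDiffOn_const

lemma fderiv_matrixForm_apply (B : Fin n → Matrix ι ι (SmoothAlg U)) (x : U) (v w : Vec n)
    (f : ι → ℝ) (i : ι) :
    fderiv ℝ (matrixForm B) x v w f i
      = ∑ k, w k * ∑ a, (∑ j, v j * ev x (pder j (B k a i))) * f a := by
  have h : HasFDerivAt (matrixForm B)
      (∑ k, ∑ a, ∑ b, (fderiv ℝ (toFn (B k a b)) x).smulRight (elemForm k a b)) x := by
    unfold matrixForm
    exact HasFDerivAt.fun_sum fun k _ => HasFDerivAt.fun_sum fun a _ => HasFDerivAt.fun_sum fun b _ =>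
      (differentiableAt_toFn (B k a b) x).hasFDerivAt.smul_const (elemForm k a b)
  have hv : ∀ g : SmoothAlg U, fderiv ℝ (toFn g) x v = ∑ j, v j * ev x (pder j g) := fun g => by
    conv_lhs => rw [← sum_single_smul v]
    simp only [map_sum, map_smul, smul_eq_mul]
    rfl
  rw [h.fderiv]
  simp only [sum_apply, Finset.sum_apply, smul_apply, ContinuousLinearMap.smulRight_apply,
    Pi.smul_apply, elemForm_apply, smul_eq_mul, hv]
  refine Finset.sum_congr rfl fun k _ => ?_
  rw [Finset.mul_sum]
  refine Finset.sum_congr rfl fun a _ => ?_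
  rw [Finset.sum_eq_single i (fun b _ hb => by rw [if_neg hb.symm]; ring) (by simp), if_pos rfl]
  ring

lemma matrixForm_flat_apply (B : Fin n → Matrix ι ι (SmoothAlg U)) (x : U) (v w : Vec n)
    (f : ι → ℝ) (i : ι) :
    (fderiv ℝ (matrixForm B) x v w + matrixForm B x w ∘L matrixForm B x v) f i
      = ∑ j, ∑ k, v j * w k * ∑ a, ev x (pder j (B k a i) + ∑ c, B j a c * B k c i) * f a := by
  rw [add_apply, Pi.add_apply, fderiv_matrixForm_apply, ContinuousLinearMap.comp_apply,
    matrixForm_apply]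
  simp only [matrixForm_apply, toFn_coe, map_add, map_sum, map_mul, add_mul, mul_add,
    Finset.sum_add_distrib, Finset.mul_sum, Finset.sum_mul]
  congr 1
  · rw [Finset.sum_congr rfl fun k _ => Finset.sum_comm, Finset.sum_comm]
    exact Finset.sum_congr rfl fun j _ => Finset.sum_congr rfl fun k _ =>
      Finset.sum_congr rfl fun a _ => by ring
  · rw [Finset.sum_congr rfl fun k _ => Finset.sum_comm, Finset.sum_comm]
    refine Finset.sum_congr rfl fun j _ => Finset.sum_congr rfl fun k _ => ?_
    rw [Finset.sum_comm]
    exact Finset.sum_congr rfl fun a _ => Finset.sum_congr rfl fun c _ => by ring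

/-- Local solvability of a completely integrable linear system with smooth coefficients. -/
theorem exists_linear_system_solution (B : Fin n → Matrix ι ι (SmoothAlg U))
    (hB : ∀ j k a i, pder j (B k a i) + ∑ c, B j a c * B k c i
      = pder k (B j a i) + ∑ c, B k a c * B j c i) (x₀ : U) :
    ∃ V : Opens (Vec n), V ≤ U ∧ (x₀ : Vec n) ∈ V ∧ ∀ f₀ : ι → ℝ, ∃ f : Vec n → ι → ℝ, f x₀ = f₀ ∧
      ContDiffOn ℝ (⊤ : ℕ∞) f V ∧
      ∀ x ∈ V, ∀ v i, fderiv ℝ f x v i = ∑ k, v k * ∑ a, toFn (B k a i) x * f x a := by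
  have hflat : ∀ x ∈ U, ∀ v w : Vec n, fderiv ℝ (matrixForm B) x v w
      + matrixForm B x w ∘L matrixForm B x v = fderiv ℝ (matrixForm B) x w v
      + matrixForm B x v ∘L matrixForm B x w := by
    intro x hx v w
    ext f i
    refine (matrixForm_flat_apply B ⟨x, hx⟩ v w f i).trans
      (Eq.trans ?_ (matrixForm_flat_apply B ⟨x, hx⟩ w v f i).symm)
    rw [Finset.sum_comm]
    exact Finset.sum_congr rfl fun k _ => Finset.sum_congr rfl fun j _ => by
      simp only [hB j k, mul_comm (v j)]
  obtain ⟨r, hr, hsub, h⟩ :=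
    exists_parallel_of_flat U.isOpen (contDiffOn_matrixForm B) hflat x₀.2
  refine ⟨⟨Metric.ball x₀ r, Metric.isOpen_ball⟩, hsub, Metric.mem_ball_self hr, fun f₀ => ?_⟩
  obtain ⟨f, h0, hs, hf⟩ := h f₀
  refine ⟨f, h0, hs, fun x hx v i => ?_⟩
  rw [(hf x hx).fderiv, ContinuousLinearMap.flip_apply, matrixForm_apply]

end LinearSystem

section Restriction

open TopologicalSpace SmoothAlg

variable {E : Type*} [NormedAddCommGroup E] [NormedSpace ℝ E]

/-- Restriction of smooth functions to a smaller open set. -/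
def SmoothAlg.res {Ω Ω' : Opens E} (h : Ω' ≤ Ω) : SmoothAlg Ω →ₐ[ℝ] SmoothAlg Ω' where
  toFun f := mk (toFn f) ((contDiffOn_toFn f).mono h)
  map_one' := ext_ev fun p : Ω' => by
    rw [ev_mk, map_one, toFn_coe (1 : SmoothAlg Ω) (⟨p, h p.2⟩ : Ω), map_one]
  map_zero' := ext_ev fun p : Ω' => by
    rw [ev_mk, map_zero, toFn_coe (0 : SmoothAlg Ω) (⟨p, h p.2⟩ : Ω), map_zero]
  map_mul' f g := ext_ev fun p : Ω' => by
    rw [ev_mk, map_mul, ev_mk, ev_mk, toFn_coe _ (⟨p, h p.2⟩ : Ω), map_mul, toFn_coe f (⟨p, h p.2⟩ : Ω),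
      toFn_coe g (⟨p, h p.2⟩ : Ω)]
  map_add' f g := ext_ev fun p : Ω' => by
    rw [ev_mk, map_add, ev_mk, ev_mk, toFn_coe _ (⟨p, h p.2⟩ : Ω), map_add, toFn_coe f (⟨p, h p.2⟩ : Ω),
      toFn_coe g (⟨p, h p.2⟩ : Ω)]
  commutes' r := ext_ev fun p : Ω' => by
    rw [ev_mk, AlgHom.commutes, toFn_coe _ (⟨p, h p.2⟩ : Ω), AlgHom.commutes]

lemma SmoothAlg.ev_res {Ω Ω' : Opens E} (h : Ω' ≤ Ω) (f : SmoothAlg Ω) (p : Ω') :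
    ev p (res h f) = ev (⟨p, h p.2⟩ : Ω) f := toFn_coe f (⟨p, h p.2⟩ : Ω)

variable {n : ℕ} {U V : Opens (Vec n)}

lemma slit_mono (h : V ≤ U) : slit V ≤ slit U := fun _ hp => ⟨h hp.1, hp.2⟩

lemma res_coord (h : V ≤ U) (i : Fin n) : res (slit_mono h) ((tan U).y i) = (tan V).y i := ext_ev fun p => by
  rw [ev_res, ev_y, ev_y]

lemma res_base (h : V ≤ U) (f : SmoothAlg U) :
    res (slit_mono h) (base U f) = base V (res h f) := ext_ev fun p => by
  rw [ev_res, ev_base, ev_base, ev_res]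

lemma res_connSpray (h : V ≤ U) (P : Fin n → Matrix (Fin n) (Fin n) (SmoothAlg U)) (i : Fin n) :
    res (slit_mono h) (connSpray P i) = connSpray (fun k => (P k).map (res h)) i := by
  simp only [connSpray, quadFn, half, map_mul, map_sum, AlgHom.commutes, Matrix.map_apply]
  congr 1
  refine Finset.sum_congr rfl fun j _ => Finset.sum_congr rfl fun k _ => ?_
  rw [res_base h, res_coord h, res_coord h]

end Restriction

section ProjectiveCoordinates

open TopologicalSpace SmoothAlg

variable {n : ℕ} {V : Opens (Vec n)}

lemma hor_base (f : SmoothAlg V) : (tan V).hor (base V f) = linFn fun l => pder l f := by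
  rw [TanCalc.hor_apply, linFn]
  exact Finset.sum_congr rfl fun k _ => by rw [X_base', mul_comm]

lemma two_vert_connSpray_hor_base (P : Fin n → Matrix (Fin n) (Fin n) (SmoothAlg V))
    (f : SmoothAlg V) :
    2 * (tan V).vert (connSpray P) ((tan V).hor (base V f))
      = quadFn fun j l => ∑ k, pder k f * P j k l := by
  rw [hor_base, TanCalc.vert_apply, quadFn_sum, Finset.mul_sum]
  refine Finset.sum_congr rfl fun k _ => ?_
  rw [Y_linFn, quadFn_smul, connSpray, mul_assoc, ← mul_assoc 2, two_mul_half, one_mul, mul_comm]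

/-- A ratio of solutions of the linear system with Hessian form `S` is a projective coordinate. -/
lemma projective_of_ratio {P : Fin n → Matrix (Fin n) (Fin n) (SmoothAlg V)}
    {S : Fin n → Fin n → SmoothAlg V} {f₀ g₀ φ : SmoothAlg V} (hg : f₀ * g₀ = 1)
    (h₀ : ∀ j l, pder j (pder l f₀) = ∑ k, pder k f₀ * P j k l - f₀ * S l j)
    (h₁ : ∀ j l, pder j (pder l (φ * f₀)) = ∑ k, pder k (φ * f₀) * P j k l - φ * f₀ * S l j)
    {G : Fin n → SmoothAlg (slit V)} {μ : SmoothAlg (slit V)}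
    (hG : ∀ i, G i = connSpray P i + μ * (tan V).y i) :
    2 * (tan V).vert G ((tan V).hor (base V φ)) - (tan V).hor ((tan V).hor (base V φ))
      = 2 * (μ + base V g₀ * (tan V).hor (base V f₀)) * (tan V).hor (base V φ) := by
  set D := (tan V).hor with hD
  set C := (tan V).vert (connSpray P) with hC
  have key : ∀ f : SmoothAlg V,
      (∀ j l, pder j (pder l f) = ∑ k, pder k f * P j k l - f * S l j) →
      2 * C (D (base V f)) - D (D (base V f)) = base V f * quadFn fun j l => S l j := by
    intro f hf
    rw [hC, hD, two_vert_connSpray_hor_base, hor_base, hor_linFn]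
    simp only [hf]
    rw [quadFn_sub, quadFn_smul]
    ring
  have hCb : ∀ f : SmoothAlg V, C (base V f) = 0 := fun f => by
    simp [hC, TanCalc.vert_apply, Y_base]
  have k₀ := key f₀ h₀
  have k₁ := key _ h₁
  have hg' : base V f₀ * base V g₀ = 1 := by rw [← map_mul, hg, map_one]
  have hvG : (tan V).vert G (D (base V φ)) = C (D (base V φ)) + μ * D (base V φ) := by
    have he : (tan V).euler (D (base V φ)) = D (base V φ) := by
      rw [hD, hor_base, euler_linFn]
    rw [funext hG, TanCalc.vert_add, TanCalc.vert_smul]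
    change _ + μ * (tan V).euler _ = _
    rw [he]
  rw [hvG]
  simp only [map_mul, map_add, Derivation.leibniz, smul_eq_mul, hCb, mul_zero,
    add_zero] at k₁
  linear_combination (base V g₀) * k₁ - base V g₀ * base V φ * k₀
    - (2 * C (D (base V φ)) - D (D (base V φ))) * hg'

end ProjectiveCoordinates

section Tractor

open TopologicalSpace SmoothAlg

variable {n : ℕ} {U : Opens (Vec n)}

/-- The connection matrices of the first-order form of the system
`∂ⱼ∂ᵢ f = Πᵏᵢⱼ ∂ₖ f - Sᵢⱼ f`. -/
def tractorMatrix (P : Fin n → Matrix (Fin n) (Fin n) (SmoothAlg U))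
    (S : Fin n → Fin n → SmoothAlg U) (k : Fin n) :
    Matrix (Option (Fin n)) (Option (Fin n)) (SmoothAlg U) := fun a i =>
  match a, i with
  | some a, some i => P k a i
  | none, some i => -S i k
  | some a, none => if a = k then 1 else 0
  | none, none => 0

variable {P : Fin n → Matrix (Fin n) (Fin n) (SmoothAlg U)} {S : Fin n → Fin n → SmoothAlg U}

lemma tractorMatrix_flat (hP : ∀ k i l, P k i l = P l i k) (hS : ∀ j l, S j l = S l j)
    (hcurv : ∀ k j i l, connCurv pder P k j i l
      = (if i = k then S j l else 0) - (if i = j then S k l else 0))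
    (hcod : ∀ m j l, pder m (S j l) - ∑ p, S j p * P m p l
      = pder j (S m l) - ∑ p, S m p * P j p l) (j k : Fin n) (a i : Option (Fin n)) :
    pder j (tractorMatrix P S k a i) + ∑ c, tractorMatrix P S j a c * tractorMatrix P S k c i
      = pder k (tractorMatrix P S j a i)
        + ∑ c, tractorMatrix P S k a c * tractorMatrix P S j c i := by
  rcases a with _ | l <;> rcases i with _ | i <;>
    simp only [tractorMatrix, Fintype.sum_option]
  · simp [hS j k]
  · have h := hcod k j i
    simp only [map_neg, neg_mul, Finset.sum_neg_distrib, zero_mul, zero_add, hS i, hS _ j, hS _ k]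
    linear_combination h
  · have h0 : ∀ m : Fin n, pder m (if l = k then (1 : SmoothAlg U) else 0) = 0 := fun m => by
      split_ifs <;> simp
    have h1 : ∀ m : Fin n, pder m (if l = j then (1 : SmoothAlg U) else 0) = 0 := fun m => by
      split_ifs <;> simp
    simp [h0, h1, hP j l k]
  · have h := hcurv j k l i
    rw [connCurv_apply] at h
    rw [hS i k, hS i j]
    simp only [ite_mul, one_mul, zero_mul]
    split_ifs at h ⊢ <;> linear_combination h

/-- Local solutions of `∂ⱼ∂ᵢ f = Πᵏᵢⱼ ∂ₖ f - Sᵢⱼ f` with arbitrary one-jet at a point. -/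
theorem exists_tractor_solution (hP : ∀ k i l, P k i l = P l i k) (hS : ∀ j l, S j l = S l j)
    (hcurv : ∀ k j i l, connCurv pder P k j i l
      = (if i = k then S j l else 0) - (if i = j then S k l else 0))
    (hcod : ∀ m j l, pder m (S j l) - ∑ p, S j p * P m p l
      = pder j (S m l) - ∑ p, S m p * P j p l) (x₀ : U) :
    ∃ V : Opens (Vec n), V ≤ U ∧ (x₀ : Vec n) ∈ V ∧ ∀ (r : ℝ) (g : Vec n), ∃ f : Vec n → ℝ,
      ContDiffOn ℝ (⊤ : ℕ∞) f V ∧ f x₀ = r ∧ (∀ v, fderiv ℝ f x₀ v = ∑ k, v k * g k) ∧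
      ∀ (V' : Opens (Vec n)) (_ : V' ≤ V) (h : V' ≤ U) (hf : ContDiffOn ℝ (⊤ : ℕ∞) f V') (j l),
        pder j (pder l (mk f hf))
          = ∑ k, pder k (mk f hf) * res h (P j k l) - mk f hf * res h (S l j) := by
  obtain ⟨V, hVU, hx₀, hV⟩ :=
    exists_linear_system_solution (tractorMatrix P S) (tractorMatrix_flat hP hS hcurv hcod) x₀
  refine ⟨V, hVU, hx₀, fun r g => ?_⟩
  obtain ⟨F, hF0, hFs, hF⟩ := hV fun i => i.elim r g
  have hd : ∀ x ∈ V, ∀ v i, fderiv ℝ (fun x => F x i) x v = fderiv ℝ F x v i := fun x hx v i => by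
    have h := ((hFs.contDiffAt (V.isOpen.mem_nhds hx)).differentiableAt (by simp)).hasFDerivAt
    rw [((hasFDerivAt_pi'.1 h) i).fderiv]
    rfl
  have hnone : ∀ x ∈ V, ∀ v, fderiv ℝ (fun x => F x none) x v = ∑ k, v k * F x (some k) := by
    intro x hx v
    rw [hd x hx, hF x hx]
    refine Finset.sum_congr rfl fun k _ => ?_
    have e1 : toFn (tractorMatrix P S k none none) x = 0 := by
      rw [toFn_coe _ (⟨x, hVU hx⟩ : U)]; simp [tractorMatrix]
    have e2 : ∀ a, toFn (tractorMatrix P S k (some a) none) x = if a = k then 1 else 0 :=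
      fun a => by
        rw [toFn_coe _ (⟨x, hVU hx⟩ : U)]; simp only [tractorMatrix]; split_ifs <;> simp
    simp [Fintype.sum_option, e1, e2]
  refine ⟨fun x => F x none, contDiffOn_pi.1 hFs none, congrFun hF0 none, fun v => ?_, ?_⟩
  · rw [hnone _ hx₀, hF0]; rfl
  · intro V' hV' h hf j l
    have hl : ∀ l, ContDiffOn ℝ (⊤ : ℕ∞) (fun x => F x (some l)) V' := fun l =>
      (contDiffOn_pi.1 hFs (some l)).mono hV'
    have hp : ∀ l, pder l (mk _ hf) = mk _ (hl l) := fun l => ext_ev fun p => by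
      rw [ev_mk, pder, ev_dir (g := fun x => F x none) _ _ (fun _ => rfl), hnone _ (hV' p.2)]
      simp [Pi.single_apply]
    simp only [hp]
    refine ext_ev fun p => ?_
    rw [pder, ev_dir (g := fun x => F x (some l)) _ _ (fun _ => rfl), hd _ (hV' p.2), hF _ (hV' p.2)]
    have e1 : toFn (tractorMatrix P S j none (some l)) p = -ev p (res h (S l j)) := by
      rw [toFn_coe _ (⟨p, h p.2⟩ : U), ev_res]; simp [tractorMatrix]
    have e2 : ∀ a, toFn (tractorMatrix P S j (some a) (some l)) p = ev p (res h (P j a l)) :=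
      fun a => by rw [toFn_coe _ (⟨p, h p.2⟩ : U), ev_res]; rfl
    rw [Finset.sum_eq_single j (fun b _ hb => by simp [hb]) (by simp)]
    simp [Fintype.sum_option, e1, e2, mul_comm]
    ring

end Tractor

section InverseChart

open TopologicalSpace

variable {n : ℕ}

/-- The inverse function theorem for smooth maps, in the form of a chart. -/
theorem exists_chart {V : Opens (Vec n)} {f : Vec n → Vec n} (hf : ContDiffOn ℝ (⊤ : ℕ∞) f V)
    {x₀ : Vec n} (hx₀ : x₀ ∈ V) (hd : fderiv ℝ f x₀ = ContinuousLinearMap.id ℝ (Vec n)) :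
    ∃ V' : Opens (Vec n), V' ≤ V ∧ x₀ ∈ V' ∧ ∃ (W : Opens (Vec n)) (c : Chart V' W), c.φ = f := by
  have hat : ∀ x ∈ V, ContDiffAt ℝ (⊤ : ℕ∞) f x := fun x hx => hf.contDiffAt (V.isOpen.mem_nhds hx)
  have hder : ∀ x ∈ V, HasFDerivAt f (fderiv ℝ f x) x := fun x hx =>
    ((hat x hx).differentiableAt (by simp)).hasFDerivAt
  have h0 : HasFDerivAt f ((ContinuousLinearEquiv.refl ℝ (Vec n) : Vec n ≃L[ℝ] Vec n) :
      Vec n →L[ℝ] Vec n) x₀ := by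
    have := hder x₀ hx₀
    rw [hd] at this
    exact this
  set e := (hat x₀ hx₀).toOpenPartialHomeomorph f h0 (by simp) with he
  have hecoe : (e : Vec n → Vec n) = f := (hat x₀ hx₀).toOpenPartialHomeomorph_coe h0 (by simp)
  have hex : x₀ ∈ e.source := (hat x₀ hx₀).mem_toOpenPartialHomeomorph_source h0 (by simp)
  have hcont : ContinuousOn (fderiv ℝ f) V := hf.continuousOn_fderiv_of_isOpen V.isOpen (by simp)
  have hO : IsOpen ((V : Set (Vec n)) ∩ fderiv ℝ f ⁻¹'
      Set.range ((↑) : (Vec n ≃L[ℝ] Vec n) → Vec n →L[ℝ] Vec n)) :=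
    hcont.isOpen_inter_preimage V.isOpen ContinuousLinearEquiv.isOpen
  set O := (V : Set (Vec n)) ∩ fderiv ℝ f ⁻¹'
      Set.range ((↑) : (Vec n ≃L[ℝ] Vec n) → Vec n →L[ℝ] Vec n)
  let V' : Opens (Vec n) := ⟨e.source ∩ O, e.open_source.inter hO⟩
  let W : Opens (Vec n) := ⟨e.target ∩ e.symm ⁻¹' O, e.isOpen_inter_preimage_symm hO⟩
  have hV : V' ≤ V := fun x hx => hx.2.1
  refine ⟨V', hV, ⟨hex, hx₀, ContinuousLinearEquiv.refl ℝ _, hd.symm⟩, W,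
    { φ := f
      ψ := e.symm
      smooth_φ := hf.mono hV
      smooth_ψ := fun u hu => ?_
      maps_φ := fun x hx => ?_
      maps_ψ := fun u hu => ⟨e.map_target hu.1, hu.2⟩
      left_inv := fun x hx => ?_
      right_inv := fun u hu => ?_ }, rfl⟩
  · obtain ⟨huV, L, hL⟩ := hu.2
    refine ContDiffAt.contDiffWithinAt (e.contDiffAt_symm (f₀' := L) hu.1 ?_ ?_)
    · rw [hecoe, hL]; exact hder _ huV
    · rw [hecoe]; exact hat _ huV
  · rw [← hecoe]
    refine ⟨e.map_source hx.1, ?_⟩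
    rw [Set.mem_preimage, e.left_inv hx.1]
    exact hx.2
  · rw [← hecoe]; exact e.left_inv hx.1
  · rw [← hecoe]; exact e.right_inv hu.1

end InverseChart

section Equivalence

open TopologicalSpace SmoothAlg

variable {n : ℕ}

namespace SqField

variable {U V : Opens (Vec n)} (Q : SqField U)

/-- Restriction of a square metric to a smaller open set. -/
def restrict (h : V ≤ U) : SqField V where
  a := Q.a
  b := Q.b
  ha i j := (Q.ha i j).mono h
  hsym x hx := Q.hsym x (h hx)
  hpos x hx := Q.hpos x (h hx)
  hb i := (Q.hb i).mono h
  hb2 x hx := Q.hb2 x (h hx)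

lemma restrict_G (h : V ≤ U) (i : Fin n) :
    (Q.restrict h).sq.G i = res (slit_mono h) (Q.sq.G i) := ext_ev fun p => by
  rw [ev_res]
  exact ((Q.restrict h).represents_G i p).trans
    (Q.represents_G i ⟨p.1, slit_mono h p.2⟩).symm

/-- A square metric of scalar flag curvature is projectively flat near every point. -/
theorem exists_projective_chart (hn : 3 ≤ n) (h : (tan U).Isotropic Q.sq.G) (x₀ : U) :
    ∃ V : Opens (Vec n), V ≤ U ∧ (x₀ : Vec n) ∈ V ∧ ∃ (W : Opens (Vec n)) (c : Chart V W)
      (R : SmoothAlg (slit W)), ∀ (p : slit W) (i : Fin n),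
        geoCoeff (fun u v => sqMetric Q.a Q.b (c.ψ u) (fderiv ℝ c.ψ u v)) i p.1.1 p.1.2
          = ev p R * p.1.2 i := by
  have hH := Q.isotropic_H_iff.1 h
  obtain ⟨P, S, q, hP, hS, hcurv, hcod, hPH⟩ := exists_flat_system hn (Q.H_quadratic hn hH) hH
  obtain ⟨V, hVU, hxV, hV⟩ := exists_tractor_solution hP hS hcurv hcod x₀
  obtain ⟨f₀, hf₀, hf₀x, hf₀d, hf₀s⟩ := hV 1 0
  choose f hf hfx hfd hfs using fun i : Fin n => hV 0 (Pi.single i 1)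
  let V₁ : Opens (Vec n) := ⟨(V : Set (Vec n)) ∩ f₀ ⁻¹' {0}ᶜ,
    hf₀.continuousOn.isOpen_inter_preimage V.isOpen isOpen_compl_singleton⟩
  have hx₁ : (x₀ : Vec n) ∈ V₁ := ⟨hxV, by simp [hf₀x]⟩
  have hV₁ : V₁ ≤ V := fun x hx => hx.1
  let φ : Vec n → Vec n := fun x i => f i x / f₀ x
  have hφ : ContDiffOn ℝ (⊤ : ℕ∞) φ V₁ := contDiffOn_pi.2 fun i =>
    ((hf i).mono hV₁).div (hf₀.mono hV₁) fun x hx => hx.2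
  have hφd : fderiv ℝ φ x₀ = ContinuousLinearMap.id ℝ (Vec n) := by
    have hd : ∀ g : Vec n → ℝ, ContDiffOn ℝ (⊤ : ℕ∞) g V → DifferentiableAt ℝ g x₀ := fun g hg =>
      (hg.contDiffAt (V.isOpen.mem_nhds hxV)).differentiableAt (by simp)
    refine ContinuousLinearMap.ext fun v => funext fun i => ?_
    have h1 := (((hφ.contDiffAt (V₁.isOpen.mem_nhds hx₁)).differentiableAt (by simp))).hasFDerivAt
    have h2 := hasFDerivAt_pi'.1 h1 i
    have h3 := (h2.mul (hd f₀ hf₀).hasFDerivAt).congr_of_eventuallyEq (f₁ := f i) (by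
      filter_upwards [V₁.isOpen.mem_nhds hx₁] with x hx
      exact (div_mul_cancel₀ _ hx.2).symm)
    have h4 := congrArg (fun L : Vec n →L[ℝ] ℝ => L v) h3.fderiv
    have h5 : φ x₀ i = 0 := by simp [φ, hfx]
    simpa [hfd, h5, hf₀x, Pi.single_apply] using h4.symm
  obtain ⟨V', hV', hx', W, c, hc⟩ := exists_chart hφ hx₁ hφd
  have hV'V := hV'.trans hV₁
  have hV'U := hV'V.trans hVU
  refine ⟨V', hV'U, hx', W, c, ?_⟩
  set F₀ : SmoothAlg V' := SmoothAlg.mk f₀ (hf₀.mono hV'V) with hF₀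
  obtain ⟨g₀, hg⟩ := exists_inv F₀ fun p => by
    rw [hF₀, ev_mk]; exact (hV' p.2).2
  refine ⟨_, (Q.restrict hV'U).transport_of_projective c fun i => projective_of_ratio hg
    (S := fun l j => res hV'U (S l j)) (P := fun k => (P k).map (res hV'U))
    (hf₀s V' hV'V hV'U _) ?_ (μ := res (slit_mono hV'U) (linFn q + Q.sq.P)) ?_⟩
  · have : SmoothAlg.mk (fun x => c.φ x i) (contDiffOn_pi.1 c.smooth_φ i) * F₀
        = SmoothAlg.mk (f i) ((hf i).mono hV'V) := ext_ev fun p => by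
      have hp : f₀ p ≠ 0 := (hV' p.2).2
      rw [map_mul, hF₀, ev_mk, ev_mk, ev_mk, hc]
      exact div_mul_cancel₀ _ hp
    rw [this]
    exact hfs i V' hV'V hV'U _
  · intro i
    have : Q.sq.G i = Q.sq.H i + Q.sq.P * (tan U).y i := rfl
    rw [restrict_G Q hV'U, this, hPH, ← res_connSpray, map_add, map_add, map_mul, map_mul, map_add,
      res_coord hV'U]
    ring

end SqField

end Equivalence

/-- Theorem 1.1: an `n ≥ 3`-dimensional square metric `F = (α+β)²/α` is of scalar
flag curvature if and only if it is locally projectively flat. -/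
theorem stmt_0 {n : ℕ} (hn : 3 ≤ n) (U : Set (Vec n))
    (hU : IsOpen U) (hconn : IsConnected U)
    (a : Vec n → Matrix (Fin n) (Fin n) ℝ) (b : Vec n → Vec n)
    (ha : ∀ i j, ContDiffOn ℝ (⊤ : ℕ∞) (fun x => a x i j) U)
    (hsym : ∀ x ∈ U, (a x).IsSymm)
    (hpos : ∀ x ∈ U, (a x).PosDef)
    (hb : ∀ i, ContDiffOn ℝ (⊤ : ℕ∞) (fun x => b x i) U)
    (hb2 : ∀ x ∈ U, 0 < bsq a b x ∧ bsq a b x < 1) :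
    IsScalarFlag U (sqMetric a b) ↔ IsLocallyProjFlat U (sqMetric a b) := by
  let Q : SqField ⟨U, hU⟩ := ⟨a, b, ha, hsym, hpos, hb, hb2⟩
  refine ⟨fun h x hx => ?_, fun h => ?_⟩
  · obtain ⟨V, hVU, hxV, W, c, R, hR⟩ :=
      Q.exists_projective_chart hn ((Q.isScalarFlag_iff (by omega)).1 h) ⟨x, hx⟩
    exact ⟨V, V.isOpen, hxV, hVU, W, W.isOpen, c.φ, c.ψ, c.smooth_φ, c.smooth_ψ, c.maps_φ,
      c.maps_ψ, c.left_inv, c.right_inv, fun u v => SmoothAlg.toFn R (u, v), fun u hu v hv i => by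
        refine (hR ⟨(u, v), hu, hv⟩ i).trans (congrArg (· * v i) ?_)
        exact (SmoothAlg.toFn_coe R ⟨(u, v), hu, hv⟩).symm⟩
  · have hloc : ∀ x ∈ U, ∃ V : Set (Vec n), x ∈ V ∧ IsScalarFlag V (sqMetric a b) := by
      intro x hx
      obtain ⟨V, hV, hxV, hVU, W, hW, φ, ψ, hφ, hψ, hVW, hWV, hl, hr, P, hP⟩ := h x hx
      let c : Chart ⟨V, hV⟩ ⟨W, hW⟩ := ⟨φ, ψ, hφ, hψ, hVW, hWV, hl, hr⟩
      let QV : SqField ⟨V, hV⟩ := Q.restrict hVU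
      exact ⟨V, hxV, (QV.isScalarFlag_iff (by omega)).2
        (QV.isotropic_of_chart c fun p i => hP _ p.2.1 _ p.2.2 i)⟩
    choose V hxV K hK using hloc
    classical
    refine ⟨fun x y => if hx : x ∈ U then K x hx x y else 0, fun x hx y hy i k => ?_⟩
    simp only [dif_pos hx]
    exact hK x hx x (hxV x hx) y hy i k
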